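/- For every ε > 0 there exists an integer n_1 such that for every n ≥ n_1 and every 2-edge-colouring of the complete 5-graph K_n^{(5)}, there exist four monochromatic tight cycles (each possibly degenerate) that are pairwise vertex-disjoint and whose vertex sets together cover at least n − εn vertices. -/

import Mathlib

open Finset

/-- `W` is the vertex set of a (possibly degenerate) tight cycle all of whose edges satisfy
the predicate `E` (e.g. "is a red edge"): either `|W| < k` (degenerate case), or `W` admits a
cyclic ordering all of whose sets of `k` consecutive vertices satisfy `E`. -/
def IsTightCycleSetOn {V : Type*} [DecidableEq V] (k : ℕ) (E : Finset V → Prop)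
    (W : Finset V) : Prop :=
  W.card < k ∨
    ∃ f : ℕ → V,
      (∀ i, f (i + W.card) = f i) ∧
      (∀ i, f i ∈ W) ∧
      (∀ i j, i < W.card → j < W.card → f i = f j → i = j) ∧
      (∀ v ∈ W, ∃ i, f i = v) ∧
      (∀ i, E ((Finset.range k).image (fun j => f (i + j))))

namespace TC

theorem link_aux {W ι : Type*} [Nontrivial W] (l : W → W → ι)
    (G : SimpleGraph W) (hG : G.Connected) (hs : ∀ x y, l x y = l y x)
    (h : ∀ x y z, G.Adj x y → G.Adj x z → l x y = l x z) :
    ∃ i : ι, (∀ x, ∃ y, G.Adj x y) ∧ ∀ x y, G.Adj x y → l x y = i := by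
  have hex : ∀ x, ∃ y, G.Adj x y := fun x => hG.preconnected.exists_adj_of_nontrivial x
  obtain ⟨x0⟩ := hG.nonempty
  obtain ⟨y0, h0⟩ := hex x0
  refine ⟨l x0 y0, hex, ?_⟩
  have key : ∀ x, G.Reachable x0 x → ∀ y, G.Adj x y → l x y = l x0 y0 := by
    intro x hx
    rw [SimpleGraph.reachable_iff_reflTransGen] at hx
    induction hx with
    | refl => intro y hy; exact h _ _ _ hy h0
    | tail _ hbc ih =>
      intro y hy
      rw [h _ _ _ hy hbc.symm, hs]
      exact ih _ hbc
  intro x y hy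
  exact key x (hG.preconnected x0 x) y hy

theorem link {W ι : Type*} [Nontrivial W] (p : W → W → Bool) (l : W → W → ι)
    (hp : ∀ x y, p x y = p y x) (hs : ∀ x y, l x y = l y x)
    (h : ∀ x y z, x ≠ y → x ≠ z → p x y = p x z → l x y = l x z) :
    ∃ (χ : Bool) (i : ι), (∀ x, ∃ y, x ≠ y ∧ p x y = χ) ∧
      ∀ x y, x ≠ y → p x y = χ → l x y = i := by
  let G : SimpleGraph W :=
    { Adj := fun x y => x ≠ y ∧ p x y = true
      symm := ⟨fun x y h => ⟨h.1.symm, by rw [hp]; exact h.2⟩⟩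
      loopless := ⟨fun x h => h.1 rfl⟩ }
  have hc : ∀ x y, Gᶜ.Adj x y ↔ x ≠ y ∧ p x y = false := by
    intro x y
    simp only [SimpleGraph.compl_adj, G]
    constructor
    · rintro ⟨a, b⟩; exact ⟨a, by simpa [a] using b⟩
    · rintro ⟨a, b⟩; exact ⟨a, by simp [b]⟩
  rcases SimpleGraph.connected_or_connected_compl G with hG | hG
  · obtain ⟨i, h1, h2⟩ := link_aux l G hG hs (fun x y z a b => h x y z a.1 b.1 (a.2.trans b.2.symm))
    exact ⟨true, i, fun x => h1 x, fun x y a b => h2 x y ⟨a, b⟩⟩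
  · obtain ⟨i, h1, h2⟩ := link_aux l Gᶜ hG hs (fun x y z a b => by
      rw [hc] at a b
      exact h x y z a.1 b.1 (a.2.trans b.2.symm))
    refine ⟨false, i, fun x => ?_, fun x y a b => h2 x y ((hc _ _).2 ⟨a, b⟩)⟩
    obtain ⟨y, hy⟩ := h1 x
    exact ⟨y, (hc _ _).1 hy⟩

variable {V ι : Type*} [Fintype V] [DecidableEq V]

theorem nontriv_compl (T : Finset V) (h : T.card + 2 ≤ Fintype.card V) :
    Nontrivial {x : V // x ∉ T} := by
  rw [← Fintype.one_lt_card_iff_nontrivial, Fintype.card_subtype_compl]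
  simp
  omega

/-- structure lemma -/
theorem struct3 (hV : 10 ≤ Fintype.card V) (col : Finset V → Bool) (lab : Finset V → ι)
    (hadj : ∀ e e' : Finset V, e.card = 5 → e'.card = 5 → (e ∩ e').card = 4 →
      col e = col e' → lab e = lab e') (T : Finset V) (hT : T.card = 3) :
    ∃ (χ : Bool) (i : ι), (∀ x, x ∉ T → ∃ y, y ∉ T ∧ x ≠ y ∧ col (insert x (insert y T)) = χ) ∧
      ∀ e, e.card = 5 → T ⊆ e → col e = χ → lab e = i := by
  haveI := nontriv_compl T (by omega)
  obtain ⟨χ, i, h1, h2⟩ := link (W := {x : V // x ∉ T})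
    (fun x y => col (insert x.1 (insert y.1 T))) (fun x y => lab (insert x.1 (insert y.1 T)))
    (fun x y => by rw [Finset.insert_comm]) (fun x y => by rw [Finset.insert_comm])
    (by
      rintro ⟨x, hx⟩ ⟨y, hy⟩ ⟨z, hz⟩ hxy hxz hc
      simp only [ne_eq, Subtype.mk.injEq] at hxy hxz hc ⊢
      by_cases hyz : y = z
      · rw [hyz]
      apply hadj _ _ _ _ _ hc
      · rw [card_insert_of_notMem, card_insert_of_notMem hy, hT]; simp [hxy, hx]
      · rw [card_insert_of_notMem, card_insert_of_notMem hz, hT]; simp [hxz, hx]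
      · have : insert x (insert y T) ∩ insert x (insert z T) = insert x T := by
          ext a; simp only [mem_inter, mem_insert]; grind
        rw [this, card_insert_of_notMem hx, hT])
  refine ⟨χ, i, ?_, ?_⟩
  · intro x hx
    obtain ⟨⟨y, hy⟩, h3, h4⟩ := h1 ⟨x, hx⟩
    exact ⟨y, hy, fun h => h3 (by simp [h]), h4⟩
  · intro e he hTe hc
    have : (e \ T).card = 2 := by rw [card_sdiff_of_subset hTe]; omega
    obtain ⟨x, y, hxy, hxye⟩ := card_eq_two.1 this
    have he' : e = insert x (insert y T) := by
      rw [← sdiff_union_of_subset hTe, hxye]; ext a; simp [or_assoc]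
    have hx : x ∉ T := by
      have : x ∈ e \ T := by rw [hxye]; simp
      exact (mem_sdiff.1 this).2
    have hy : y ∉ T := by
      have : y ∈ e \ T := by rw [hxye]; simp
      exact (mem_sdiff.1 this).2
    have := h2 ⟨x, hx⟩ ⟨y, hy⟩ (by simpa using hxy)
    rw [he']
    apply this
    rw [← hc, he']

theorem struct (hV : 10 ≤ Fintype.card V) (col : Finset V → Bool) (lab : Finset V → ι)
    (hadj : ∀ e e' : Finset V, e.card = 5 → e'.card = 5 → (e ∩ e').card = 4 →
      col e = col e' → lab e = lab e') :
    ∃ (φ : Finset V → Bool) (C : Finset V → ι) (Φ : V → Bool) (Λ : Bool → ι),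
      (∀ T e, T.card = 3 → e.card = 5 → T ⊆ e → col e = φ T → lab e = C T) ∧
      (∀ T T', T.card = 3 → T'.card = 3 → (T ∩ T').card = 2 → φ T = φ T' → C T = C T') ∧
      (∀ v T, T.card = 3 → v ∈ T → φ T = Φ v → C T = Λ (Φ v)) := by
  haveI : Nonempty ι := ⟨lab ∅⟩
  have h3 := struct3 hV col lab hadj
  choose! φ C hA hB using h3
  have S1 : ∀ T e, T.card = 3 → e.card = 5 → T ⊆ e → col e = φ T → lab e = C T :=
    fun T e h1 h2 h3 h4 => hB T h1 e h2 h3 h4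
  have S2 : ∀ T T', T.card = 3 → T'.card = 3 → (T ∩ T').card = 2 → φ T = φ T' → C T = C T' := by
    intro T T' hT hT' hI hφ
    have : (T' \ T).Nonempty := by
      rw [← card_pos]
      have := card_sdiff_add_card_inter T' T
      rw [inter_comm] at this; omega
    obtain ⟨y, hy⟩ := this
    rw [mem_sdiff] at hy
    obtain ⟨p, hp, hyp, hc⟩ := hA T hT y hy.2
    have hc5 : (insert y (insert p T)).card = 5 := by
      rw [card_insert_of_notMem, card_insert_of_notMem hp, hT]; simp [hyp, hy.2]
    rw [← S1 T _ hT hc5 (by intro a; simp; tauto) hc]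
    refine S1 T' _ hT' hc5 ?_ (hc.trans hφ)
    have h1 : (T' \ T).card = 1 := by
      have := card_sdiff_add_card_inter T' T
      rw [inter_comm] at this; omega
    intro a ha
    by_cases haT : a ∈ T
    · simp [haT]
    · have := card_le_one.1 h1.le a (by simp [ha, haT]) y (by simp [hy])
      simp [this]
  have hv : ∀ v : V, ∃ (χ : Bool) (i : ι),
      (∀ x, x ≠ v → ∃ y, y ≠ v ∧ x ≠ y ∧ φ {v, x, y} = χ) ∧
      ∀ T, T.card = 3 → v ∈ T → φ T = χ → C T = i := by
    intro v
    haveI := nontriv_compl {v} (by simp; omega)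
    obtain ⟨χ, i, h1, h2⟩ := link (W := {x : V // x ∉ ({v} : Finset V)})
      (fun x y => φ {v, x.1, y.1}) (fun x y => C {v, x.1, y.1})
      (fun x y => by congr 1; ext; simp; tauto) (fun x y => by congr 1; ext; simp; tauto)
      (by
        rintro ⟨x, hx⟩ ⟨y, hy⟩ ⟨z, hz⟩ hxy hxz hc
        simp only [ne_eq, Subtype.mk.injEq, mem_singleton] at hx hy hz hxy hxz hc ⊢
        by_cases hyz : y = z
        · rw [hyz]
        apply S2 _ _ _ _ _ hc
        · exact card_eq_three.2 ⟨v, x, y, Ne.symm hx, Ne.symm hy, hxy, rfl⟩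
        · exact card_eq_three.2 ⟨v, x, z, Ne.symm hx, Ne.symm hz, hxz, rfl⟩
        · have : ({v, x, y} : Finset V) ∩ {v, x, z} = {v, x} := by
            ext a; simp only [mem_inter, mem_insert, mem_singleton]; grind
          rw [this, card_pair (Ne.symm hx)])
    refine ⟨χ, i, ?_, ?_⟩
    · intro x hx
      obtain ⟨⟨y, hy⟩, h3, h4⟩ := h1 ⟨x, by simpa using hx⟩
      exact ⟨y, by simpa using hy, fun h => h3 (by simp [h]), h4⟩
    · intro T hT hvT hc
      have : (T.erase v).card = 2 := by rw [card_erase_of_mem hvT]; omega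
      obtain ⟨x, y, hxy, he⟩ := card_eq_two.1 this
      have hTe : T = {v, x, y} := by rw [← insert_erase hvT, he]
      have hx : x ≠ v := by
        have : x ∈ T.erase v := by rw [he]; simp
        exact (mem_erase.1 this).1
      have hy : y ≠ v := by
        have : y ∈ T.erase v := by rw [he]; simp
        exact (mem_erase.1 this).1
      have := h2 ⟨x, by simpa using hx⟩ ⟨y, by simpa using hy⟩ (by simpa using hxy)
      rw [hTe]; apply this; rw [← hc, hTe]
  choose Φ D hD1 hD2 using hv
  refine ⟨φ, C, Φ, fun r => if h : ∃ v, Φ v = r then D h.choose else lab ∅, S1, S2, ?_⟩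
  intro v T hT hvT hc
  have hex : ∃ v', Φ v' = Φ v := ⟨v, rfl⟩
  simp only [hex, dif_pos]
  rw [hD2 v T hT hvT hc]
  have hv' := hex.choose_spec
  set v' := hex.choose
  by_cases hvv : v' = v
  · rw [hvv]
  obtain ⟨q, hq1, hq2, hq3⟩ := hD1 v v' hvv
  have hc3 : ({v, v', q} : Finset V).card = 3 :=
    card_eq_three.2 ⟨v, v', q, Ne.symm hvv, Ne.symm hq1, hq2, rfl⟩
  rw [← hD2 v _ hc3 (by simp) hq3]
  exact hD2 v' _ hc3 (by simp) (hq3.trans hv'.symm)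

end TC

namespace TC
variable {V ι : Type*} [Fintype V] [DecidableEq V]

/-- fractional matching supported on F -/
def FM (F : Finset V → Prop) (w : Finset V → ℝ) : Prop :=
  (∀ e, 0 ≤ w e) ∧ (∀ e, w e ≠ 0 → e.card = 5 ∧ F e) ∧
    ∀ v, ∑ e ∈ univ.filter (fun e => v ∈ e), w e ≤ 1

theorem FM_zero (F : Finset V → Prop) : FM F (fun _ => 0) := by
  refine ⟨fun _ => le_rfl, fun e h => absurd rfl h, fun v => by simp⟩

theorem FM_compact (F : Finset V → Prop) : IsCompact {w | FM F w} := by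
  have hsub : {w | FM F w} ⊆ Set.univ.pi (fun _ : Finset V => Set.Icc (0:ℝ) 1) := by
    intro w hw e _
    refine ⟨hw.1 e, ?_⟩
    by_contra hlt
    push Not at hlt
    have h0 : w e ≠ 0 := by linarith
    have h5 := (hw.2.1 e h0).1
    obtain ⟨v, hv⟩ : e.Nonempty := by rw [← card_pos]; omega
    have := hw.2.2 v
    have h2 : w e ≤ ∑ e ∈ univ.filter (fun e => v ∈ e), w e :=
      single_le_sum (f := w) (fun i _ => hw.1 i) (by simp [hv])
    linarith
  refine (isCompact_univ_pi (fun _ => isCompact_Icc)).of_isClosed_subset ?_ hsub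
  have : {w | FM F w} = (⋂ e, {w | 0 ≤ w e}) ∩ (⋂ e, {w | w e ≠ 0 → e.card = 5 ∧ F e}) ∩
      ⋂ v, {w | ∑ e ∈ univ.filter (fun e => v ∈ e), w e ≤ 1} := by
    ext w; simp [FM, and_assoc]
  rw [this]
  refine IsClosed.inter (IsClosed.inter ?_ ?_) ?_
  · exact isClosed_iInter fun e => isClosed_le continuous_const (continuous_apply e)
  · refine isClosed_iInter fun e => ?_
    by_cases h : e.card = 5 ∧ F e
    · simp [h]
    · simp only [h, imp_false, not_not]
      exact isClosed_eq (continuous_apply e) continuous_const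
  · exact isClosed_iInter fun v => isClosed_le
      (continuous_finsetSum _ fun e _ => continuous_apply e) continuous_const

theorem FM_max {κ : Type*} [Finite κ] [Nonempty κ] (F : κ → Finset V → Prop) :
    ∃ M w, FM (F M) w ∧ ∀ M' w', FM (F M') w' → ∑ e, w' e ≤ ∑ e, w e := by
  have hc : IsCompact (⋃ M, {w | FM (F M) w}) := isCompact_iUnion fun M => FM_compact (F M)
  have hne : (⋃ M, {w | FM (F M) w}).Nonempty := by
    obtain ⟨M⟩ := ‹Nonempty κ›
    exact ⟨fun _ => 0, Set.mem_iUnion.2 ⟨M, FM_zero _⟩⟩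
  obtain ⟨w, hw, hmax⟩ := hc.exists_isMaxOn hne (f := fun w : Finset V → ℝ => ∑ e, w e)
    (Continuous.continuousOn (continuous_finsetSum _ fun e _ => continuous_apply e))
  obtain ⟨M, hM⟩ := Set.mem_iUnion.1 hw
  exact ⟨M, w, hM, fun M' w' h => hmax (Set.mem_iUnion.2 ⟨M', h⟩)⟩

/-- uncovered (not fully loaded) vertices -/
noncomputable def unc (w : Finset V → ℝ) : Finset V := by
  classical
  exact univ.filter fun v => ∑ e ∈ univ.filter (fun e => v ∈ e), w e < 1

theorem slack (w : Finset V → ℝ) : ∃ δ : ℝ, 0 < δ ∧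
    ∀ v ∈ unc w, ∑ e ∈ univ.filter (fun e => v ∈ e), w e + δ ≤ 1 := by
  classical
  rcases (unc w).eq_empty_or_nonempty with h | h
  · exact ⟨1, one_pos, by simp [h]⟩
  · obtain ⟨v, hv, hm⟩ := exists_min_image (unc w)
      (fun v => 1 - ∑ e ∈ univ.filter (fun e => v ∈ e), w e) h
    refine ⟨1 - ∑ e ∈ univ.filter (fun e => v ∈ e), w e, ?_, fun u hu => by have := hm u hu; linarith⟩
    have := (mem_filter.1 hv).2
    linarith

theorem no_edge_unc (F : Finset V → Prop) (w : Finset V → ℝ) (hw : FM F w)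
    (hmax : ∀ w', FM F w' → ∑ e, w' e ≤ ∑ e, w e) (a : Finset V) (ha : a.card = 5)
    (hau : a ⊆ unc w) : ¬ F a := by
  intro hF
  obtain ⟨δ, hδ, hs⟩ := slack w
  have := hmax (fun e => w e + if e = a then δ else 0) ⟨?_, ?_, ?_⟩
  · simp [sum_add_distrib] at this; linarith
  · intro e; have := hw.1 e; beta_reduce; split_ifs <;> linarith
  · intro e he
    by_cases h : e = a
    · exact h ▸ ⟨ha, hF⟩
    · simp [h] at he; exact hw.2.1 e he
  · intro v
    rw [sum_add_distrib, sum_ite_eq']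
    by_cases h : v ∈ a
    · simpa [h] using hs v (hau h)
    · simpa [h] using hw.2.2 v

theorem exchange (F : Finset V → Prop) (w : Finset V → ℝ) (hw : FM F w)
    (hmax : ∀ w', FM F w' → ∑ e, w' e ≤ ∑ e, w e) (e : Finset V) (he : w e ≠ 0) :
    ∃ x ∈ e, ∀ a : Finset V, a.card = 5 → a ⊆ e.erase x ∪ unc w → ¬ F a := by
  by_contra hcon
  push Not at hcon
  choose! A hA5 hAs hAF using hcon
  obtain ⟨δ, hδ, hs⟩ := slack w
  have hpos : 0 < w e := lt_of_le_of_ne (hw.1 e) he.symm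
  have he5 := (hw.2.1 e he).1
  set t := min (w e / 4) (δ / 5) with ht
  have ht0 : 0 < t := by rw [ht]; positivity
  have ht1 : 4 * t ≤ w e := by have := min_le_left (w e / 4) (δ / 5); linarith
  have ht2 : 5 * t ≤ δ := by have := min_le_right (w e / 4) (δ / 5); linarith
  have := hmax (fun g => w g + (∑ x ∈ e, if g = A x then t else 0) - if g = e then 4 * t else 0)
    ⟨?_, ?_, ?_⟩
  · rw [sum_sub_distrib, sum_add_distrib, sum_comm] at this
    simp [he5] at this; linarith
  · intro g
    have h1 := hw.1 g
    have h2 : 0 ≤ ∑ x ∈ e, if g = A x then t else 0 :=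
      sum_nonneg fun x _ => by split_ifs <;> linarith
    by_cases h : g = e
    · subst h; simp only [if_true]; linarith
    · simp only [h, if_false]; linarith
  · intro g hg
    by_cases h : g = e
    · rw [h]; exact hw.2.1 e he
    by_cases h2 : ∃ x ∈ e, g = A x
    · obtain ⟨x, hx, rfl⟩ := h2; exact ⟨hA5 x hx, hAF x hx⟩
    · push Not at h2
      beta_reduce at hg
      rw [sum_eq_zero (fun x hx => by simp [h2 x hx])] at hg
      simp [h] at hg; exact hw.2.1 g hg
  · intro v
    rw [sum_sub_distrib, sum_add_distrib, sum_comm]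
    simp only [sum_ite_eq', mem_filter, mem_univ, true_and]
    by_cases hvu : v ∈ unc w
    · have h1 := hs v hvu
      have h2 : ∑ x ∈ e, (if v ∈ A x then t else 0) ≤ ∑ x ∈ e, t :=
        sum_le_sum fun x _ => by split_ifs <;> linarith
      rw [sum_const, he5] at h2
      have h3 : 0 ≤ if v ∈ e then 4 * t else 0 := by split_ifs <;> linarith
      simp at h2; linarith
    · have h1 := hw.2.2 v
      by_cases hve : v ∈ e
      · have h2 : ∑ x ∈ e, (if v ∈ A x then t else 0) ≤ ∑ x ∈ e.erase v, t := by
          rw [← add_sum_erase e _ hve]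
          have : v ∉ A v := fun h => by
            have := hAs v hve h; simp [hvu] at this
          simp only [this, if_false, zero_add]
          exact sum_le_sum fun x _ => by split_ifs <;> linarith
        rw [sum_const, card_erase_of_mem hve, he5] at h2
        simp [hve] at h2 ⊢; linarith
      · have h2 : ∑ x ∈ e, (if v ∈ A x then t else 0) = 0 := by
          refine sum_eq_zero fun x hx => ?_
          have : v ∉ A x := fun h => by
            have := hAs x hx h; simp [hvu, hve] at this
          simp [this]
        rw [h2]; simp [hve]; exact h1

theorem load_total (w : Finset V → ℝ) (F) (hw : FM F w) :
    (Fintype.card V : ℝ) - (unc w).card ≤ 5 * ∑ e, w e := by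
  have h1 : ∑ v, ∑ e ∈ univ.filter (fun e => v ∈ e), w e = 5 * ∑ e, w e := by
    simp_rw [sum_filter]
    rw [sum_comm, mul_sum]
    refine sum_congr rfl fun e _ => ?_
    by_cases h : w e = 0
    · simp [h]
    · rw [← sum_filter]; simp [(hw.2.1 e h).1]
  rw [← h1]
  have h2 : (Fintype.card V : ℝ) - (unc w).card = ((unc w)ᶜ.card : ℝ) := by
    rw [card_compl, Nat.cast_sub (card_le_univ _)]
  rw [h2, card_eq_sum_ones, Nat.cast_sum]
  refine le_trans ?_ (sum_le_univ_sum_of_nonneg (s := (unc w)ᶜ) ?_)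
  · refine sum_le_sum fun v hv => ?_
    simp [unc] at hv; simpa using hv
  · intro v; exact sum_nonneg fun e _ => hw.1 e
end TC

namespace TC
variable {V ι : Type*} [Fintype V] [DecidableEq V]

def FF (col : Finset V → Bool) (lab : Finset V → ι) (Λ M : Bool → ι) (e : Finset V) : Prop :=
  lab e = Λ (col e) ∨ lab e = M (col e)

section core
variable (col : Finset V → Bool) (lab : Finset V → ι)
  (φ : Finset V → Bool) (C : Finset V → ι) (Φ : V → Bool) (Λ M : Bool → ι)

def GG (r : Bool) (T : Finset V) : Prop := φ T = !r ∧ (C T = Λ (!r) ∨ C T = M (!r))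

variable
  (S1 : ∀ T e, T.card = 3 → e.card = 5 → T ⊆ e → col e = φ T → lab e = C T)
  (S2 : ∀ T T', T.card = 3 → T'.card = 3 → (T ∩ T').card = 2 → φ T = φ T' → C T = C T')
  (S3 : ∀ v T, T.card = 3 → v ∈ T → φ T = Φ v → C T = Λ (Φ v))
  (hadj : ∀ e e' : Finset V, e.card = 5 → e'.card = 5 → (e ∩ e').card = 4 →
      col e = col e' → lab e = lab e')

include S1 S3 in
theorem F1 (r : Bool) (e T : Finset V) (u : V) (he : e.card = 5) (hT : T.card = 3) (hu : u ∈ T)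
    (hTe : T ⊆ e) (hr : col e = r) (hΦ : Φ u = r) (hF : ¬ FF col lab Λ M e) : φ T = !r := by
  by_contra h
  have h' : φ T = r := by cases r <;> simpa using h
  apply hF
  left
  rw [S1 T e hT he hTe (hr.trans h'.symm), S3 u T hT hu (h'.trans hΦ.symm), hr, hΦ]

include S1 in
theorem G_col (r : Bool) (T a : Finset V) (hT : T.card = 3) (ha : a.card = 5) (hTa : T ⊆ a)
    (hG : GG φ C Λ M r T) (hF : ¬ FF col lab Λ M a) : col a = r := by
  by_contra h
  have h' : col a = !r := by cases r <;> simpa using h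
  apply hF
  unfold FF
  rw [S1 T a hT ha hTa (h'.trans hG.1.symm), h']
  exact hG.2

include S1 S2 S3 in
theorem G_step (r : Bool) (U P T T' : Finset V) (hP : ∀ a ⊆ P, a.card = 5 → ¬ FF col lab Λ M a)
    (hUP : U ⊆ P) (hU : ∀ u ∈ U, Φ u = r) (hUc : 5 ≤ U.card)
    (hT : T.card = 3) (hT' : T'.card = 3) (hTP : T ⊆ P) (hT'P : T' ⊆ P) (hI : (T ∩ T').card = 2)
    (u : V) (hu : u ∈ U) (huT : u ∈ T') (hG : GG φ C Λ M r T) : GG φ C Λ M r T' := by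
  have h4 : (T ∪ T').card = 4 := by have := card_union_add_card_inter T T'; omega
  obtain ⟨x, hxU, hx⟩ : ∃ x ∈ U, x ∉ T ∪ T' := by
    by_contra h; push Not at h
    have := card_le_card (show U ⊆ T ∪ T' from h); omega
  have ha : (insert x (T ∪ T')).card = 5 := by rw [card_insert_of_notMem hx, h4]
  have haP : insert x (T ∪ T') ⊆ P := by
    intro y hy
    rcases mem_insert.1 hy with rfl | hy
    · exact hUP hxU
    · rcases mem_union.1 hy with hy | hy
      · exact hTP hy
      · exact hT'P hy
  have hTa : T ⊆ insert x (T ∪ T') := by intro y hy; simp [hy]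
  have hTa' : T' ⊆ insert x (T ∪ T') := by intro y hy; simp [hy]
  have hc := G_col col lab φ C Λ M S1 r T _ hT ha hTa hG (hP _ haP ha)
  have hφ := F1 col lab φ C Φ Λ M S1 S3 r _ T' u ha hT' huT hTa' hc (hU u hu) (hP _ haP ha)
  refine ⟨hφ, ?_⟩
  rw [← S2 T T' hT hT' hI (hG.1.trans hφ.symm)]
  exact hG.2

include S1 S2 S3 hadj in
theorem L1 (r : Bool) (U e : Finset V) (x : V) (hx : x ∈ e) (he : e.card = 5)
    (hF : FF col lab Λ M e) (hc : col e = !r) (hd : Disjoint U e)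
    (hP : ∀ a ⊆ e.erase x ∪ U, a.card = 5 → ¬ FF col lab Λ M a)
    (hU : ∀ u ∈ U, Φ u = r) (hUc : 5 ≤ U.card) :
    ∀ T ⊆ U, T.card = 3 → GG φ C Λ M r T := by
  intro T hTU hT
  obtain ⟨u1, u2, u3, h12, h13, h23, rfl⟩ := card_eq_three.1 hT
  have hb : (e.erase x).card = 4 := by rw [card_erase_of_mem hx, he]
  have hu1 : u1 ∈ U := hTU (by simp)
  have hu2 : u2 ∈ U := hTU (by simp)
  have hu3 : u3 ∈ U := hTU (by simp)
  have hue : ∀ u ∈ U, u ∉ e := fun u hu => disjoint_left.1 hd hu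
  obtain ⟨y1, y2, y3, y4, g12, g13, g14, g23, g24, g34, hbe⟩ := card_eq_four.1 hb
  have hy : ∀ y, y ∈ e.erase x ↔ y = y1 ∨ y = y2 ∨ y = y3 ∨ y = y4 := by
    intro y; rw [hbe]; simp
  have hye : ∀ y ∈ e.erase x, y ∈ e := fun y h => mem_of_mem_erase h
  have m1 : y1 ∈ e.erase x := by rw [hy]; simp
  have m2 : y2 ∈ e.erase x := by rw [hy]; simp
  have m3 : y3 ∈ e.erase x := by rw [hy]; simp
  have k1 : u1 ≠ y1 := fun h => hue _ hu1 (h ▸ hye _ m1)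
  have k2 : u1 ≠ y2 := fun h => hue _ hu1 (h ▸ hye _ m2)
  have k3 : u1 ≠ y3 := fun h => hue _ hu1 (h ▸ hye _ m3)
  have k21 : u2 ≠ y1 := fun h => hue _ hu2 (h ▸ hye _ m1)
  have k22 : u2 ≠ y2 := fun h => hue _ hu2 (h ▸ hye _ m2)
  have k31 : u3 ≠ y1 := fun h => hue _ hu3 (h ▸ hye _ m1)
  -- edge b + u1
  have hu1b : u1 ∉ e.erase x := fun h => hue _ hu1 (hye _ h)
  have ha : (insert u1 (e.erase x)).card = 5 := by rw [card_insert_of_notMem hu1b, hb]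
  have haP : insert u1 (e.erase x) ⊆ e.erase x ∪ U := by
    intro y hy
    rcases mem_insert.1 hy with rfl | hy
    · exact mem_union_right _ hu1
    · exact mem_union_left _ hy
  have hnF := hP _ haP ha
  have hac : col (insert u1 (e.erase x)) = r := by
    by_contra h
    have h' : col (insert u1 (e.erase x)) = !r := by cases r <;> simpa using h
    apply hnF
    unfold FF
    rw [hadj _ e ha he _ (h'.trans hc.symm), h', ← hc]
    · exact hF
    · have : insert u1 (e.erase x) ∩ e = e.erase x := by
        ext y; simp only [mem_inter, mem_insert, mem_erase]
        have := hue _ hu1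
        grind
      rw [this, hb]
  have c0 : ({u1, y1, y2} : Finset V).card = 3 := card_eq_three.2 ⟨_, _, _, k1, k2, g12, rfl⟩
  have G0 : GG φ C Λ M r {u1, y1, y2} := by
    have hφ := F1 col lab φ C Φ Λ M S1 S3 r _ {u1, y1, y2} u1 ha c0 (by simp)
      (by intro y; simp only [mem_insert, mem_singleton]; rintro (h | h | h) <;> simp [h, m1, m2, -mem_erase])
      hac (hU u1 hu1) hnF
    refine ⟨hφ, ?_⟩
    by_cases hΦ : Φ y1 = r
    · have c1 : ({y1, y2, y3} : Finset V).card = 3 := card_eq_three.2 ⟨_, _, _, g12, g13, g23, rfl⟩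
      have hφ2 := F1 col lab φ C Φ Λ M S1 S3 r _ {y1, y2, y3} y1 ha c1 (by simp)
        (by intro y; simp only [mem_insert, mem_singleton]; rintro (h | h | h) <;> simp [h, m1, m2, m3, -mem_erase])
        hac hΦ hnF
      have hl := S1 {y1, y2, y3} e c1 he
        (by intro y; simp only [mem_insert, mem_singleton]; rintro (h | h | h) <;> simp [h, hye _ m1, hye _ m2, hye _ m3])
        (hc.trans hφ2.symm)
      rw [S2 {u1, y1, y2} {y1, y2, y3} c0 c1 _ (hφ.trans hφ2.symm), ← hl, ← hc]
      · exact hF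
      · have : ({u1, y1, y2} : Finset V) ∩ {y1, y2, y3} = {y1, y2} := by
          ext a; simp only [mem_inter, mem_insert, mem_singleton]; grind
        rw [this, card_pair g12]
    · have h' : Φ y1 = !r := by cases r <;> simpa using hΦ
      left
      rw [S3 y1 _ c0 (by simp) (hφ.trans h'.symm), h']
  have hUP : U ⊆ e.erase x ∪ U := subset_union_right
  have n1 : y1 ∈ e.erase x ∪ U := mem_union_left _ m1
  have n2 : y2 ∈ e.erase x ∪ U := mem_union_left _ m2
  have c1 : ({u1, u2, y1} : Finset V).card = 3 := card_eq_three.2 ⟨_, _, _, h12, k1, k21, rfl⟩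
  have G1 : GG φ C Λ M r {u1, u2, y1} := by
    refine G_step col lab φ C Φ Λ M S1 S2 S3 r U (e.erase x ∪ U) {u1, y1, y2} _ hP hUP hU hUc c0 c1
      ?_ ?_ ?_ u1 hu1 (by simp) G0
    · intro y; simp only [mem_insert, mem_singleton]; rintro (h | h | h) <;> simp [h, n1, n2, hUP hu1, -mem_union]
    · intro y; simp only [mem_insert, mem_singleton]; rintro (h | h | h) <;> simp [h, n1, hUP hu2, hUP hu1, -mem_union]
    · have : ({u1, y1, y2} : Finset V) ∩ {u1, u2, y1} = {u1, y1} := by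
        ext a; simp only [mem_inter, mem_insert, mem_singleton]; grind
      rw [this, card_pair k1]
  refine G_step col lab φ C Φ Λ M S1 S2 S3 r U (e.erase x ∪ U) {u1, u2, y1} _ hP hUP hU hUc c1 hT
      ?_ ?_ ?_ u1 hu1 (by simp) G1
  · intro y; simp only [mem_insert, mem_singleton]; rintro (h | h | h) <;> simp [h, n1, hUP hu2, hUP hu1, -mem_union]
  · exact hTU.trans hUP
  · have : ({u1, u2, y1} : Finset V) ∩ {u1, u2, u3} = {u1, u2} := by
      ext a; simp only [mem_inter, mem_insert, mem_singleton]; grind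
    rw [this, card_pair h12]

include S1 S2 S3 hadj in
theorem L2 (r : Bool) (U e : Finset V) (x : V) (hx : x ∈ e) (he : e.card = 5)
    (hF : FF col lab Λ M e) (hc : col e = r) (hd : Disjoint U e)
    (hP : ∀ a ⊆ e.erase x ∪ U, a.card = 5 → ¬ FF col lab Λ M a)
    (hU : ∀ u ∈ U, Φ u = r) (hUc : 5 ≤ U.card)
    (T : Finset V) (hTU : T ⊆ U) (hT : T.card = 3) (hG : GG φ C Λ M r T) : False := by
  obtain ⟨u1, u2, u3, h12, h13, h23, rfl⟩ := card_eq_three.1 hT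
  have hb : (e.erase x).card = 4 := by rw [card_erase_of_mem hx, he]
  have hu1 : u1 ∈ U := hTU (by simp)
  have hu2 : u2 ∈ U := hTU (by simp)
  have hu3 : u3 ∈ U := hTU (by simp)
  have hue : ∀ u ∈ U, u ∉ e := fun u hu => disjoint_left.1 hd hu
  obtain ⟨y1, y2, y3, y4, g12, g13, g14, g23, g24, g34, hbe⟩ := card_eq_four.1 hb
  have hy : ∀ y, y ∈ e.erase x ↔ y = y1 ∨ y = y2 ∨ y = y3 ∨ y = y4 := by
    intro y; rw [hbe]; simp
  have hye : ∀ y ∈ e.erase x, y ∈ e := fun y h => mem_of_mem_erase h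
  have m1 : y1 ∈ e.erase x := by rw [hy]; simp
  have m2 : y2 ∈ e.erase x := by rw [hy]; simp
  have k1 : u1 ≠ y1 := fun h => hue _ hu1 (h ▸ hye _ m1)
  have k2 : u1 ≠ y2 := fun h => hue _ hu1 (h ▸ hye _ m2)
  have k21 : u2 ≠ y1 := fun h => hue _ hu2 (h ▸ hye _ m1)
  have k22 : u2 ≠ y2 := fun h => hue _ hu2 (h ▸ hye _ m2)
  have k31 : u3 ≠ y1 := fun h => hue _ hu3 (h ▸ hye _ m1)
  have hu1b : u1 ∉ e.erase x := fun h => hue _ hu1 (hye _ h)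
  have ha : (insert u1 (e.erase x)).card = 5 := by rw [card_insert_of_notMem hu1b, hb]
  have haP : insert u1 (e.erase x) ⊆ e.erase x ∪ U := by
    intro y hy
    rcases mem_insert.1 hy with rfl | hy
    · exact mem_union_right _ hu1
    · exact mem_union_left _ hy
  have hnF := hP _ haP ha
  have hUP : U ⊆ e.erase x ∪ U := subset_union_right
  have n1 : y1 ∈ e.erase x ∪ U := mem_union_left _ m1
  have n2 : y2 ∈ e.erase x ∪ U := mem_union_left _ m2
  have c0 : ({u1, y1, y2} : Finset V).card = 3 := card_eq_three.2 ⟨_, _, _, k1, k2, g12, rfl⟩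
  have c1 : ({u1, u2, y1} : Finset V).card = 3 := card_eq_three.2 ⟨_, _, _, h12, k1, k21, rfl⟩
  have G1 : GG φ C Λ M r {u1, u2, y1} := by
    refine G_step col lab φ C Φ Λ M S1 S2 S3 r U (e.erase x ∪ U) {u1, u2, u3} _ hP hUP hU hUc hT c1
      (hTU.trans hUP) ?_ ?_ u1 hu1 (by simp) hG
    · intro y; simp only [mem_insert, mem_singleton]; rintro (h | h | h) <;> simp [h, n1, hUP hu2, hUP hu1, -mem_union]
    · have : ({u1, u2, u3} : Finset V) ∩ {u1, u2, y1} = {u1, u2} := by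
        ext a; simp only [mem_inter, mem_insert, mem_singleton]; grind
      rw [this, card_pair h12]
  have G0 : GG φ C Λ M r {u1, y1, y2} := by
    refine G_step col lab φ C Φ Λ M S1 S2 S3 r U (e.erase x ∪ U) {u1, u2, y1} _ hP hUP hU hUc c1 c0
      ?_ ?_ ?_ u1 hu1 (by simp) G1
    · intro y; simp only [mem_insert, mem_singleton]; rintro (h | h | h) <;> simp [h, n1, hUP hu2, hUP hu1, -mem_union]
    · intro y; simp only [mem_insert, mem_singleton]; rintro (h | h | h) <;> simp [h, n1, n2, hUP hu1, -mem_union]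
    · have : ({u1, u2, y1} : Finset V) ∩ {u1, y1, y2} = {u1, y1} := by
        ext a; simp only [mem_inter, mem_insert, mem_singleton]; grind
      rw [this, card_pair k1]
  have hac := G_col col lab φ C Λ M S1 r {u1, y1, y2} _ c0 ha
    (by intro y; simp only [mem_insert, mem_singleton]; rintro (h | h | h) <;> simp [h, m1, m2, -mem_erase]) G0 hnF
  apply hnF
  unfold FF
  rw [hadj _ e ha he _ (hac.trans hc.symm), hac, ← hc]
  · exact hF
  · have : insert u1 (e.erase x) ∩ e = e.erase x := by
      ext y; simp only [mem_inter, mem_insert, mem_erase]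
      have := hue _ hu1
      grind
    rw [this, hb]
end core

theorem core [Finite ι] (hV : 31 ≤ Fintype.card V) (col : Finset V → Bool) (lab : Finset V → ι)
    (hadj : ∀ e e' : Finset V, e.card = 5 → e'.card = 5 → (e ∩ e').card = 4 →
      col e = col e' → lab e = lab e') :
    ∃ (Λ M : Bool → ι) (w : Finset V → ℝ), FM (FF col lab Λ M) w ∧
      (Fintype.card V : ℝ) - 30 ≤ 5 * ∑ e, w e := by
  classical
  obtain ⟨φ, C, Φ, Λ, S1, S2, S3⟩ := struct (by omega) col lab hadj
  have : Nonempty ι := ⟨lab ∅⟩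
  obtain ⟨M, w, hw, hmax⟩ := FM_max (fun M : Bool → ι => FF col lab Λ M)
  refine ⟨Λ, M, w, hw, ?_⟩
  have := load_total w _ hw
  suffices h : (unc w).card ≤ 30 by
    have h' : ((unc w).card : ℝ) ≤ 30 := by exact_mod_cast h
    linarith
  by_contra hbig
  push Not at hbig
  obtain ⟨r, hr⟩ : ∃ r : Bool, 15 < ((unc w).filter (fun v => Φ v = r)).card := by
    have := exists_lt_card_fiber_of_mul_lt_card_of_maps_to (s := unc w) (t := (univ : Finset Bool))
      (f := Φ) (n := 15) (fun _ _ => mem_univ _) (by simpa using hbig)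
    simpa using this
  set U := (unc w).filter (fun v => Φ v = r) with hUdef
  have hUu : U ⊆ unc w := filter_subset _ _
  have hUΦ : ∀ u ∈ U, Φ u = r := fun u hu => (mem_filter.1 hu).2
  have hsupp : ∀ M', (∀ e, w e ≠ 0 → FF col lab Λ M e → FF col lab Λ M' e) →
      FM (FF col lab Λ M') w := fun M' h =>
    ⟨hw.1, fun e he => ⟨(hw.2.1 e he).1, h e he (hw.2.1 e he).2⟩, hw.2.2⟩
  have nou : ∀ M', FM (FF col lab Λ M') w → ∀ a ⊆ U, a.card = 5 → ¬ FF col lab Λ M' a :=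
    fun M' h a haU ha => no_edge_unc _ w h (hmax M') a ha (haU.trans hUu)
  have sub5 : ∀ Y : Finset V, Y.card ≤ 10 → 5 ≤ (U \ Y).card := by
    intro Y hY
    have := le_card_sdiff Y U
    omega
  by_cases hcase : ∃ e, w e ≠ 0 ∧ col e = !r
  · obtain ⟨e, he, hc⟩ := hcase
    obtain ⟨he5, heF⟩ := hw.2.1 e he
    obtain ⟨x, hx, hP⟩ := exchange _ w hw (hmax M) e he
    have hL1 : ∀ U' ⊆ U, Disjoint U' e → 5 ≤ U'.card → ∀ T ⊆ U', T.card = 3 → GG φ C Λ M r T := by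
      intro U' hU' hd h5
      exact L1 col lab φ C Φ Λ M S1 S2 S3 hadj r U' e x hx he5 heF hc hd
        (fun a ha h => hP a h (ha.trans (union_subset_union_right (hU'.trans hUu))))
        (fun u hu => hUΦ u (hU' hu)) h5
    by_cases hc2 : ∃ e', w e' ≠ 0 ∧ col e' = r
    · obtain ⟨e', he', hc'⟩ := hc2
      obtain ⟨he5', heF'⟩ := hw.2.1 e' he'
      obtain ⟨x', hx', hP'⟩ := exchange _ w hw (hmax M) e' he'
      have h5 := sub5 (e ∪ e') (by have := card_union_le e e'; omega)
      set U' := U \ (e ∪ e')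
      have hU' : U' ⊆ U := sdiff_subset
      have hd : Disjoint U' (e ∪ e') := sdiff_disjoint
      rw [disjoint_union_right] at hd
      obtain ⟨T, hT, hT3⟩ := exists_subset_card_eq (s := U') (n := 3) (by omega)
      exact L2 col lab φ C Φ Λ M S1 S2 S3 hadj r U' e' x' hx' he5' heF' hc' hd.2
        (fun a ha h => hP' a h (ha.trans (union_subset_union_right (hU'.trans hUu))))
        (fun u hu => hUΦ u (hU' hu)) h5 T hT hT3 (hL1 U' hU' hd.1 h5 T hT hT3)
    · push Not at hc2
      have h5 := sub5 e (by omega)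
      set U' := U \ e
      have hU' : U' ⊆ U := sdiff_subset
      have hd : Disjoint U' e := sdiff_disjoint
      obtain ⟨a, haU, ha5⟩ := exists_subset_card_eq (s := U') (n := 5) (by omega)
      obtain ⟨T, hT, hT3⟩ := exists_subset_card_eq (s := a) (n := 3) (by omega)
      have hG := hL1 U' hU' hd h5 T (hT.trans haU) hT3
      have hac := G_col col lab φ C Λ M S1 r T a hT3 ha5 hT hG (nou M hw a (haU.trans hU') ha5)
      have hM' := hsupp (Function.update M r (lab a)) (fun g hg h => by
        unfold FF at h ⊢
        rw [Function.update_of_ne (hc2 g hg)]; exact h)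
      refine nou _ hM' a (haU.trans hU') ha5 ?_
      right; rw [hac, Function.update_self]
  · push Not at hcase
    have hused : ∀ g, w g ≠ 0 → col g = r := fun g hg => by
      have := hcase g hg; cases r <;> simpa using this
    have hMany : ∀ i, FM (FF col lab Λ (Function.update M (!r) i)) w := fun i =>
      hsupp _ (fun g hg h => by
        unfold FF at h ⊢
        rw [Function.update_of_ne (hcase g hg)]; exact h)
    have hallr : ∀ a ⊆ U, a.card = 5 → col a = r := by
      intro a haU ha
      by_contra h
      have h' : col a = !r := by cases r <;> simpa using h
      refine nou _ (hMany (lab a)) a haU ha ?_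
      right; rw [h', Function.update_self]
    by_cases hz : ∃ e', w e' ≠ 0
    · obtain ⟨e', he'⟩ := hz
      have hc' := hused e' he'
      have he5' := (hw.2.1 e' he').1
      have h5 := sub5 e' (by omega)
      set U' := U \ e'
      have hU' : U' ⊆ U := sdiff_subset
      have hd : Disjoint U' e' := sdiff_disjoint
      obtain ⟨a, haU, ha5⟩ := exists_subset_card_eq (s := U') (n := 5) (by omega)
      obtain ⟨T, hT, hT3⟩ := exists_subset_card_eq (s := a) (n := 3) (by omega)
      obtain ⟨u, hu⟩ : T.Nonempty := by rw [← card_pos]; omega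
      have hφ := F1 col lab φ C Φ Λ M S1 S3 r a T u ha5 hT3 hu hT
        (hallr a (haU.trans hU') ha5) (hUΦ u (hU' (haU (hT hu)))) (nou M hw a (haU.trans hU') ha5)
      have hw' := hMany (C T)
      obtain ⟨x', hx', hP'⟩ := exchange _ w hw' (hmax _) e' he'
      refine L2 col lab φ C Φ Λ (Function.update M (!r) (C T)) S1 S2 S3 hadj r U' e' x' hx' he5'
        (hw'.2.1 e' he').2 hc' hd
        (fun a ha h => hP' a h (ha.trans (union_subset_union_right (hU'.trans hUu))))
        (fun u hu => hUΦ u (hU' hu)) h5 T (hT.trans haU) hT3 ⟨hφ, ?_⟩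
      right; rw [Function.update_self]
    · push Not at hz
      obtain ⟨a, haU, ha5⟩ := exists_subset_card_eq (s := U) (n := 5) (by omega)
      have hM' : FM (FF col lab Λ (fun _ => lab a)) w :=
        hsupp _ (fun g hg => absurd (hz g) hg)
      refine nou _ hM' a haU ha5 ?_
      right; rfl
end TC

namespace TC

theorem exp_conv (b t d : ℝ) (hb : 0 < b) (hd : |d| ≤ b) :
    Real.exp (t * d) ≤ Real.cosh (t * b) + (d / b) * Real.sinh (t * b) := by
  have hd' := abs_le.1 hd
  have h1 : 0 ≤ (b + d) / (2 * b) := div_nonneg (by linarith) (by linarith)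
  have h2 : 0 ≤ (b - d) / (2 * b) := div_nonneg (by linarith) (by linarith)
  have h := convexOn_exp.2 (Set.mem_univ (t * b)) (Set.mem_univ (-(t * b))) h1 h2
    (by field_simp; ring)
  simp only [smul_eq_mul] at h
  have e1 : (b + d) / (2 * b) * (t * b) + (b - d) / (2 * b) * (-(t * b)) = t * d := by
    field_simp; ring
  rw [e1] at h
  refine h.trans (le_of_eq ?_)
  rw [Real.cosh_eq, Real.sinh_eq]
  field_simp; ring

theorem one_step {α : Type*} [Fintype α] (g : α → ℝ) (m b t : ℝ) (hb : 0 < b)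
    (hm : ∑ a, g a = Fintype.card α * m) (hg : ∀ a, |g a - m| ≤ b) :
    ∑ a, Real.exp (t * g a) ≤ Fintype.card α * Real.exp (t * m + t ^ 2 * b ^ 2 / 2) := by
  have h1 : ∀ a, Real.exp (t * g a) ≤
      Real.exp (t * m) * (Real.cosh (t * b) + ((g a - m) / b) * Real.sinh (t * b)) := by
    intro a
    have : t * g a = t * m + t * (g a - m) := by ring
    rw [this, Real.exp_add]
    exact mul_le_mul_of_nonneg_left (exp_conv b t _ hb (hg a)) (Real.exp_pos _).le
  refine (sum_le_sum fun a _ => h1 a).trans ?_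
  rw [← mul_sum, sum_add_distrib, ← sum_mul, ← sum_div, sum_sub_distrib, hm]
  simp only [sum_const, card_univ, nsmul_eq_mul, sub_self, zero_div, zero_mul, add_zero]
  rw [Real.exp_add]
  have := Real.cosh_le_exp_half_sq (t * b)
  have e : (t * b) ^ 2 / 2 = t ^ 2 * b ^ 2 / 2 := by ring
  rw [e] at this
  have h2 : (0:ℝ) ≤ Fintype.card α * Real.exp (t * m) := by positivity
  nlinarith [mul_le_mul_of_nonneg_left this h2]

theorem mgf {α : Type*} [Fintype α] [Nonempty α] (b t : ℝ) (hb : 0 < b) (N : ℕ) :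
    ∀ (f : (Fin N → α) → ℝ) (_ : ∀ x i a, |f (Function.update x i a) - f x| ≤ b) (m : ℝ)
      (_ : ∑ x, f x = (Fintype.card α : ℝ) ^ N * m),
    ∑ x, Real.exp (t * f x) ≤ (Fintype.card α : ℝ) ^ N * Real.exp (t * m + N * (t ^ 2 * b ^ 2 / 2)) := by
  induction N with
  | zero =>
    intro f _ m hm
    simp at hm ⊢
    rw [hm]
  | succ N ih =>
    intro f hf m hm
    have hA : (0:ℝ) < Fintype.card α := by exact_mod_cast Fintype.card_pos
    have hsplit : ∀ F : (Fin (N+1) → α) → ℝ, ∑ x, F x = ∑ x' : Fin N → α, ∑ a, F (Fin.cons a x') := by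
      intro F
      rw [sum_comm, ← Fintype.sum_prod_type']
      exact (Fintype.sum_equiv (Fin.consEquiv (fun _ => α)) _ _ (fun x => rfl)).symm
    set h : (Fin N → α) → ℝ := fun x' => (∑ a, f (Fin.cons a x')) / Fintype.card α with hh
    have hcons : ∀ (x' : Fin N → α) a a', (Fin.cons a' x' : Fin (N+1) → α) =
        Function.update (Fin.cons a x') 0 a' := by
      intro x' a a'; simp
    have h1 : ∀ x', ∑ a, Real.exp (t * f (Fin.cons a x')) ≤
        Fintype.card α * Real.exp (t * h x' + t ^ 2 * b ^ 2 / 2) := by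
      intro x'
      refine one_step (fun a => f (Fin.cons a x')) (h x') b t hb ?_ ?_
      · rw [hh]; field_simp
      · intro a
        have : f (Fin.cons a x') - h x' = (∑ a', (f (Fin.cons a x') - f (Fin.cons a' x'))) / Fintype.card α := by
          rw [sum_sub_distrib, hh]; simp only [sum_const, card_univ, nsmul_eq_mul]; field_simp
        beta_reduce
        rw [this, abs_div, abs_of_pos hA, div_le_iff₀ hA]
        refine (abs_sum_le_sum_abs _ _).trans ?_
        refine (sum_le_sum fun a' _ => (?_ : _ ≤ b)).trans ?_
        · rw [hcons x' a' a]; exact hf _ _ _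
        · simp [mul_comm]
    rw [hsplit]
    refine (sum_le_sum fun x' _ => h1 x').trans ?_
    have h2 := ih h (by
      intro x i a
      have : h (Function.update x i a) - h x =
          (∑ c, (f (Fin.cons c (Function.update x i a)) - f (Fin.cons c x))) / Fintype.card α := by
        rw [sum_sub_distrib, hh]; ring
      rw [this, abs_div, abs_of_pos hA, div_le_iff₀ hA]
      refine (abs_sum_le_sum_abs _ _).trans ?_
      refine (sum_le_sum fun a' _ => (?_ : _ ≤ b)).trans ?_
      · rw [Fin.cons_update]; exact hf _ _ _
      · simp [mul_comm]) m (by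
      rw [hh]; simp only
      rw [← sum_div, ← hsplit, hm, pow_succ]; field_simp)
    simp_rw [Real.exp_add, ← mul_assoc]
    rw [← sum_mul, ← mul_sum]
    calc _ ≤ Fintype.card α * ((Fintype.card α : ℝ) ^ N * Real.exp (t * m + N * (t ^ 2 * b ^ 2 / 2)))
          * Real.exp (t ^ 2 * b ^ 2 / 2) := by gcongr
      _ = _ := by
        push_cast
        rw [add_mul, Real.exp_add, Real.exp_add, one_mul]; ring

theorem mcdiarmid {α : Type*} [Fintype α] [Nonempty α] (N : ℕ) (f : (Fin N → α) → ℝ)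
    (b s m : ℝ) (hb : 0 < b) (hs : 0 ≤ s)
    (hf : ∀ x i a, |f (Function.update x i a) - f x| ≤ b)
    (hm : ∑ x, f x = (Fintype.card α : ℝ) ^ N * m) :
    ((univ.filter fun x => m + s ≤ f x).card : ℝ) ≤
      Real.exp (- (s ^ 2 / (2 * b ^ 2 * N))) * (Fintype.card α : ℝ) ^ N := by
  rcases Nat.eq_zero_or_pos N with rfl | hN
  · simp
    refine (card_le_univ _).trans (by simp)
  have hN' : (0:ℝ) < N := by exact_mod_cast hN
  set t := s / (b ^ 2 * N) with ht
  have ht0 : 0 ≤ t := by positivity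
  have h := mgf b t hb N f hf m hm
  have h1 : ((univ.filter fun x => m + s ≤ f x).card : ℝ) * Real.exp (t * (m + s)) ≤
      ∑ x, Real.exp (t * f x) := by
    rw [← nsmul_eq_mul, ← sum_const]
    refine (sum_le_sum fun x hx => ?_).trans
      (sum_le_univ_sum_of_nonneg (s := univ.filter fun x => m + s ≤ f x) fun x => (Real.exp_pos _).le)
    simp at hx
    exact Real.exp_le_exp.2 (mul_le_mul_of_nonneg_left hx ht0)
  have h2 := h1.trans h
  have e : Real.exp (t * m + N * (t ^ 2 * b ^ 2 / 2)) =
      Real.exp (- (s ^ 2 / (2 * b ^ 2 * N))) * Real.exp (t * (m + s)) := by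
    rw [← Real.exp_add]; congr 1; rw [ht]; field_simp; ring
  rw [e] at h2
  have h3 := Real.exp_pos (t * (m + s))
  refine le_of_mul_le_mul_right ?_ h3
  linarith

theorem mcdiarmid' {α J : Type*} [Fintype α] [Nonempty α] [Fintype J] [DecidableEq J]
    (f : (J → α) → ℝ) (b s m : ℝ) (hb : 0 < b) (hs : 0 ≤ s)
    (hf : ∀ x i a, |f (Function.update x i a) - f x| ≤ b)
    (hm : ∑ x, f x = (Fintype.card α : ℝ) ^ Fintype.card J * m) :
    ((univ.filter fun x => m + s ≤ f x).card : ℝ) ≤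
      Real.exp (- (s ^ 2 / (2 * b ^ 2 * Fintype.card J))) * (Fintype.card α : ℝ) ^ Fintype.card J := by
  let E : (Fin (Fintype.card J) → α) ≃ (J → α) := (Fintype.equivFin J).symm.arrowCongr (Equiv.refl α)
  have hE : ∀ x, E x = x ∘ Fintype.equivFin J := fun x => rfl
  have := mcdiarmid (Fintype.card J) (fun x => f (E x)) b s m hb hs (by
    intro x i a
    have : E (Function.update x i a) = Function.update (E x) ((Fintype.equivFin J).symm i) a := by
      rw [hE, hE]
      ext j
      simp [Function.update_apply, Equiv.eq_symm_apply]
    beta_reduce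
    rw [this]; exact hf _ _ _) (by rw [← hm]; exact Equiv.sum_comp E f)
  refine le_trans (le_of_eq ?_) this
  congr 1
  refine card_bij (fun x _ => E.symm x) ?_ ?_ ?_
  · intro x hx; simpa using hx
  · intro x _ y _ h; simpa using h
  · intro x hx; exact ⟨E x, by simpa using hx, by simp⟩
end TC

namespace TC

variable {V : Type*} [Fintype V] [DecidableEq V]

def CleanSet (G : Finset (Fin 5 → V)) (m : Fin 5 → ℝ) : Prop :=
  ∀ y ∈ G, ∀ i, m i ≤ ((univ.filter fun v => Function.update y i v ∈ G).card : ℝ)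

theorem clean (m : Fin 5 → ℝ) (hm : ∀ i, 0 ≤ m i) (k : ℕ) : ∀ (G : Finset (Fin 5 → V)), G.card ≤ k →
    ∃ G' ⊆ G, CleanSet G' m ∧
      (G.card : ℝ) ≤ G'.card + ∑ i, m i * ((G.image (fun y => Fin.removeNth i y)).card : ℝ) := by
  induction k with
  | zero =>
    intro G hG
    have : G = ∅ := by simpa using hG
    subst this
    exact ⟨∅, by simp, by intro y hy; simp at hy, by simp⟩
  | succ k ih =>
    intro G hG
    by_cases hc : CleanSet G m
    · refine ⟨G, Subset.rfl, hc, ?_⟩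
      have : 0 ≤ ∑ i, m i * ((G.image (fun y => Fin.removeNth i y)).card : ℝ) :=
        sum_nonneg fun i _ => mul_nonneg (hm i) (by positivity)
      linarith
    · unfold CleanSet at hc
      push Not at hc
      obtain ⟨y, hy, i, hlt⟩ := hc
      set L := G.filter (fun z => Fin.removeNth i z = Fin.removeNth i y) with hL
      have hyL : y ∈ L := by simp [hL, hy]
      have hLG : L ⊆ G := filter_subset _ _
      have hLc : (L.card : ℝ) ≤ m i := by
        refine le_trans ?_ hlt.le
        have : L.card ≤ (univ.filter fun v => Function.update y i v ∈ G).card := by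
          have key : ∀ z ∈ L, Function.update y i (z i) = z := by
            intro z hz
            have hz' := (mem_filter.1 hz).2
            rw [← Fin.insertNth_self_removeNth i z, hz']
            simp
          refine card_le_card_of_injOn (fun z => z i) ?_ ?_
          · intro z hz
            simp only [coe_filter, mem_univ, true_and, Set.mem_setOf_eq]
            rw [key z hz]; exact hLG hz
          · intro z hz z' hz' h
            rw [← key z hz, ← key z' hz']; simp only at h; rw [h]
        exact_mod_cast this
      obtain ⟨G', hG', hcl, hb⟩ := ih (G \ L) (by
        have h1 := card_sdiff_add_card_eq_card hLG
        have h2 : 0 < L.card := card_pos.2 ⟨y, hyL⟩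
        omega)
      refine ⟨G', hG'.trans sdiff_subset, hcl, ?_⟩
      have h1 : (G.card : ℝ) = (G \ L).card + L.card := by
        rw [← Nat.cast_add, card_sdiff_add_card_eq_card hLG]
      have h2 : ∀ j, m j * (((G \ L).image (fun y => Fin.removeNth j y)).card : ℝ) +
          (if j = i then m i else 0) ≤ m j * ((G.image (fun y => Fin.removeNth j y)).card : ℝ) := by
        intro j
        split_ifs with h
        · subst h
          have : ((G \ L).image (fun y => Fin.removeNth j y)).card + 1 ≤
              (G.image (fun y => Fin.removeNth j y)).card := by
            rw [← card_insert_of_notMem (a := Fin.removeNth j y)]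
            · apply card_le_card
              intro p hp
              rcases mem_insert.1 hp with rfl | hp
              · exact mem_image_of_mem _ hy
              · exact image_subset_image sdiff_subset hp
            · intro h
              obtain ⟨z, hz, hzy⟩ := mem_image.1 h
              rw [mem_sdiff] at hz
              exact hz.2 (by simp [hL, hz.1, hzy])
          have h' : (((G \ L).image (fun y => Fin.removeNth j y)).card : ℝ) + 1 ≤
              ((G.image (fun y => Fin.removeNth j y)).card : ℝ) := by exact_mod_cast this
          nlinarith [hm j]
        · rw [add_zero]
          exact mul_le_mul_of_nonneg_left
            (by exact_mod_cast card_le_card (image_subset_image sdiff_subset)) (hm j)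
      have h3 := sum_le_sum fun j (_ : j ∈ univ) => h2 j
      rw [sum_add_distrib, sum_ite_eq' univ i] at h3
      simp only [mem_univ, if_true] at h3
      linarith

def rt (y : Fin 5 → V) : Fin 5 → V := fun i => y (i + 1)

theorem rt_inj : Function.Injective (rt : (Fin 5 → V) → _) := by
  intro y z h
  funext i
  have := congrFun h (i - 1)
  simpa [rt] using this

theorem rt_update (y : Fin 5 → V) (i : Fin 5) (v : V) :
    rt (Function.update y i v) = Function.update (rt y) (i - 1) v := by
  funext j
  simp only [rt, Function.update_apply]
  congr 1
  simp [eq_sub_iff_add_eq]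

theorem rt5 (y : Fin 5 → V) : rt (rt (rt (rt (rt y)))) = y := by
  funext i
  simp only [rt]
  congr 1
  fin_cases i <;> rfl

theorem clean_rot (μ : ℝ) (hμ : 0 ≤ μ) (G : Finset (Fin 5 → V)) (hG : ∀ y ∈ G, rt y ∈ G) :
    ∃ G' ⊆ G, CleanSet G' (fun _ => μ) ∧ (∀ y ∈ G', rt y ∈ G') ∧
      (G.card : ℝ) ≤ G'.card + 5 * μ * (Fintype.card V : ℝ) ^ 4 := by
  classical
  obtain ⟨G1, h1, h2, h3⟩ := clean (fun _ => μ) (fun _ => hμ) _ G le_rfl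
  set G' := G.filter (fun y => ∃ S ⊆ G, CleanSet S (fun _ => μ) ∧ y ∈ S) with hG'
  have hsub : ∀ S ⊆ G, CleanSet S (fun _ => μ) → S ⊆ G' := by
    intro S hS hc y hy
    exact mem_filter.2 ⟨hS hy, S, hS, hc, hy⟩
  refine ⟨G', filter_subset _ _, ?_, ?_, ?_⟩
  · intro y hy i
    obtain ⟨_, S, hS, hc, hyS⟩ := mem_filter.1 hy
    refine (hc y hyS i).trans ?_
    have : (univ.filter fun v => Function.update y i v ∈ S).card ≤
      (univ.filter fun v => Function.update y i v ∈ G').card := by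
      apply card_le_card
      intro v hv
      simp only [mem_filter, mem_univ, true_and] at hv
      exact mem_filter.2 ⟨mem_univ _, hsub S hS hc hv⟩
    exact_mod_cast this
  · intro y hy
    obtain ⟨_, S, hS, hc, hyS⟩ := mem_filter.1 hy
    refine hsub (S.image rt) ?_ ?_ (mem_image_of_mem _ hyS)
    · intro z hz
      obtain ⟨z, hz', rfl⟩ := mem_image.1 hz
      exact hG z (hS hz')
    · intro z hz i
      obtain ⟨z, hz', rfl⟩ := mem_image.1 hz
      refine (hc z hz' (i + 1)).trans ?_
      have : (univ.filter fun v => Function.update z (i + 1) v ∈ S).card ≤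
        (univ.filter fun v => Function.update (rt z) i v ∈ S.image rt).card := by
        apply card_le_card
        intro v hv
        simp only [mem_filter, mem_univ, true_and] at hv ⊢
        have := mem_image_of_mem rt hv
        rw [rt_update] at this
        simpa using this
      exact_mod_cast this
  · refine h3.trans ?_
    have a1 : (G1.card : ℝ) ≤ G'.card := by exact_mod_cast card_le_card (hsub G1 h1 h2)
    have a2 : ∑ i : Fin 5, μ * ((G.image (fun y => Fin.removeNth i y)).card : ℝ) ≤
        ∑ i : Fin 5, μ * (Fintype.card V : ℝ) ^ 4 := by
      refine sum_le_sum fun i _ => mul_le_mul_of_nonneg_left ?_ hμ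
      have : (G.image (fun y => Fin.removeNth i y)).card ≤ Fintype.card (Fin 4 → V) := card_le_univ _
      rw [Fintype.card_fun, Fintype.card_fin] at this
      exact_mod_cast this
    simp at a2
    linarith
end TC

namespace TC
variable {V : Type*} [Fintype V] [DecidableEq V]

def sn (f : Fin 4 → V) (v : V) : Fin 5 → V := ![f 0, f 1, f 2, f 3, v]
def nx (f : Fin 4 → V) (v : V) : Fin 4 → V := ![f 1, f 2, f 3, v]
def ini (y : Fin 5 → V) : Fin 4 → V := ![y 0, y 1, y 2, y 3]
def tl (y : Fin 5 → V) : Fin 4 → V := ![y 1, y 2, y 3, y 4]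

/-- walk starting in f and appending l -/
def TWl (H : Finset (Fin 5 → V)) : (Fin 4 → V) → List V → Prop
  | _, [] => True
  | f, v :: l => sn f v ∈ H ∧ TWl H (nx f v) l

instance (H : Finset (Fin 5 → V)) : ∀ (f : Fin 4 → V) (l : List V), Decidable (TWl H f l)
  | _, [] => isTrue trivial
  | f, v :: l =>
    haveI := instDecidableTWl H (nx f v) l
    inferInstanceAs (Decidable (sn f v ∈ H ∧ TWl H (nx f v) l))

def cnt (H : Finset (Fin 5 → V)) (j : ℕ) (f g : Fin 4 → V) : ℕ :=
  (univ.filter fun z : Fin j → V => TWl H f (List.ofFn z ++ List.ofFn g)).card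

theorem cnt_succ (H : Finset (Fin 5 → V)) (j : ℕ) (f g : Fin 4 → V) :
    cnt H (j + 1) f g = ∑ v ∈ univ.filter (fun v => sn f v ∈ H), cnt H j (nx f v) g := by
  unfold cnt
  rw [← card_sigma]
  refine card_bij (fun z _ => ⟨z 0, Fin.tail z⟩) ?_ ?_ ?_
  · intro z hz
    simp only [mem_filter, mem_univ, true_and, List.ofFn_succ, List.cons_append, TWl] at hz
    simp only [mem_sigma, mem_filter, mem_univ, true_and]
    exact ⟨hz.1, hz.2⟩
  · intro z _ z' _ h
    simp only [Sigma.mk.injEq, heq_eq_eq] at h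
    rw [← Fin.cons_self_tail z, ← Fin.cons_self_tail z', h.1, h.2]
  · rintro ⟨v, z⟩ hz
    simp only [mem_sigma, mem_filter, mem_univ, true_and] at hz
    refine ⟨Fin.cons v z, ?_, by simp⟩
    simp only [mem_filter, mem_univ, true_and, List.ofFn_succ, List.cons_append, TWl]
    exact ⟨hz.1, by simpa using hz.2⟩

/-- four-step reachability -/
def N4 (H : Finset (Fin 5 → V)) (f g : Fin 4 → V) : Prop := TWl H f (List.ofFn g)

instance (H : Finset (Fin 5 → V)) (f g : Fin 4 → V) : Decidable (N4 H f g) := by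
  unfold N4; infer_instance

theorem N4_iff (H : Finset (Fin 5 → V)) (f g : Fin 4 → V) : N4 H f g ↔
    ![f 0, f 1, f 2, f 3, g 0] ∈ H ∧ ![f 1, f 2, f 3, g 0, g 1] ∈ H ∧
    ![f 2, f 3, g 0, g 1, g 2] ∈ H ∧ ![f 3, g 0, g 1, g 2, g 3] ∈ H := by
  simp [N4, TWl, sn, nx, List.ofFn_succ]

theorem TWl_four (H : Finset (Fin 5 → V)) (f h : Fin 4 → V) (l : List V) :
    TWl H f (List.ofFn h ++ l) ↔ N4 H f h ∧ TWl H h l := by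
  have : nx (nx (nx (nx f (h 0)) (h 1)) (h 2)) (h 3) = h := by
    funext i; fin_cases i <;> simp [nx]
  simp only [N4, List.ofFn_succ, List.ofFn_zero, List.cons_append, List.nil_append, TWl]
  have e : nx (nx (nx (nx f (h 0)) (h (Fin.succ 0))) (h (Fin.succ (Fin.succ 0)))) (h (Fin.succ (Fin.succ (Fin.succ 0)))) = h := this
  rw [e]; tauto

theorem cnt_zero (H : Finset (Fin 5 → V)) (f g : Fin 4 → V) :
    cnt H 0 f g = if N4 H f g then 1 else 0 := by
  simp only [cnt, List.ofFn_zero, List.nil_append]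
  by_cases h : N4 H f g
  · have h' : TWl H f (List.ofFn g) := h
    rw [if_pos h, filter_true_of_mem (fun _ _ => h')]; simp
  · have h' : ¬ TWl H f (List.ofFn g) := h
    rw [if_neg h, filter_false_of_mem (fun _ _ => h')]; simp

theorem cnt_add_four (H : Finset (Fin 5 → V)) (j : ℕ) (f g : Fin 4 → V) :
    ∑ h ∈ univ.filter (fun h => N4 H f h), cnt H j h g ≤ cnt H (4 + j) f g := by
  unfold cnt
  rw [← card_sigma]
  refine card_le_card_of_injOn (fun p => Fin.append p.1 p.2) ?_ ?_
  · rintro ⟨h, z⟩ hz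
    simp only [coe_sigma, Set.mem_sigma_iff, coe_filter, mem_univ, true_and, Set.mem_ofPred_eq] at hz ⊢
    rw [List.ofFn_fin_append, List.append_assoc, TWl_four]
    exact hz
  · rintro ⟨h, z⟩ _ ⟨h', z'⟩ _ e
    simp only at e
    have h1 : h = h' := by
      funext i; have := congrFun e (Fin.castAdd j i); simpa using this
    have h2 : z = z' := by
      funext i; have := congrFun e (Fin.natAdd 4 i); simpa using this
    rw [h1, h2]

/-- weighted count -/
noncomputable def TT (H : Finset (Fin 5 → V)) (L : ℕ) (f g : Fin 4 → V) : ℝ :=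
  ∑ j ∈ range (L + 1), (cnt H j f g : ℝ) / (Fintype.card V : ℝ) ^ j

theorem TT_mono (H : Finset (Fin 5 → V)) (L : ℕ) (f g : Fin 4 → V) :
    TT H L f g ≤ TT H (L + 1) f g := by
  unfold TT
  rw [sum_range_succ _ (L + 1)]
  have : (0:ℝ) ≤ (cnt H (L + 1) f g : ℝ) / (Fintype.card V : ℝ) ^ (L + 1) := by positivity
  linarith

theorem TT_nonneg (H : Finset (Fin 5 → V)) (L : ℕ) (f g : Fin 4 → V) : 0 ≤ TT H L f g :=
  sum_nonneg fun _ _ => by positivity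

theorem TT_succ (H : Finset (Fin 5 → V)) (L : ℕ) (f g : Fin 4 → V) :
    (∑ v ∈ univ.filter (fun v => sn f v ∈ H), TT H L (nx f v) g) / Fintype.card V ≤
      TT H (L + 1) f g := by
  unfold TT
  rw [sum_range_succ' _ (L + 1), sum_comm, sum_div]
  have : (0:ℝ) ≤ (cnt H 0 f g : ℝ) / (Fintype.card V : ℝ) ^ 0 := by positivity
  refine le_trans (le_of_eq ?_) (le_add_of_nonneg_right this)
  refine sum_congr rfl fun j _ => ?_
  rw [cnt_succ, ← sum_div, pow_succ]
  push_cast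
  rw [div_div]

/-- growth -/
theorem grow (H : Finset (Fin 5 → V)) (A : Finset (Fin 4 → V)) (g : Fin 4 → V) (θ γ : ℝ)
    (hθ : 0 < θ) (hθ1 : θ ≤ 1) (hγ : 0 < γ) (hn : 0 < Fintype.card V)
    (hM : ∀ B ⊆ A, γ * (Fintype.card V : ℝ) ^ 4 ≤ B.card →
      γ * (Fintype.card V : ℝ) ^ 4 ≤ (A \ B).card →
      θ * (Fintype.card V : ℝ) ^ 5 ≤
        ∑ f ∈ A \ B, ((univ.filter fun v => sn f v ∈ H ∧ nx f v ∈ B).card : ℝ))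
    (hB0 : γ * (Fintype.card V : ℝ) ^ 4 ≤ ((A.filter fun f => N4 H f g).card : ℝ)) (i : ℕ) :
    ∃ B ⊆ A, (∀ f ∈ B, (θ / 2) ^ i ≤ TT H i f g) ∧ γ * (Fintype.card V : ℝ) ^ 4 ≤ B.card ∧
      (((A \ B).card : ℝ) < γ * (Fintype.card V : ℝ) ^ 4 ∨
        i * (θ / 2 * (Fintype.card V : ℝ) ^ 4) ≤ B.card) := by
  set n : ℝ := (Fintype.card V : ℝ) with hndef
  have hn' : 0 < n := by rw [hndef]; exact_mod_cast hn
  induction i with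
  | zero =>
    refine ⟨A.filter fun f => N4 H f g, filter_subset _ _, ?_, hB0, Or.inr (by simp)⟩
    intro f hf
    simp [TT, cnt_zero, (mem_filter.1 hf).2]
  | succ i ih =>
    obtain ⟨B, hBA, hBT, hBc, hor⟩ := ih
    have hp : 0 < (θ / 2) ^ i := by positivity
    have hT' : ∀ f ∈ B, (θ / 2) ^ (i + 1) ≤ TT H (i + 1) f g := by
      intro f hf
      refine le_trans ?_ ((hBT f hf).trans (TT_mono _ _ _ _))
      rw [pow_succ]; nlinarith
    rcases lt_or_ge ((A \ B).card : ℝ) (γ * n ^ 4) with hlt | hge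
    · exact ⟨B, hBA, hT', hBc, Or.inl hlt⟩
    · have hm := hM B hBA hBc hge
      have hor' : i * (θ / 2 * n ^ 4) ≤ B.card := by
        rcases hor with h | h
        · linarith
        · exact h
      set d : (Fin 4 → V) → ℝ := fun f => ((univ.filter fun v => sn f v ∈ H ∧ nx f v ∈ B).card : ℝ)
      set D := (A \ B).filter (fun f => θ / 2 * n ≤ d f) with hD
      have hAn : ((A \ B).card : ℝ) ≤ n ^ 4 := by
        have : (A \ B).card ≤ Fintype.card (Fin 4 → V) := card_le_univ _
        rw [Fintype.card_fun, Fintype.card_fin] at this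
        rw [hndef]; exact_mod_cast this
      have hDc : θ / 2 * n ^ 4 ≤ D.card := by
        have h1 : ∑ f ∈ A \ B, d f ≤ ∑ f ∈ A \ B, (θ / 2 * n + if θ / 2 * n ≤ d f then n else 0) := by
          refine sum_le_sum fun f _ => ?_
          split_ifs with h
          · have : d f ≤ n := by
              show ((univ.filter fun v => sn f v ∈ H ∧ nx f v ∈ B).card : ℝ) ≤ n
              rw [hndef]; exact_mod_cast card_le_univ _
            have : 0 ≤ θ / 2 * n := by positivity
            linarith
          · linarith
        rw [sum_add_distrib, ← sum_filter, sum_const, sum_const, nsmul_eq_mul, nsmul_eq_mul] at h1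
        have h2 : θ * n ^ 5 ≤ n ^ 4 * (θ / 2 * n) + D.card * n := by
          refine hm.trans (h1.trans ?_)
          gcongr
        have h3 : θ / 2 * n ^ 4 * n ≤ D.card * n := by nlinarith
        exact le_of_mul_le_mul_right h3 hn'
      have hdisj : Disjoint B D := by
        rw [disjoint_left]; intro f hf hf'
        exact (mem_sdiff.1 (mem_filter.1 hf').1).2 hf
      refine ⟨B ∪ D, ?_, ?_, ?_, Or.inr ?_⟩
      · refine union_subset hBA ((filter_subset _ _).trans sdiff_subset)
      · intro f hf
        rcases mem_union.1 hf with hf | hf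
        · exact hT' f hf
        · have hdf := (mem_filter.1 hf).2
          refine le_trans ?_ (TT_succ H i f g)
          rw [le_div_iff₀ hn']
          have : ∑ v ∈ univ.filter (fun v => sn f v ∈ H ∧ nx f v ∈ B), (θ / 2) ^ i ≤
              ∑ v ∈ univ.filter (fun v => sn f v ∈ H), TT H i (nx f v) g := by
            refine (sum_le_sum (fun v hv => hBT (nx f v) (mem_filter.1 hv).2.2)).trans ?_
            refine sum_le_sum_of_subset_of_nonneg ?_ (fun v _ _ => TT_nonneg _ _ _ _)
            intro v hv
            simp only [mem_filter, mem_univ, true_and] at hv ⊢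
            exact hv.1
          refine le_trans ?_ this
          rw [sum_const, nsmul_eq_mul, pow_succ]
          have := mul_le_mul_of_nonneg_right hdf hp.le
          calc _ = θ / 2 * n * (θ / 2) ^ i := by ring
            _ ≤ _ := this
      · refine hBc.trans ?_
        exact_mod_cast card_le_card subset_union_left
      · rw [card_union_of_disjoint hdisj]
        push_cast
        nlinarith

/-- connection -/
theorem connect (H : Finset (Fin 5 → V)) (A : Finset (Fin 4 → V)) (f g : Fin 4 → V) (θ γ : ℝ)
    (hθ : 0 < θ) (hθ1 : θ ≤ 1) (hγ : 0 < γ) (hn : 0 < Fintype.card V)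
    (hM : ∀ B ⊆ A, γ * (Fintype.card V : ℝ) ^ 4 ≤ B.card →
      γ * (Fintype.card V : ℝ) ^ 4 ≤ (A \ B).card →
      θ * (Fintype.card V : ℝ) ^ 5 ≤
        ∑ f ∈ A \ B, ((univ.filter fun v => sn f v ∈ H ∧ nx f v ∈ B).card : ℝ))
    (hB0 : γ * (Fintype.card V : ℝ) ^ 4 ≤ ((A.filter fun f => N4 H f g).card : ℝ))
    (hf : 2 * γ * (Fintype.card V : ℝ) ^ 4 ≤ ((A.filter fun h => N4 H f h).card : ℝ))
    (I : ℕ) (hI : 2 < I * θ) :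
    ∃ j ≤ I + 4, γ * (θ / 2) ^ I / (I + 1) * (Fintype.card V : ℝ) ^ j ≤ cnt H j f g := by
  obtain ⟨B, hBA, hBT, -, hor⟩ := grow H A g θ γ hθ hθ1 hγ hn hM hB0 I
  set n : ℝ := (Fintype.card V : ℝ) with hndef
  have hn' : 0 < n := by rw [hndef]; exact_mod_cast hn
  have hlt : ((A \ B).card : ℝ) < γ * n ^ 4 := by
    rcases hor with h | h
    · exact h
    · exfalso
      have : B.card ≤ Fintype.card (Fin 4 → V) := card_le_univ _
      rw [Fintype.card_fun, Fintype.card_fin] at this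
      have h' : (B.card : ℝ) ≤ n ^ 4 := by rw [hndef]; exact_mod_cast this
      have : 0 < n ^ 4 := by positivity
      nlinarith
  set S := B.filter (fun h => N4 H f h) with hS
  have hSc : γ * n ^ 4 ≤ S.card := by
    have : (A.filter fun h => N4 H f h) ⊆ S ∪ (A \ B) := by
      intro h hh
      rw [mem_filter] at hh
      by_cases hb : h ∈ B
      · exact mem_union_left _ (mem_filter.2 ⟨hb, hh.2⟩)
      · exact mem_union_right _ (mem_sdiff.2 ⟨hh.1, hb⟩)
    have h2 : ((A.filter fun h => N4 H f h).card : ℝ) ≤ S.card + (A \ B).card := by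
      exact_mod_cast (card_le_card this).trans (card_union_le _ _)
    linarith
  have key : γ * (θ / 2) ^ I ≤ ∑ j ∈ range (I + 1), (cnt H (4 + j) f g : ℝ) / n ^ (4 + j) := by
    have h1 : γ * n ^ 4 * (θ / 2) ^ I ≤ ∑ h ∈ univ.filter (fun h => N4 H f h), TT H I h g := by
      calc γ * n ^ 4 * (θ / 2) ^ I ≤ S.card * (θ / 2) ^ I := by gcongr
        _ = ∑ h ∈ S, (θ / 2) ^ I := by rw [sum_const, nsmul_eq_mul]
        _ ≤ ∑ h ∈ S, TT H I h g := sum_le_sum fun h hh => hBT h (mem_filter.1 hh).1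
        _ ≤ _ := sum_le_sum_of_subset_of_nonneg (by
            intro h hh; simpa using (mem_filter.1 hh).2) (fun v _ _ => TT_nonneg _ _ _ _)
    unfold TT at h1
    rw [sum_comm] at h1
    have h2 : ∀ j, ∑ h ∈ univ.filter (fun h => N4 H f h), (cnt H j h g : ℝ) / n ^ j ≤
        n ^ 4 * ((cnt H (4 + j) f g : ℝ) / n ^ (4 + j)) := by
      intro j
      rw [← sum_div, pow_add, ← div_div, ← mul_div_assoc, mul_div_cancel₀ _ (by positivity)]
      have := cnt_add_four H j f g
      have h' : ∑ h ∈ univ.filter (fun h => N4 H f h), (cnt H j h g : ℝ) ≤ cnt H (4 + j) f g := by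
        exact_mod_cast this
      gcongr
    have h3 := h1.trans (sum_le_sum fun j _ => h2 j)
    rw [← mul_sum] at h3
    have h4 : 0 < n ^ 4 := by positivity
    refine le_of_mul_le_mul_left ?_ h4
    calc _ = γ * n ^ 4 * (θ / 2) ^ I := by ring
      _ ≤ _ := h3
  by_contra hcon
  push Not at hcon
  have : ∑ j ∈ range (I + 1), (cnt H (4 + j) f g : ℝ) / n ^ (4 + j) <
      ∑ j ∈ range (I + 1), γ * (θ / 2) ^ I / (I + 1) := by
    refine sum_lt_sum_of_nonempty (by simp) fun j hj => ?_
    rw [div_lt_iff₀ (by positivity)]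
    have := hcon (4 + j) (by simp at hj; omega)
    exact this
  rw [sum_const, card_range, nsmul_eq_mul] at this
  push_cast at this
  rw [mul_div_cancel₀ _ (by positivity)] at this
  linarith
end TC

namespace TC
variable {V : Type*} [Fintype V] [DecidableEq V]

theorem sn_ini (y : Fin 5 → V) : sn (ini y) (y 4) = y := by
  funext i; fin_cases i <;> simp [sn, ini]
theorem nx_ini (y : Fin 5 → V) : nx (ini y) (y 4) = tl y := by
  funext i; fin_cases i <;> simp [nx, ini, tl]
theorem ini_sn (f : Fin 4 → V) (v : V) : ini (sn f v) = f := by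
  funext i; fin_cases i <;> simp [sn, ini]
theorem tl_sn (f : Fin 4 → V) (v : V) : tl (sn f v) = nx f v := by
  funext i; fin_cases i <;> simp [sn, tl, nx]
theorem ini_rt (y : Fin 5 → V) : ini (rt y) = tl y := by
  funext i; fin_cases i <;> simp [rt, ini, tl]
theorem eta5 (y : Fin 5 → V) : y = ![y 0, y 1, y 2, y 3, y 4] := by
  funext i; fin_cases i <;> rfl
theorem eta4 (y : Fin 4 → V) : y = ![y 0, y 1, y 2, y 3] := by
  funext i; fin_cases i <;> rfl
theorem rt_mk (a b c d e : V) : rt ![a, b, c, d, e] = ![b, c, d, e, a] := by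
  funext i; fin_cases i <;> rfl

theorem low (H : Finset (Fin 5 → V)) (m : ℝ) (hm : 0 ≤ m)
    (h1 : ∀ f v, sn f v ∈ H → m ≤ ((univ.filter fun v => sn f v ∈ H).card : ℝ))
    (h2 : ∀ f v, sn f v ∈ H → ∃ v', sn (nx f v) v' ∈ H) (j : ℕ) :
    ∀ f, (∃ v, sn f v ∈ H) →
    m ^ j ≤ ((univ.filter fun z : Fin j → V => TWl H f (List.ofFn z)).card : ℝ) := by
  induction j with
  | zero =>
    intro f _
    simp [TWl]
  | succ j ih =>
    rintro f ⟨v, hv⟩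
    have h := h1 f v hv
    have hc : (univ.filter fun z : Fin (j+1) → V => TWl H f (List.ofFn z)).card =
        ∑ v ∈ univ.filter (fun v => sn f v ∈ H),
          (univ.filter fun z : Fin j → V => TWl H (nx f v) (List.ofFn z)).card := by
      rw [← card_sigma]
      refine card_bij (fun z _ => ⟨z 0, Fin.tail z⟩) ?_ ?_ ?_
      · intro z hz
        simp only [mem_filter, mem_univ, true_and, List.ofFn_succ, TWl] at hz
        simp only [mem_sigma, mem_filter, mem_univ, true_and]
        exact ⟨hz.1, hz.2⟩
      · intro z _ z' _ h
        simp only [Sigma.mk.injEq, heq_eq_eq] at h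
        rw [← Fin.cons_self_tail z, ← Fin.cons_self_tail z', h.1, h.2]
      · rintro ⟨v, z⟩ hz
        simp only [mem_sigma, mem_filter, mem_univ, true_and] at hz
        refine ⟨Fin.cons v z, ?_, by simp⟩
        simp only [mem_filter, mem_univ, true_and, List.ofFn_succ, TWl]
        exact ⟨hz.1, by simpa using hz.2⟩
    rw [hc]
    push_cast
    calc m ^ (j + 1) ≤ ((univ.filter fun v => sn f v ∈ H).card : ℝ) * m ^ j := by
          rw [pow_succ, mul_comm]; gcongr
      _ = ∑ v ∈ univ.filter (fun v => sn f v ∈ H), m ^ j := by rw [sum_const, nsmul_eq_mul]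
      _ ≤ _ := sum_le_sum fun v hv => ih _ (h2 f v (mem_filter.1 hv).2)

theorem low_out (H : Finset (Fin 5 → V)) (m : ℝ) (hm : 0 ≤ m) (hc : CleanSet H (fun _ => m))
    (hr : ∀ y ∈ H, rt y ∈ H) (f : Fin 4 → V) (hf : ∃ v, sn f v ∈ H) :
    m ^ 4 ≤ ((univ.filter fun g => N4 H f g).card : ℝ) := by
  refine low H m hm ?_ ?_ 4 f hf
  · intro f v hv
    refine (hc _ hv 4).trans (le_of_eq ?_)
    congr 2; ext v'
    have : Function.update (sn f v) 4 v' = sn f v' := by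
      funext i; fin_cases i <;> simp [sn]
    simp only [mem_filter, mem_univ, true_and, this]
  · intro f v hv
    refine ⟨f 0, ?_⟩
    have := hr _ hv
    rw [sn, rt_mk] at this
    simpa [sn, nx] using this

theorem low_in (H : Finset (Fin 5 → V)) (m : ℝ) (hm : 0 ≤ m) (hc : CleanSet H (fun _ => m))
    (hr : ∀ y ∈ H, rt y ∈ H) (g : Fin 4 → V) (hg : ∃ v, sn g v ∈ H) :
    m ^ 4 ≤ ((univ.filter fun f => N4 H f g).card : ℝ) := by
  set Hr : Finset (Fin 5 → V) := univ.filter fun y => ![y 4, y 3, y 2, y 1, y 0] ∈ H with hHr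
  have hmem : ∀ y, y ∈ Hr ↔ ![y 4, y 3, y 2, y 1, y 0] ∈ H := by intro y; simp [hHr]
  have hr4 : ∀ y ∈ H, rt (rt (rt (rt y))) ∈ H := fun y hy => hr _ (hr _ (hr _ (hr _ hy)))
  have := low Hr m hm (by
    intro f v hv
    rw [hmem] at hv
    refine (hc _ hv 0).trans (le_of_eq ?_)
    congr 2; ext v'
    simp only [mem_filter, mem_univ, true_and]
    rw [hmem]
    have : Function.update ![sn f v 4, sn f v 3, sn f v 2, sn f v 1, sn f v 0] 0 v' =
       ![sn f v' 4, sn f v' 3, sn f v' 2, sn f v' 1, sn f v' 0] := by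
      funext i; fin_cases i <;> simp [sn]
    rw [this]) (by
    intro f v hv
    refine ⟨f 0, ?_⟩
    rw [hmem] at hv ⊢
    have := hr4 _ hv
    simp only [rt_mk] at this
    simpa [sn, nx] using this) 4 ![g 3, g 2, g 1, g 0] (by
    obtain ⟨v, hv⟩ := hg
    refine ⟨v, ?_⟩
    rw [hmem]
    have := hr4 _ hv
    simp only [sn, rt_mk] at this
    simpa [sn] using this)
  refine this.trans ?_
  have h2 : (univ.filter fun z : Fin 4 → V => TWl Hr ![g 3, g 2, g 1, g 0] (List.ofFn z)).card ≤
      (univ.filter fun f => N4 H f g).card := by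
    refine card_le_card_of_injOn (fun z => ![z 3, z 2, z 1, z 0]) ?_ ?_
    · intro z hz
      simp only [coe_filter, mem_univ, true_and, Set.mem_ofPred_eq] at hz ⊢
      have hz' : N4 Hr ![g 3, g 2, g 1, g 0] z := hz
      rw [N4_iff] at hz' ⊢
      simp only [hmem] at hz'
      simp at hz' ⊢
      tauto
    · intro z _ z' _ h
      rw [eta4 z, eta4 z']
      have h0 := congrFun h 0
      have h1 := congrFun h 1
      have h2 := congrFun h 2
      have h3 := congrFun h 3
      simp at h0 h1 h2 h3
      rw [h0, h1, h2, h3]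
  exact_mod_cast h2

theorem cross_count (H : Finset (Fin 5 → V)) (ℓ : (Fin 4 → V) → ℕ) :
    ((univ.filter fun p : (Fin 4 → V) × (Fin 4 → V) => N4 H p.1 p.2 ∧ ℓ p.1 ≠ ℓ p.2).card) ≤
      4 * ((H.filter fun y => ℓ (ini y) ≠ ℓ (tl y)).card * Fintype.card V ^ 3) := by
  set X := H.filter fun y => ℓ (ini y) ≠ ℓ (tl y) with hX
  set P := univ.filter fun p : (Fin 4 → V) × (Fin 4 → V) => N4 H p.1 p.2 ∧ ℓ p.1 ≠ ℓ p.2 with hP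
  let a : Fin 4 → (Fin 4 → V) × (Fin 4 → V) → (Fin 5 → V) := fun k p =>
    ![![p.1 0, p.1 1, p.1 2, p.1 3, p.2 0], ![p.1 1, p.1 2, p.1 3, p.2 0, p.2 1],
      ![p.1 2, p.1 3, p.2 0, p.2 1, p.2 2], ![p.1 3, p.2 0, p.2 1, p.2 2, p.2 3]] k
  let r : Fin 4 → (Fin 4 → V) × (Fin 4 → V) → (Fin 3 → V) := fun k p =>
    ![![p.2 1, p.2 2, p.2 3], ![p.1 0, p.2 2, p.2 3], ![p.1 0, p.1 1, p.2 3],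
      ![p.1 0, p.1 1, p.1 2]] k
  have hsub : P ⊆ univ.biUnion fun k : Fin 4 => P.filter fun p => a k p ∈ X := by
    intro p hp
    have hp' := (mem_filter.1 hp).2
    rw [N4_iff] at hp'
    by_contra hcon
    simp only [mem_biUnion, mem_univ, true_and, mem_filter, not_exists, not_and, hp,
      true_implies] at hcon
    apply hp'.2
    have hXm : ∀ y, y ∉ X → y ∈ H → ℓ (ini y) = ℓ (tl y) := by
      intro y hy hyH
      by_contra h
      exact hy (mem_filter.2 ⟨hyH, h⟩)
    have e0 := hXm _ (hcon 0) hp'.1.1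
    have e1 := hXm _ (hcon 1) hp'.1.2.1
    have e2 := hXm _ (hcon 2) hp'.1.2.2.1
    have e3 := hXm _ (hcon 3) hp'.1.2.2.2
    simp [a, ini, tl] at e0 e1 e2 e3
    rw [eta4 p.1, eta4 p.2]
    exact e0.trans (e1.trans (e2.trans e3))
  have hk : ∀ k : Fin 4, (P.filter fun p => a k p ∈ X).card ≤ X.card * Fintype.card V ^ 3 := by
    intro k
    have hcard : X.card * Fintype.card V ^ 3 = (X ×ˢ (univ : Finset (Fin 3 → V))).card := by
      rw [card_product, card_univ, Fintype.card_fun, Fintype.card_fin]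
    rw [hcard]
    refine card_le_card_of_injOn (fun p => (a k p, r k p)) ?_ ?_
    · intro p hp
      simp only [coe_filter, Set.mem_ofPred_eq] at hp
      simp [hp.2]
    · rintro ⟨f, g⟩ _ ⟨f', g'⟩ _ h
      simp only [Prod.mk.injEq] at h
      obtain ⟨h1, h2⟩ := h
      have q0 := congrFun h1 0
      have q1 := congrFun h1 1
      have q2 := congrFun h1 2
      have q3 := congrFun h1 3
      have q4 := congrFun h1 4
      have s0 := congrFun h2 0
      have s1 := congrFun h2 1
      have s2 := congrFun h2 2
      rw [Prod.mk.injEq, eta4 f, eta4 f', eta4 g, eta4 g']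
      fin_cases k <;> simp [a, r] at q0 q1 q2 q3 q4 s0 s1 s2 <;>
        simp [q0, q1, q2, q3, q4, s0, s1, s2]
  calc P.card ≤ _ := card_le_card hsub
    _ ≤ ∑ k : Fin 4, (P.filter fun p => a k p ∈ X).card := card_biUnion_le
    _ ≤ ∑ k : Fin 4, X.card * Fintype.card V ^ 3 := sum_le_sum fun k _ => hk k
    _ = _ := by simp
end TC

namespace TC
variable {V : Type*} [Fintype V] [DecidableEq V]

def om (H : Finset (Fin 5 → V)) : Finset (Fin 4 → V) := univ.filter fun f => ∃ v, sn f v ∈ H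

theorem ini_om (H : Finset (Fin 5 → V)) (y) (hy : y ∈ H) : ini y ∈ om H :=
  mem_filter.2 ⟨mem_univ _, y 4, by rwa [sn_ini]⟩

theorem tl_om (H : Finset (Fin 5 → V)) (hr : ∀ y ∈ H, rt y ∈ H) (y) (hy : y ∈ H) : tl y ∈ om H := by
  rw [← ini_rt]; exact ini_om H _ (hr y hy)

def crs (H : Finset (Fin 5 → V)) (ℓ : (Fin 4 → V) → ℕ) : Finset (Fin 5 → V) :=
  H.filter fun y => ℓ (ini y) ≠ ℓ (tl y)

def PP (H : Finset (Fin 5 → V)) (γ η : ℝ) (s : ℕ) (ℓ : (Fin 4 → V) → ℕ) : Prop :=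
  (∀ f, ℓ f < s) ∧
  (∀ i < s, γ * (Fintype.card V : ℝ) ^ 4 ≤ (((om H).filter fun f => ℓ f = i).card : ℝ)) ∧
  ((crs H ℓ).card : ℝ) ≤ η * 8 ^ s * (Fintype.card V : ℝ) ^ 5

theorem PP_bound (H : Finset (Fin 5 → V)) (γ η : ℝ) (hγ : 0 < γ) (hn : 0 < Fintype.card V) (s : ℕ)
    (ℓ) (h : PP H γ η s ℓ) : (s : ℝ) ≤ 1 / γ := by
  have hn' : (0:ℝ) < Fintype.card V := by exact_mod_cast hn
  have h1 : ∑ i ∈ range s, γ * (Fintype.card V : ℝ) ^ 4 ≤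
      ∑ i ∈ range s, (((om H).filter fun f => ℓ f = i).card : ℝ) :=
    sum_le_sum fun i hi => h.2.1 i (mem_range.1 hi)
  have h2 : ∑ i ∈ range s, ((om H).filter fun f => ℓ f = i).card = (om H).card :=
    (card_eq_sum_card_fiberwise (fun f _ => by simpa using h.1 f)).symm
  have h3 : (om H).card ≤ Fintype.card V ^ 4 := by
    have : (om H).card ≤ Fintype.card (Fin 4 → V) := card_le_univ _
    rwa [Fintype.card_fun, Fintype.card_fin] at this
  have h4 : ∑ i ∈ range s, (((om H).filter fun f => ℓ f = i).card : ℝ) ≤ (Fintype.card V : ℝ) ^ 4 := by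
    have := h2.le.trans h3; exact_mod_cast this
  rw [sum_const, card_range, nsmul_eq_mul] at h1
  rw [le_div_iff₀ hγ]
  have h5 : (0:ℝ) < (Fintype.card V : ℝ) ^ 4 := by positivity
  refine le_of_mul_le_mul_right ?_ h5
  linarith

theorem split_step (H : Finset (Fin 5 → V)) (hr : ∀ y ∈ H, rt y ∈ H) (γ η : ℝ) (hη : 0 < η)
    (s : ℕ) (ℓ) (h : PP H γ η s ℓ) (hmax : ∀ ℓ', ¬ PP H γ η (s + 1) ℓ') (i : ℕ) (hi : i < s)
    (B : Finset (Fin 4 → V)) (hB : B ⊆ (om H).filter fun f => ℓ f = i)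
    (hB1 : γ * (Fintype.card V : ℝ) ^ 4 ≤ B.card)
    (hB2 : γ * (Fintype.card V : ℝ) ^ 4 ≤ (((om H).filter fun f => ℓ f = i) \ B).card) :
    3 * η * (Fintype.card V : ℝ) ^ 5 ≤
        ∑ f ∈ ((om H).filter fun f => ℓ f = i) \ B,
          ((univ.filter fun v => sn f v ∈ H ∧ nx f v ∈ B).card : ℝ) := by
  set n : ℝ := (Fintype.card V : ℝ) with hn
  set A := (om H).filter fun f => ℓ f = i with hA
  have hBi : ∀ f ∈ B, ℓ f = i := fun f hf => (mem_filter.1 (hB hf)).2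
  set ℓ' : (Fin 4 → V) → ℕ := fun f => if f ∈ B then s else ℓ f with hℓ'
  have hℓs : ∀ f, ℓ f ≠ s := fun f => (h.1 f).ne
  set M1 := H.filter fun y => ini y ∈ B ∧ tl y ∈ A \ B with hM1
  set M2 := H.filter fun y => ini y ∈ A \ B ∧ tl y ∈ B with hM2
  have hcr : crs H ℓ' ⊆ crs H ℓ ∪ (M1 ∪ M2) := by
    intro y hy
    obtain ⟨hyH, hne⟩ := mem_filter.1 hy
    by_cases hc : ℓ (ini y) = ℓ (tl y)
    · refine mem_union_right _ ?_
      by_cases h1 : ini y ∈ B <;> by_cases h2 : tl y ∈ B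
      · simp [hℓ', h1, h2] at hne
      · refine mem_union_left _ (mem_filter.2 ⟨hyH, h1, mem_sdiff.2 ⟨mem_filter.2 ⟨tl_om H hr y hyH, ?_⟩, h2⟩⟩)
        rw [← hc, hBi _ h1]
      · refine mem_union_right _ (mem_filter.2 ⟨hyH, mem_sdiff.2 ⟨mem_filter.2 ⟨ini_om H y hyH, ?_⟩, h1⟩, h2⟩)
        rw [hc, hBi _ h2]
      · simp [hℓ', h1, h2, hc] at hne
    · exact mem_union_left _ (mem_filter.2 ⟨hyH, hc⟩)
  have hcr' : ((crs H ℓ').card : ℝ) ≤ (crs H ℓ).card + (M1.card + M2.card) := by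
    have := (card_le_card hcr).trans ((card_union_le _ _).trans (Nat.add_le_add_left (card_union_le _ _) _))
    exact_mod_cast this
  have hbig : η * 8 ^ (s + 1) * n ^ 5 < (crs H ℓ').card := by
    by_contra hle
    push Not at hle
    refine hmax ℓ' ⟨?_, ?_, hle⟩
    · intro f
      simp only [hℓ']
      split_ifs
      · omega
      · have := h.1 f; omega
    · intro j hj
      by_cases hjs : j = s
      · subst hjs
        refine hB1.trans ?_
        have : B ⊆ (om H).filter fun f => ℓ' f = j := by
          intro f hf
          refine mem_filter.2 ⟨(mem_filter.1 (hB hf)).1, by simp [hℓ', hf]⟩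
        exact_mod_cast card_le_card this
      · by_cases hji : j = i
        · subst hji
          refine hB2.trans ?_
          have : A \ B ⊆ (om H).filter fun f => ℓ' f = j := by
            intro f hf
            rw [mem_sdiff, hA, mem_filter] at hf
            refine mem_filter.2 ⟨hf.1.1, by simp [hℓ', hf.2, hf.1.2]⟩
          exact_mod_cast card_le_card this
        · refine (h.2.1 j (by omega)).trans ?_
          have : ((om H).filter fun f => ℓ f = j) ⊆ (om H).filter fun f => ℓ' f = j := by
            intro f hf
            rw [mem_filter] at hf
            have : f ∉ B := fun hfB => hji (by rw [← hf.2, hBi f hfB])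
            refine mem_filter.2 ⟨hf.1, by simp [hℓ', this, hf.2]⟩
          exact_mod_cast card_le_card this
  -- Eulerian
  have heul : M1.card ≤ M2.card + (crs H ℓ).card := by
    have e1 : (H.filter fun y => ini y ∈ B).card ≤ (H.filter fun y => tl y ∈ B).card := by
      refine card_le_card_of_injOn (fun y => rt (rt (rt (rt y)))) ?_ ?_
      · intro y hy
        simp only [coe_filter, Set.mem_ofPred_eq] at hy ⊢
        refine ⟨hr _ (hr _ (hr _ (hr _ hy.1))), ?_⟩
        rw [← ini_rt, rt5]; exact hy.2
      · intro y _ z _ e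
        exact rt_inj (rt_inj (rt_inj (rt_inj e)))
    have e2 := card_filter_add_card_filter_not (s := H.filter fun y => ini y ∈ B) (fun y => tl y ∈ B)
    have e3 := card_filter_add_card_filter_not (s := H.filter fun y => tl y ∈ B) (fun y => ini y ∈ B)
    rw [filter_filter, filter_filter] at e2 e3
    have e4 : (H.filter fun y => ini y ∈ B ∧ tl y ∈ B) = H.filter fun y => tl y ∈ B ∧ ini y ∈ B := by
      ext y; simp only [mem_filter]; tauto
    rw [e4] at e2
    have e5 : M1.card ≤ (H.filter fun y => ini y ∈ B ∧ tl y ∉ B).card := by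
      refine card_le_card fun y hy => ?_
      rw [mem_filter] at hy ⊢
      exact ⟨hy.1, hy.2.1, (mem_sdiff.1 hy.2.2).2⟩
    have e6 : (H.filter fun y => tl y ∈ B ∧ ini y ∉ B) ⊆ M2 ∪ crs H ℓ := by
      intro y hy
      rw [mem_filter] at hy
      by_cases hc : ℓ (ini y) = i
      · exact mem_union_left _ (mem_filter.2 ⟨hy.1, mem_sdiff.2
          ⟨mem_filter.2 ⟨ini_om H y hy.1, hc⟩, hy.2.2⟩, hy.2.1⟩)
      · refine mem_union_right _ (mem_filter.2 ⟨hy.1, ?_⟩)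
        rw [hBi _ hy.2.1]; exact hc
    have e7 := (card_le_card e6).trans (card_union_le _ _)
    omega
  have heul' : (M1.card : ℝ) ≤ M2.card + (crs H ℓ).card := by exact_mod_cast heul
  have hX := h.2.2
  have hM2s : M2.card ≤ ∑ f ∈ A \ B, (univ.filter fun v => sn f v ∈ H ∧ nx f v ∈ B).card := by
    rw [← card_sigma]
    refine card_le_card_of_injOn (fun y => ⟨ini y, y 4⟩) ?_ ?_
    · intro y hy
      simp only [hM2, coe_filter, Set.mem_ofPred_eq] at hy
      simp only [coe_sigma, Set.mem_sigma_iff, coe_filter, Set.mem_ofPred_eq, mem_univ, true_and, sn_ini, nx_ini]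
      exact ⟨by exact_mod_cast hy.2.1, hy.1, hy.2.2⟩
    · intro y _ z _ e
      simp only [Sigma.mk.injEq, heq_eq_eq] at e
      rw [← sn_ini y, ← sn_ini z, e.1, e.2]
  have hM2r : (M2.card : ℝ) ≤ ∑ f ∈ A \ B, ((univ.filter fun v => sn f v ∈ H ∧ nx f v ∈ B).card : ℝ) := by
    exact_mod_cast hM2s
  refine le_trans ?_ hM2r
  have h8 : (1:ℝ) ≤ 8 ^ s := one_le_pow₀ (by norm_num)
  have hn0 : 0 ≤ n ^ 5 := by positivity
  have h9 : η * n ^ 5 ≤ η * 8 ^ s * n ^ 5 := by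
    refine mul_le_mul_of_nonneg_right ?_ hn0
    nlinarith
  have h10 : η * 8 ^ (s + 1) * n ^ 5 = 8 * (η * 8 ^ s * n ^ 5) := by rw [pow_succ]; ring
  nlinarith

noncomputable def badO (H : Finset (Fin 5 → V)) (ℓ : (Fin 4 → V) → ℕ) (t : ℝ) : Finset (Fin 4 → V) := by
  classical
  exact (om H).filter fun f => ((univ.filter fun g => N4 H f g ∧ ℓ g = ℓ f).card : ℝ) < t

noncomputable def badI (H : Finset (Fin 5 → V)) (ℓ : (Fin 4 → V) → ℕ) (t : ℝ) : Finset (Fin 4 → V) := by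
  classical
  exact (om H).filter fun g => ((univ.filter fun f => N4 H f g ∧ ℓ f = ℓ g).card : ℝ) < t

theorem badO_bound (H : Finset (Fin 5 → V)) (ℓ) (m t : ℝ) (hm : 0 ≤ m) (hc : CleanSet H (fun _ => m))
    (hr : ∀ y ∈ H, rt y ∈ H) (ht : m ^ 4 = 2 * t) :
    (badO H ℓ t).card * t ≤ 4 * ((crs H ℓ).card * (Fintype.card V : ℝ) ^ 3) := by
  classical
  have h1 : ∀ f ∈ badO H ℓ t, t ≤ ((univ.filter fun g => N4 H f g ∧ ℓ f ≠ ℓ g).card : ℝ) := by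
    intro f hf
    simp only [badO, mem_filter] at hf
    have h0 := low_out H m hm hc hr f (mem_filter.1 hf.1).2
    have e := card_filter_add_card_filter_not (s := univ.filter fun g => N4 H f g) (fun g => ℓ g = ℓ f)
    rw [filter_filter, filter_filter] at e
    have e' : ((univ.filter fun g => N4 H f g ∧ ℓ g = ℓ f).card : ℝ) +
      (univ.filter fun g => N4 H f g ∧ ¬ ℓ g = ℓ f).card = (univ.filter fun g => N4 H f g).card := by
      exact_mod_cast e
    have e2 : (univ.filter fun g => N4 H f g ∧ ℓ f ≠ ℓ g) = (univ.filter fun g => N4 H f g ∧ ¬ ℓ g = ℓ f) := by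
      ext g; simp [eq_comm]
    rw [e2]; linarith
  have h2 := cross_count H ℓ
  have h3 : ∑ f ∈ badO H ℓ t, (univ.filter fun g => N4 H f g ∧ ℓ f ≠ ℓ g).card ≤
      (univ.filter fun p : (Fin 4 → V) × (Fin 4 → V) => N4 H p.1 p.2 ∧ ℓ p.1 ≠ ℓ p.2).card := by
    rw [← card_sigma]
    refine card_le_card_of_injOn (fun p => (p.1, p.2)) ?_ ?_
    · rintro ⟨f, g⟩ hp
      simp at hp ⊢; exact hp.2
    · rintro ⟨f, g⟩ _ ⟨f', g'⟩ _ e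
      simpa using e
  have h4 : ∑ f ∈ badO H ℓ t, ((univ.filter fun g => N4 H f g ∧ ℓ f ≠ ℓ g).card : ℝ) ≤
    4 * ((crs H ℓ).card * (Fintype.card V : ℝ) ^ 3) := by exact_mod_cast h3.trans h2
  refine le_trans ?_ h4
  rw [← nsmul_eq_mul, ← sum_const]
  exact sum_le_sum h1

theorem badI_bound (H : Finset (Fin 5 → V)) (ℓ) (m t : ℝ) (hm : 0 ≤ m) (hc : CleanSet H (fun _ => m))
    (hr : ∀ y ∈ H, rt y ∈ H) (ht : m ^ 4 = 2 * t) :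
    (badI H ℓ t).card * t ≤ 4 * ((crs H ℓ).card * (Fintype.card V : ℝ) ^ 3) := by
  classical
  have h1 : ∀ g ∈ badI H ℓ t, t ≤ ((univ.filter fun f => N4 H f g ∧ ℓ f ≠ ℓ g).card : ℝ) := by
    intro g hg
    simp only [badI, mem_filter] at hg
    have h0 := low_in H m hm hc hr g (mem_filter.1 hg.1).2
    have e := card_filter_add_card_filter_not (s := univ.filter fun f => N4 H f g) (fun f => ℓ f = ℓ g)
    rw [filter_filter, filter_filter] at e
    have e' : ((univ.filter fun f => N4 H f g ∧ ℓ f = ℓ g).card : ℝ) +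
      (univ.filter fun f => N4 H f g ∧ ¬ ℓ f = ℓ g).card = (univ.filter fun f => N4 H f g).card := by
      exact_mod_cast e
    show t ≤ ((univ.filter fun f => N4 H f g ∧ ¬ ℓ f = ℓ g).card : ℝ)
    linarith
  have h2 := cross_count H ℓ
  have h3 : ∑ g ∈ badI H ℓ t, (univ.filter fun f => N4 H f g ∧ ℓ f ≠ ℓ g).card ≤
      (univ.filter fun p : (Fin 4 → V) × (Fin 4 → V) => N4 H p.1 p.2 ∧ ℓ p.1 ≠ ℓ p.2).card := by
    rw [← card_sigma]
    refine card_le_card_of_injOn (fun p => (p.2, p.1)) ?_ ?_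
    · rintro ⟨f, g⟩ hp
      simp at hp ⊢; exact hp.2
    · rintro ⟨f, g⟩ _ ⟨f', g'⟩ _ e
      simp at e ⊢; tauto
  have h4 : ∑ g ∈ badI H ℓ t, ((univ.filter fun f => N4 H f g ∧ ℓ f ≠ ℓ g).card : ℝ) ≤
    4 * ((crs H ℓ).card * (Fintype.card V : ℝ) ^ 3) := by exact_mod_cast h3.trans h2
  refine le_trans ?_ h4
  rw [← nsmul_eq_mul, ← sum_const]
  exact sum_le_sum h1

theorem fib_bound (H : Finset (Fin 5 → V)) (S : Finset (Fin 4 → V)) :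
    (H.filter fun y => ini y ∈ S).card ≤ S.card * Fintype.card V := by
  rw [← card_univ, ← card_product]
  refine card_le_card_of_injOn (fun y => (ini y, y 4)) ?_ ?_
  · intro y hy
    simp only [coe_filter, Set.mem_ofPred_eq] at hy
    simp [hy.2]
  · intro y _ z _ e
    simp only [Prod.mk.injEq] at e
    rw [← sn_ini y, ← sn_ini z, e.1, e.2]

/-- rotation-closed core of a predicate -/
theorem rot_core (H : Finset (Fin 5 → V)) (hr : ∀ y ∈ H, rt y ∈ H) (G : (Fin 5 → V) → Prop)
    [DecidablePred G] :
    ∃ H' ⊆ H, (∀ y ∈ H', rt y ∈ H') ∧ (∀ y ∈ H', G y) ∧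
      H.card ≤ H'.card + 5 * (H.filter fun y => ¬ G y).card := by
  refine ⟨H.filter fun y => G y ∧ G (rt y) ∧ G (rt (rt y)) ∧ G (rt (rt (rt y))) ∧
    G (rt (rt (rt (rt y)))), filter_subset _ _, ?_, ?_, ?_⟩
  · intro y hy
    rw [mem_filter] at hy ⊢
    refine ⟨hr _ hy.1, hy.2.2.1, hy.2.2.2.1, hy.2.2.2.2.1, hy.2.2.2.2.2, ?_⟩
    rw [rt5]; exact hy.2.1
  · intro y hy; exact (mem_filter.1 hy).2.1
  · set Z := H.filter fun y => ¬ G y with hZ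
    have key : ∀ ρ : (Fin 5 → V) → (Fin 5 → V), Function.Injective ρ → (∀ y ∈ H, ρ y ∈ H) →
        (H.filter fun y => ¬ G (ρ y)).card ≤ Z.card := by
      intro ρ hi hm
      refine card_le_card_of_injOn ρ ?_ (hi.injOn)
      intro y hy
      simp only [coe_filter, Set.mem_ofPred_eq, hZ] at hy ⊢
      exact ⟨hm y hy.1, hy.2⟩
    have k0 := key id Function.injective_id (fun y h => h)
    have k1 := key rt rt_inj hr
    have k2 := key (rt ∘ rt) (rt_inj.comp rt_inj) (fun y h => hr _ (hr _ h))
    have k3 := key (rt ∘ rt ∘ rt) (rt_inj.comp (rt_inj.comp rt_inj)) (fun y h => hr _ (hr _ (hr _ h)))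
    have k4 := key (rt ∘ rt ∘ rt ∘ rt) (rt_inj.comp (rt_inj.comp (rt_inj.comp rt_inj)))
      (fun y h => hr _ (hr _ (hr _ (hr _ h))))
    simp only [Function.comp, id] at k0 k1 k2 k3 k4
    have hsub : H ⊆ (H.filter fun y => G y ∧ G (rt y) ∧ G (rt (rt y)) ∧ G (rt (rt (rt y))) ∧
        G (rt (rt (rt (rt y))))) ∪ ((H.filter fun y => ¬ G y) ∪ ((H.filter fun y => ¬ G (rt y)) ∪
        ((H.filter fun y => ¬ G (rt (rt y))) ∪ ((H.filter fun y => ¬ G (rt (rt (rt y)))) ∪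
        (H.filter fun y => ¬ G (rt (rt (rt (rt y))))))))) := by
      intro y hy
      simp only [mem_union, mem_filter, hy, true_and]
      tauto
    have := card_le_card hsub
    have u1 := card_union_le (H.filter fun y => G y ∧ G (rt y) ∧ G (rt (rt y)) ∧ G (rt (rt (rt y))) ∧
        G (rt (rt (rt (rt y))))) ((H.filter fun y => ¬ G y) ∪ ((H.filter fun y => ¬ G (rt y)) ∪
        ((H.filter fun y => ¬ G (rt (rt y))) ∪ ((H.filter fun y => ¬ G (rt (rt (rt y)))) ∪
        (H.filter fun y => ¬ G (rt (rt (rt (rt y)))))))))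
    have u2 := card_union_le (H.filter fun y => ¬ G y) ((H.filter fun y => ¬ G (rt y)) ∪
        ((H.filter fun y => ¬ G (rt (rt y))) ∪ ((H.filter fun y => ¬ G (rt (rt (rt y)))) ∪
        (H.filter fun y => ¬ G (rt (rt (rt (rt y))))))))
    have u3 := card_union_le (H.filter fun y => ¬ G (rt y))
        ((H.filter fun y => ¬ G (rt (rt y))) ∪ ((H.filter fun y => ¬ G (rt (rt (rt y)))) ∪
        (H.filter fun y => ¬ G (rt (rt (rt (rt y)))))))
    have u4 := card_union_le (H.filter fun y => ¬ G (rt (rt y))) ((H.filter fun y => ¬ G (rt (rt (rt y)))) ∪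
        (H.filter fun y => ¬ G (rt (rt (rt (rt y))))))
    have u5 := card_union_le (H.filter fun y => ¬ G (rt (rt (rt y))))
        (H.filter fun y => ¬ G (rt (rt (rt (rt y)))))
    omega
end TC

namespace TC

theorem N4_om_r {V : Type*} [Fintype V] [DecidableEq V] (H : Finset (Fin 5 → V))
    (hr : ∀ y ∈ H, rt y ∈ H) (f g) (h : N4 H f g) : g ∈ om H := by
  rw [N4_iff] at h
  refine mem_filter.2 ⟨mem_univ _, f 3, ?_⟩
  have := hr _ h.2.2.2
  rwa [rt_mk] at this

theorem N4_om_l {V : Type*} [Fintype V] [DecidableEq V] (H : Finset (Fin 5 → V))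
    (f g) (h : N4 H f g) : f ∈ om H := by
  rw [N4_iff] at h
  exact mem_filter.2 ⟨mem_univ _, g 0, h.1⟩

theorem TWl_mono {V : Type*} [Fintype V] [DecidableEq V] {H H' : Finset (Fin 5 → V)} (h : H ⊆ H') :
    ∀ (l : List V) (f : Fin 4 → V), TWl H f l → TWl H' f l
  | [], _, _ => trivial
  | _ :: l, _, hl => ⟨h hl.1, TWl_mono h l _ hl.2⟩

theorem cnt_mono {V : Type*} [Fintype V] [DecidableEq V] {H H' : Finset (Fin 5 → V)} (h : H ⊆ H')
    (j f g) : cnt H j f g ≤ cnt H' j f g :=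
  card_le_card fun z hz => by
    rw [mem_filter] at hz ⊢; exact ⟨hz.1, TWl_mono h _ _ hz.2⟩

theorem conn (δ : ℝ) (hδ : 0 < δ) (hδ1 : δ ≤ 1) :
    ∃ (K L : ℕ) (c : ℝ), 0 < c ∧ (K : ℝ) ≤ 40000 / δ ^ 4 ∧
      ∀ (V : Type) [Fintype V] [DecidableEq V], 0 < Fintype.card V →
      ∀ H : Finset (Fin 5 → V), (∀ y ∈ H, rt y ∈ H) →
      ∃ (ℓ : (Fin 4 → V) → ℕ) (H' : Finset (Fin 5 → V)), (∀ f, ℓ f < K) ∧ H' ⊆ H ∧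
        (∀ y ∈ H', rt y ∈ H') ∧ (H.card : ℝ) ≤ H'.card + δ * (Fintype.card V : ℝ) ^ 5 ∧
        (∀ y ∈ H', ℓ (ini y) = ℓ (tl y)) ∧
        ∀ y ∈ H', ∀ y' ∈ H', ℓ (ini y) = ℓ (ini y') →
          ∃ j ≤ L, c * (Fintype.card V : ℝ) ^ j ≤ cnt H j (ini y) (ini y') := by
  set γ : ℝ := δ ^ 4 / 40000 with hγd
  have hγ : 0 < γ := by positivity
  have hγ1 : γ ≤ 1 := by
    rw [hγd, div_le_one (by norm_num)]
    have : δ ^ 4 ≤ 1 := pow_le_one₀ hδ.le hδ1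
    linarith
  set K := ⌊1 / γ⌋₊ with hK
  have hK1 : 1 ≤ K := by
    rw [hK, Nat.one_le_floor_iff, le_div_iff₀ hγ]; linarith
  set η : ℝ := δ * γ / 100 with hη
  have hη0 : 0 < η := by positivity
  set η0 : ℝ := η / 8 ^ K with hη0d
  have hη00 : 0 < η0 := by positivity
  have hη1 : η0 ≤ 1 / 100 := by
    rw [hη0d, div_le_iff₀ (by positivity)]
    have h8 : (1:ℝ) ≤ 8 ^ K := one_le_pow₀ (by norm_num)
    have : η ≤ 1 / 100 := by rw [hη]; nlinarith
    linarith
  set θ : ℝ := 3 * η0 with hθ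
  have hθ0 : 0 < θ := by positivity
  obtain ⟨I, hI⟩ := exists_nat_gt (2 / θ)
  rw [div_lt_iff₀ hθ0] at hI
  refine ⟨K, I + 4, γ * (θ / 2) ^ I / (I + 1), by positivity, ?_, ?_⟩
  · refine (Nat.floor_le (by positivity)).trans (le_of_eq ?_)
    rw [hγd, one_div_div]
  intro V _ _ hn H hr
  classical
  set n : ℝ := (Fintype.card V : ℝ) with hnd
  have hn0 : 0 < n := by rw [hnd]; exact_mod_cast hn
  obtain ⟨G, hGH, hGc, hGr, hGl⟩ := clean_rot (δ / 10 * n) (by positivity) H hr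
  rw [← hnd] at hGl
  by_cases hGe : G = ∅
  · refine ⟨fun _ => 0, ∅, fun _ => hK1, by simp, by simp, ?_, by simp, by simp⟩
    subst hGe
    refine hGl.trans ?_
    have : (0:ℝ) < n ^ 5 := by positivity
    have e : 5 * (δ / 10 * n) * n ^ 4 = δ / 2 * n ^ 5 := by ring
    rw [e]; simp only [card_empty]; push_cast; nlinarith
  obtain ⟨y0, hy0⟩ := nonempty_iff_ne_empty.2 hGe
  have hm4 : (δ / 10 * n) ^ 4 = 2 * (2 * γ * n ^ 4) := by rw [hγd]; ring
  have hP1 : PP G γ η0 1 (fun _ => 0) := by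
    refine ⟨fun _ => Nat.one_pos, ?_, ?_⟩
    · intro i hi
      have := low_out G (δ / 10 * n) (by positivity) hGc hGr (ini y0) ⟨y0 4, by rwa [sn_ini]⟩
      have h2 : (univ.filter fun g => N4 G (ini y0) g) ⊆ (om G).filter fun _ => 0 = i := by
        intro g hg
        exact mem_filter.2 ⟨N4_om_r G hGr _ _ (mem_filter.1 hg).2, by omega⟩
      have h3 : ((univ.filter fun g => N4 G (ini y0) g).card : ℝ) ≤
        (((om G).filter fun _ => 0 = i).card : ℝ) := by exact_mod_cast card_le_card h2
      rw [hm4] at this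
      have : 0 < γ * n ^ 4 := by positivity
      rw [← hnd]
      linarith
    · have : crs G (fun _ => 0) = ∅ := by simp [crs]
      rw [this]; simp only [card_empty, Nat.cast_zero]; positivity
  have hPK : ∀ s, (∃ ℓ, PP G γ η0 s ℓ) → s ≤ K := by
    rintro s ⟨ℓ, h⟩
    exact Nat.le_floor (PP_bound G γ η0 hγ hn s ℓ h)
  set s := Nat.findGreatest (fun s => ∃ ℓ, PP G γ η0 s ℓ) K with hs
  obtain ⟨ℓ, hℓ⟩ : ∃ ℓ, PP G γ η0 s ℓ :=
    Nat.findGreatest_spec (P := fun s => ∃ ℓ, PP G γ η0 s ℓ) (m := 1) hK1 ⟨_, hP1⟩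
  have hsK : s ≤ K := Nat.findGreatest_le K
  have hmax : ∀ ℓ', ¬ PP G γ η0 (s + 1) ℓ' := by
    intro ℓ' h
    have := Nat.le_findGreatest (P := fun s => ∃ ℓ, PP G γ η0 s ℓ) (hPK _ ⟨ℓ', h⟩) ⟨ℓ', h⟩
    omega
  have hcrs : ((crs G ℓ).card : ℝ) ≤ η * n ^ 5 := by
    refine hℓ.2.2.trans (mul_le_mul_of_nonneg_right ?_ (by positivity))
    rw [hη0d, div_mul_eq_mul_div, div_le_iff₀ (by positivity)]
    exact mul_le_mul_of_nonneg_left (pow_le_pow_right₀ (by norm_num) hsK) hη0.le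
  have hbO := badO_bound G ℓ _ (2 * γ * n ^ 4) (by positivity) hGc hGr hm4
  have hbI := badI_bound G ℓ _ (2 * γ * n ^ 4) (by positivity) hGc hGr hm4
  have hbound : ∀ S : Finset (Fin 4 → V), S.card * (2 * γ * n ^ 4) ≤ 4 * ((crs G ℓ).card * n ^ 3) →
      ((G.filter fun y => ini y ∈ S).card : ℝ) ≤ δ / 50 * n ^ 5 := by
    intro S hS
    have h1 : ((G.filter fun y => ini y ∈ S).card : ℝ) ≤ S.card * n := by
      rw [hnd]; exact_mod_cast fib_bound G S
    refine h1.trans ?_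
    have h2 : S.card * (2 * γ * n ^ 4) ≤ 4 * (η * n ^ 5 * n ^ 3) :=
      hS.trans (by gcongr)
    have h3 : 0 < 2 * γ * n ^ 3 := by positivity
    refine le_of_mul_le_mul_right ?_ h3
    calc S.card * n * (2 * γ * n ^ 3) = S.card * (2 * γ * n ^ 4) := by ring
      _ ≤ _ := h2
      _ = δ / 50 * n ^ 5 * (2 * γ * n ^ 3) := by rw [hη]; ring
  obtain ⟨H', hH', hH'r, hH'g, hH'c⟩ := rot_core G hGr (fun y => ℓ (ini y) = ℓ (tl y) ∧
    ini y ∉ badO G ℓ (2 * γ * n ^ 4) ∧ ini y ∉ badI G ℓ (2 * γ * n ^ 4))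
  refine ⟨ℓ, H', fun f => (hℓ.1 f).trans_le hsK, hH'.trans hGH, hH'r, ?_, fun y hy => (hH'g y hy).1, ?_⟩
  · have h1 : (G.filter fun y => ¬ (ℓ (ini y) = ℓ (tl y) ∧
      ini y ∉ badO G ℓ (2 * γ * n ^ 4) ∧ ini y ∉ badI G ℓ (2 * γ * n ^ 4))) ⊆
        crs G ℓ ∪ ((G.filter fun y => ini y ∈ badO G ℓ (2 * γ * n ^ 4)) ∪
          (G.filter fun y => ini y ∈ badI G ℓ (2 * γ * n ^ 4))) := by
      intro y hy
      simp only [mem_filter, crs, mem_union] at hy ⊢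
      tauto
    have h2 := (card_le_card h1).trans ((card_union_le _ _).trans (Nat.add_le_add_left (card_union_le _ _) _))
    have b1 := hbound _ hbO
    have b2 := hbound _ hbI
    have h3 : (G.card : ℝ) ≤ H'.card + 5 * ((crs G ℓ).card + (
      ((G.filter fun y => ini y ∈ badO G ℓ (2 * γ * n ^ 4)).card : ℝ) +
      ((G.filter fun y => ini y ∈ badI G ℓ (2 * γ * n ^ 4)).card : ℝ))) := by
      have := hH'c.trans (Nat.add_le_add_left (Nat.mul_le_mul_left 5 h2) _)
      exact_mod_cast this
    have e : 5 * (δ / 10 * n) * n ^ 4 = δ / 2 * n ^ 5 := by ring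
    have h5 : (0:ℝ) < n ^ 5 := by positivity
    have h6 : η * n ^ 5 ≤ δ / 100 * n ^ 5 := by
      refine mul_le_mul_of_nonneg_right ?_ h5.le
      rw [hη]; nlinarith
    have h7 : 0 < δ * n ^ 5 := by positivity
    linarith
  · intro y hy y' hy' he
    obtain ⟨-, hO, -⟩ := hH'g y hy
    obtain ⟨-, -, hI'⟩ := hH'g y' hy'
    have hyo := ini_om G y (hH' hy)
    have hyo' := ini_om G y' (hH' hy')
    set A := (om G).filter fun f => ℓ f = ℓ (ini y) with hA
    have hc := connect G A (ini y) (ini y') θ γ hθ0 (by rw [hθ]; linarith) hγ hn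
      (fun B hB h1 h2 => split_step G hGr γ η0 hη00 s ℓ hℓ hmax _ (hℓ.1 _) B hB h1 h2)
      (by
        simp only [badI, mem_filter, hyo', true_and, not_lt] at hI'
        have : (univ.filter fun f => N4 G f (ini y') ∧ ℓ f = ℓ (ini y')) ⊆
            A.filter fun f => N4 G f (ini y') := by
          intro f hf
          simp only [mem_filter, mem_univ, true_and] at hf
          exact mem_filter.2 ⟨mem_filter.2 ⟨N4_om_l G _ _ hf.1, by rw [hf.2, he]⟩, hf.1⟩
        have h2 : ((univ.filter fun f => N4 G f (ini y') ∧ ℓ f = ℓ (ini y')).card : ℝ) ≤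
            ((A.filter fun f => N4 G f (ini y')).card : ℝ) := by exact_mod_cast card_le_card this
        have : 0 < γ * n ^ 4 := by positivity
        rw [← hnd]; linarith)
      (by
        simp only [badO, mem_filter, hyo, true_and, not_lt] at hO
        have : (univ.filter fun f => N4 G (ini y) f ∧ ℓ f = ℓ (ini y)) ⊆
            A.filter fun f => N4 G (ini y) f := by
          intro f hf
          simp only [mem_filter, mem_univ, true_and] at hf
          exact mem_filter.2 ⟨mem_filter.2 ⟨N4_om_r G hGr _ _ hf.1, hf.2⟩, hf.1⟩
        have h2 : ((univ.filter fun f => N4 G (ini y) f ∧ ℓ f = ℓ (ini y)).card : ℝ) ≤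
            ((A.filter fun f => N4 G (ini y) f).card : ℝ) := by exact_mod_cast card_le_card this
        rw [← hnd]; linarith)
      I hI
    obtain ⟨j, hj, hc⟩ := hc
    refine ⟨j, hj, hc.trans ?_⟩
    exact_mod_cast cnt_mono hGH _ _ _
end TC

namespace TC

theorem hit_eq {V : Type*} [Fintype V] [DecidableEq V] (j : ℕ) (i : Fin j) (v : V) :
    (univ.filter fun z : Fin j → V => z i = v).card * Fintype.card V ≤ Fintype.card V ^ j := by
  have e : Fintype.card V ^ j = (univ : Finset (Fin j → V)).card := by simp
  rw [e, ← card_univ (α := V), ← card_product]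
  refine card_le_card_of_injOn (fun p => Function.update p.1 i p.2) (by intro _ _; simp) ?_
  rintro ⟨z, w⟩ hz ⟨z', w'⟩ hz' h
  simp only [coe_product, coe_filter, mem_univ, true_and, coe_univ, Set.mem_prod, Set.mem_ofPred_eq, Set.mem_univ, and_true] at hz hz' h
  have hw : w = w' := by have := congrFun h i; simpa using this
  refine Prod.ext (funext fun k => ?_) hw
  by_cases hk : k = i
  · subst hk; exact hz.trans hz'.symm
  · have := congrFun h k; simpa [hk] using this

theorem hit_dup {V : Type*} [Fintype V] [DecidableEq V] (j : ℕ) (i k : Fin j) (hik : i ≠ k) :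
    (univ.filter fun z : Fin j → V => z i = z k).card * Fintype.card V ≤ Fintype.card V ^ j := by
  have e : Fintype.card V ^ j = (univ : Finset (Fin j → V)).card := by simp
  rw [e, ← card_univ (α := V), ← card_product]
  refine card_le_card_of_injOn (fun p => Function.update p.1 i p.2) (by intro _ _; simp) ?_
  rintro ⟨z, w⟩ hz ⟨z', w'⟩ hz' h
  simp only [coe_product, coe_filter, mem_univ, true_and, coe_univ, Set.mem_prod, Set.mem_ofPred_eq, Set.mem_univ, and_true] at hz hz' h
  have hw : w = w' := by have := congrFun h i; simpa using this
  have ho : ∀ l, l ≠ i → z l = z' l := by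
    intro l hl; have := congrFun h l; simpa [hl] using this
  refine Prod.ext (funext fun l => ?_) hw
  by_cases hl : l = i
  · subst hl; show z l = z' l
    rw [hz, hz', ho k hik.symm]
  · exact ho l hl

theorem hit_v {V : Type*} [Fintype V] [DecidableEq V] (j : ℕ) (v : V) :
    (univ.filter fun z : Fin j → V => ∃ i, z i = v).card * Fintype.card V ≤ j * Fintype.card V ^ j := by
  have : (univ.filter fun z : Fin j → V => ∃ i, z i = v) =
      univ.biUnion fun i => univ.filter fun z : Fin j → V => z i = v := by
    ext z; simp
  rw [this]
  refine (Nat.mul_le_mul_right _ card_biUnion_le).trans ?_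
  rw [sum_mul]
  refine (sum_le_sum fun i _ => hit_eq j i v).trans ?_
  simp

theorem hit_ext {V : Type*} [Fintype V] [DecidableEq V] (q j : ℕ) (z : Fin j → V) :
    (q + 1) ^ Fintype.card V ≤ (q + 1) ^ j *
      (univ.filter fun ω : V → Fin (q + 1) => ∀ i, ω (z i) = 0).card := by
  have e : (q + 1) ^ Fintype.card V = (univ : Finset (V → Fin (q + 1))).card := by simp
  have e2 : (q + 1) ^ j = (univ : Finset (Fin j → Fin (q + 1))).card := by simp
  rw [e, e2, ← card_product]
  refine card_le_card_of_injOn (fun ω => (ω ∘ z, fun v => if ∃ i, z i = v then 0 else ω v)) ?_ ?_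
  · intro ω _
    simp
  · intro ω _ ω' _ h
    simp only [Prod.mk.injEq] at h
    funext v
    by_cases hv : ∃ i, z i = v
    · obtain ⟨i, rfl⟩ := hv
      exact congrFun h.1 i
    · have := congrFun h.2 v
      simpa [hv] using this

theorem decay (κ : ℝ) (hκ : 0 < κ) : ∃ n0 : ℕ, ∀ n : ℕ, n0 ≤ n →
    2 * (n:ℝ) ^ 8 * Real.exp (- (κ * n)) < 1 / 2 := by
  have h := Real.tendsto_pow_mul_exp_neg_atTop_nhds_zero 8
  have h1 : Filter.Tendsto (fun n : ℕ => κ * (n:ℝ)) Filter.atTop Filter.atTop :=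
    Filter.Tendsto.const_mul_atTop hκ tendsto_natCast_atTop_atTop
  have h2 := (h.comp h1).eventually (gt_mem_nhds (show (0:ℝ) < κ ^ 8 / 4 by positivity))
  obtain ⟨n0, h0⟩ := Filter.eventually_atTop.1 h2
  refine ⟨n0, fun n hn => ?_⟩
  have := h0 n hn
  simp only [Function.comp] at this
  rw [mul_pow] at this
  have hk : 0 < κ ^ 8 := by positivity
  refine lt_of_mul_lt_mul_left ?_ hk.le
  nlinarith

/-- random reservoir -/
theorem reservoir (L : ℕ) (c ρ : ℝ) (hc : 0 < c) (hρ : 0 < ρ) :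
    ∃ c' : ℝ, 0 < c' ∧ ∃ n0 : ℕ, ∀ (V T : Type) [Fintype V] [DecidableEq V] [Fintype T],
      n0 ≤ Fintype.card V → 0 < Fintype.card V → (Fintype.card T : ℝ) ≤ 2 * (Fintype.card V : ℝ) ^ 8 →
      ∀ (j : T → ℕ) (S : ∀ t, Finset (Fin (j t) → V)), (∀ t, j t ≤ L) →
      (∀ t, c * (Fintype.card V : ℝ) ^ (j t) ≤ (S t).card) →
      ∃ X : Finset V, (X.card : ℝ) ≤ ρ * Fintype.card V ∧
        ∀ t, c' * (Fintype.card V : ℝ) ^ (j t) ≤ ((S t).filter fun z => ∀ i, z i ∈ X).card := by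
  obtain ⟨q, hq⟩ := exists_nat_gt (2 / ρ)
  rw [div_lt_iff₀ hρ] at hq
  set Q : ℝ := (q : ℝ) + 1 with hQ
  have hQ1 : 1 ≤ Q := by rw [hQ]; linarith [(Nat.cast_nonneg q : (0:ℝ) ≤ q)]
  have hQ0 : 0 < Q := by linarith
  set c' := c / Q ^ L / 2 with hc'
  have hc'0 : 0 < c' := by positivity
  set κ : ℝ := c' ^ 2 / (2 * (L + 1) ^ 2) with hκ
  have hκ0 : 0 < κ := by positivity
  obtain ⟨n0, hn0⟩ := decay κ hκ0
  refine ⟨c', hc'0, n0, ?_⟩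
  intro V T _ _ _ hn hnp hT j S hj hS
  classical
  set n : ℝ := (Fintype.card V : ℝ) with hnd
  have hnp' : 0 < n := by rw [hnd]; exact_mod_cast hnp
  set F : ∀ t, (V → Fin (q+1)) → ℝ := fun t ω => (((S t).filter fun z => ∀ i, ω (z i) = 0).card : ℝ) with hF
  have hcard : (Fintype.card (Fin (q+1)) : ℝ) = Q := by simp [hQ]
  have hbadt : ∀ t, ((univ.filter fun ω => F t ω ≤ c' * n ^ (j t)).card : ℝ) ≤
      Real.exp (-(κ * n)) * Q ^ Fintype.card V := by
    intro t
    set m : ℝ := (∑ ω, F t ω) / Q ^ Fintype.card V with hm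
    have hmlow : 2 * c' * n ^ (j t) ≤ m := by
      rw [hm, le_div_iff₀ (by positivity)]
      have e1 : ∑ ω, F t ω = ∑ z ∈ S t, ((univ.filter fun ω : V → Fin (q + 1) => ∀ i, ω (z i) = 0).card : ℝ) := by
        simp only [hF, card_filter, Nat.cast_sum]
        rw [sum_comm]
      rw [e1]
      have e2 : ∀ z ∈ S t, Q ^ Fintype.card V / Q ^ L ≤
          ((univ.filter fun ω : V → Fin (q + 1) => ∀ i, ω (z i) = 0).card : ℝ) := by
        intro z _
        rw [div_le_iff₀ (by positivity)]
        have : Q ^ Fintype.card V ≤ Q ^ (j t) * ((univ.filter fun ω : V → Fin (q + 1) => ∀ i, ω (z i) = 0).card : ℝ) := by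
          rw [hQ]; exact_mod_cast hit_ext q (j t) z
        refine this.trans ?_
        rw [mul_comm]
        exact mul_le_mul_of_nonneg_left (pow_le_pow_right₀ hQ1 (hj t)) (by positivity)
      have e3 := sum_le_sum e2
      rw [sum_const, nsmul_eq_mul] at e3
      refine le_trans ?_ e3
      have := mul_le_mul_of_nonneg_right (hS t) (show 0 ≤ Q ^ Fintype.card V / Q ^ L by positivity)
      refine le_trans (le_of_eq ?_) this
      rw [hc']; ring
    have hmc := mcdiarmid' (fun ω => - F t ω) ((L + 1) * n ^ (j t) / n) (c' * n ^ (j t)) (-m)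
      (by positivity) (by positivity) (by
        intro ω v a
        set bad := univ.filter fun z : Fin (j t) → V => ∃ i, z i = v with hbad
        have hb : (bad.card : ℝ) ≤ (L + 1) * n ^ (j t) / n := by
          rw [le_div_iff₀ hnp']
          have h1 : (bad.card : ℝ) * n ≤ j t * n ^ (j t) := by
            rw [hnd]; exact_mod_cast hit_v (j t) v
          refine h1.trans (mul_le_mul_of_nonneg_right ?_ (by positivity))
          have : (j t : ℝ) ≤ L := by exact_mod_cast hj t
          linarith
        have key : ∀ ω ω' : V → Fin (q+1), (∀ u, u ≠ v → ω u = ω' u) → F t ω ≤ F t ω' + bad.card := by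
          intro ω ω' h
          have : ((S t).filter fun z => ∀ i, ω (z i) = 0) ⊆
              ((S t).filter fun z => ∀ i, ω' (z i) = 0) ∪ bad := by
            intro z hz
            rw [mem_filter] at hz
            by_cases hv : ∃ i, z i = v
            · exact mem_union_right _ (mem_filter.2 ⟨mem_univ _, hv⟩)
            · push Not at hv
              exact mem_union_left _ (mem_filter.2 ⟨hz.1, fun i => by rw [← h _ (hv i)]; exact hz.2 i⟩)
          have := (card_le_card this).trans (card_union_le _ _)
          simp only [hF]; exact_mod_cast this
        have k1 := key (Function.update ω v a) ω (fun u hu => by simp [hu])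
        have k2 := key ω (Function.update ω v a) (fun u hu => by simp [hu])
        rw [abs_le]; constructor <;> linarith)
      (by
        rw [sum_neg_distrib, hcard, hm]; field_simp)
    rw [hcard] at hmc
    have e4 : (c' * n ^ (j t)) ^ 2 / (2 * ((L + 1) * n ^ (j t) / n) ^ 2 * (Fintype.card V : ℝ)) = κ * n := by
      rw [← hnd, hκ]; field_simp
    rw [e4] at hmc
    refine le_trans ?_ hmc
    have : (univ.filter fun ω => F t ω ≤ c' * n ^ (j t)) ⊆
        univ.filter fun ω => -m + c' * n ^ (j t) ≤ -F t ω := by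
      intro ω hω
      rw [mem_filter] at hω ⊢
      refine ⟨hω.1, ?_⟩
      linarith [hω.2]
    exact_mod_cast card_le_card this
  -- size of X
  set Xs : (V → Fin (q+1)) → Finset V := fun ω => univ.filter fun v => ω v = 0 with hXs
  have hsize : ((univ.filter fun ω => ρ * n < ((Xs ω).card : ℝ)).card : ℝ) ≤ Q ^ Fintype.card V / 2 := by
    have hsum : ∑ ω, ((Xs ω).card : ℝ) ≤ n * (Q ^ Fintype.card V / Q) := by
      have e1 : ∑ ω, ((Xs ω).card : ℝ) = ∑ v, ((univ.filter fun ω : V → Fin (q + 1) => ω v = 0).card : ℝ) := by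
        simp only [hXs, card_filter, Nat.cast_sum]
        rw [sum_comm]
      rw [e1]
      have e2 : ∀ v ∈ (univ : Finset V), ((univ.filter fun ω : V → Fin (q + 1) => ω v = 0).card : ℝ) ≤
          Q ^ Fintype.card V / Q := by
        intro v _
        rw [le_div_iff₀ hQ0]
        have : (univ.filter fun ω : V → Fin (q + 1) => ω v = 0).card * (q + 1) ≤ (q+1) ^ Fintype.card V := by
          have e : (q + 1) ^ Fintype.card V = (univ : Finset (V → Fin (q+1))).card := by simp
          have e' : (univ : Finset (Fin (q+1))).card = q + 1 := by simp
          rw [e]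
          refine le_trans (le_of_eq (congrArg (_ * ·) e'.symm)) ?_
          show _ * _ ≤ _
          rw [← card_product]
          refine card_le_card_of_injOn (fun p => Function.update p.1 v p.2) (by intro _ _; simp) ?_
          rintro ⟨z, w⟩ hz ⟨z', w'⟩ hz' h
          simp only [coe_product, coe_filter, mem_univ, true_and, coe_univ, Set.mem_prod, Set.mem_ofPred_eq, Set.mem_univ, and_true] at hz hz' h
          have hw : w = w' := by have := congrFun h v; simpa using this
          refine Prod.ext (funext fun k => ?_) hw
          by_cases hk : k = v
          · subst hk; exact hz.trans hz'.symm
          · have := congrFun h k; simpa [hk] using this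
        rw [hQ]; exact_mod_cast this
      refine (sum_le_sum e2).trans ?_
      rw [sum_const, nsmul_eq_mul, card_univ]
    have h2 : ((univ.filter fun ω => ρ * n < ((Xs ω).card : ℝ)).card : ℝ) * (ρ * n) ≤ ∑ ω, ((Xs ω).card : ℝ) := by
      rw [← nsmul_eq_mul, ← sum_const]
      refine (sum_le_sum (fun ω hω => (mem_filter.1 hω).2.le)).trans ?_
      exact sum_le_sum_of_subset_of_nonneg (filter_subset _ _) (fun _ _ _ => by positivity)
    have h3 := h2.trans hsum
    have h4 : ((univ.filter fun ω => ρ * n < ((Xs ω).card : ℝ)).card : ℝ) * (ρ * Q) ≤ Q ^ Fintype.card V := by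
      refine le_of_mul_le_mul_right ?_ (show 0 < n / Q by positivity)
      calc _ = ((univ.filter fun ω => ρ * n < ((Xs ω).card : ℝ)).card : ℝ) * (ρ * n) := by field_simp
        _ ≤ _ := h3
        _ = _ := by ring
    have h5 : 2 ≤ ρ * Q := by rw [hQ]; nlinarith
    have h6 : (0:ℝ) ≤ ((univ.filter fun ω => ρ * n < ((Xs ω).card : ℝ)).card : ℝ) := by positivity
    nlinarith
  by_contra hcon
  push Not at hcon
  have hcov : (univ : Finset (V → Fin (q+1))) ⊆ (univ.filter fun ω => ρ * n < ((Xs ω).card : ℝ)) ∪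
      univ.biUnion fun t => univ.filter fun ω => F t ω ≤ c' * n ^ (j t) := by
    intro ω _
    rw [mem_union]
    by_cases h : ρ * n < ((Xs ω).card : ℝ)
    · left; simpa using h
    · right
      obtain ⟨t, ht⟩ := hcon (Xs ω) (not_lt.1 h)
      refine mem_biUnion.2 ⟨t, mem_univ _, mem_filter.2 ⟨mem_univ _, ?_⟩⟩
      have : ((S t).filter fun z => ∀ i, ω (z i) = 0) = (S t).filter fun z => ∀ i, z i ∈ Xs ω := by
        ext z; simp [hXs]
      simp only [hF, this]; exact ht.le
  have h1 := (card_le_card hcov).trans ((card_union_le _ _).trans (Nat.add_le_add_left card_biUnion_le _))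
  have h2 : Q ^ Fintype.card V ≤ ((univ.filter fun ω => ρ * n < ((Xs ω).card : ℝ)).card : ℝ) +
      ∑ t, ((univ.filter fun ω => F t ω ≤ c' * n ^ (j t)).card : ℝ) := by
    have e : Q ^ Fintype.card V = ((univ : Finset (V → Fin (q+1))).card : ℝ) := by simp [hQ]
    rw [e]; exact_mod_cast h1
  have h3 := sum_le_sum (s := univ) (fun t _ => hbadt t)
  rw [sum_const, nsmul_eq_mul, card_univ] at h3
  have h4 := hn0 _ hn
  rw [← hnd] at h4
  have hQn : 0 < Q ^ Fintype.card V := by positivity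
  have h5 : (Fintype.card T : ℝ) * (Real.exp (-(κ * n)) * Q ^ Fintype.card V) ≤
      2 * n ^ 8 * Real.exp (-(κ * n)) * Q ^ Fintype.card V := by
    rw [← mul_assoc]
    refine mul_le_mul_of_nonneg_right (mul_le_mul_of_nonneg_right hT (Real.exp_pos _).le) hQn.le
  nlinarith
end TC

namespace TC
section Q1
variable {U : Type} [Fintype U] [DecidableEq U] {ι : Type} [Fintype ι] {N : ℕ}

def TM (F : ι → Finset (Fin 5 → U)) (x : Fin N → U) (w : ι → (Fin 5 → Fin N) → ℝ) : Prop :=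
  (∀ p σ, 0 ≤ w p σ) ∧ (∀ p σ, w p σ ≠ 0 → Function.Injective σ ∧ x ∘ σ ∈ F p) ∧
    ∀ i, ∑ p, ∑ σ ∈ univ.filter (fun σ : Fin 5 → Fin N => ∃ k, σ k = i), w p σ ≤ 1

theorem TM_total {F : ι → Finset (Fin 5 → U)} {x : Fin N → U} {w} (h : TM F x w) :
    ∑ p, ∑ σ, w p σ ≤ N := by
  have h1 : ∑ p, ∑ σ, w p σ ≤ ∑ i, ∑ p, ∑ σ ∈ univ.filter (fun σ : Fin 5 → Fin N => ∃ k, σ k = i), w p σ := by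
    rw [sum_comm (γ := Fin N)]
    refine sum_le_sum fun p _ => ?_
    simp only [sum_filter]
    rw [sum_comm]
    refine sum_le_sum fun σ _ => ?_
    have := single_le_sum (f := fun i => if ∃ k, σ k = i then w p σ else 0) (s := univ)
      (fun i _ => by show 0 ≤ ite _ _ _; split_ifs; exacts [h.1 p σ, le_rfl]) (mem_univ (σ 0))
    simpa using this
  refine h1.trans ((sum_le_sum fun i _ => h.2.2 i).trans (by simp))

noncomputable def nu (F : ι → Finset (Fin 5 → U)) (x : Fin N → U) : ℝ :=
  sSup {r | ∃ w, TM F x w ∧ ∑ p, ∑ σ, w p σ = r}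

theorem nu_bdd (F : ι → Finset (Fin 5 → U)) (x : Fin N → U) :
    BddAbove {r | ∃ w, TM F x w ∧ ∑ p, ∑ σ, w p σ = r} :=
  ⟨N, by rintro r ⟨w, hw, rfl⟩; exact TM_total hw⟩

theorem TM_zero (F : ι → Finset (Fin 5 → U)) (x : Fin N → U) : TM F x (fun _ _ => 0) :=
  ⟨fun _ _ => le_rfl, fun _ _ h => absurd rfl h, fun _ => by simp⟩

theorem le_nu {F : ι → Finset (Fin 5 → U)} {x : Fin N → U} {w} (h : TM F x w) :
    ∑ p, ∑ σ, w p σ ≤ nu F x := le_csSup (nu_bdd F x) ⟨w, h, rfl⟩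

theorem nu_le {F : ι → Finset (Fin 5 → U)} {x : Fin N → U} (b : ℝ)
    (h : ∀ w, TM F x w → ∑ p, ∑ σ, w p σ ≤ b) : nu F x ≤ b :=
  csSup_le ⟨_, _, TM_zero F x, rfl⟩ (by rintro r ⟨w, hw, rfl⟩; exact h w hw)

theorem nu_near (F : ι → Finset (Fin 5 → U)) (x : Fin N → U) (η : ℝ) (hη : 0 < η) :
    ∃ w, TM F x w ∧ nu F x - η ≤ ∑ p, ∑ σ, w p σ := by
  obtain ⟨r, ⟨w, hw, rfl⟩, h⟩ := exists_lt_of_lt_csSup (s := {r | ∃ w, TM F x w ∧ ∑ p, ∑ σ, w p σ = r})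
    ⟨_, _, TM_zero F x, rfl⟩ (show nu F x - η < nu F x by linarith)
  exact ⟨w, hw, h.le⟩

theorem nu_lip1 (F : ι → Finset (Fin 5 → U)) (x x' : Fin N → U) (i : Fin N)
    (h : ∀ k, k ≠ i → x k = x' k) : nu F x ≤ nu F x' + 1 := by
  refine nu_le _ fun w hw => ?_
  set w' : ι → (Fin 5 → Fin N) → ℝ := fun p σ => if ∃ k, σ k = i then 0 else w p σ with hw'
  have hle : ∀ p σ, w' p σ ≤ w p σ := by
    intro p σ; simp only [hw']; split_ifs; exacts [hw.1 p σ, le_rfl]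
  have hT : TM F x' w' := by
    refine ⟨?_, ?_, ?_⟩
    · intro p σ; simp only [hw']; split_ifs; exacts [le_rfl, hw.1 p σ]
    · intro p σ hne
      simp only [hw'] at hne
      split_ifs at hne with hk
      · exact absurd rfl hne
      · have := hw.2.1 p σ hne
        refine ⟨this.1, ?_⟩
        have e : x' ∘ σ = x ∘ σ := by
          funext k; exact (h _ (fun hh => hk ⟨k, hh⟩)).symm
        rw [e]; exact this.2
    · intro k
      exact (sum_le_sum fun p _ => sum_le_sum fun σ _ => hle p σ).trans (hw.2.2 k)
  have h1 := le_nu hT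
  have h2 : ∑ p, ∑ σ, w p σ = ∑ p, ∑ σ, w' p σ +
      ∑ p, ∑ σ ∈ univ.filter (fun σ : Fin 5 → Fin N => ∃ k, σ k = i), w p σ := by
    rw [← sum_add_distrib]
    refine sum_congr rfl fun p _ => ?_
    rw [sum_filter, ← sum_add_distrib]
    refine sum_congr rfl fun σ _ => ?_
    simp only [hw']; split_ifs <;> simp
  have := hw.2.2 i
  linarith

theorem nu_lip (F : ι → Finset (Fin 5 → U)) (x : Fin N → U) (i : Fin N) (a : U) :
    |nu F (Function.update x i a) - nu F x| ≤ 1 := by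
  have h1 := nu_lip1 F (Function.update x i a) x i (fun k hk => by simp [hk])
  have h2 := nu_lip1 F x (Function.update x i a) i (fun k hk => by simp [hk])
  rw [abs_le]; constructor <;> linarith

theorem fix5 (σ : Fin 5 → Fin N) (hσ : Function.Injective σ) (y : Fin 5 → U) :
    (univ.filter fun x : Fin N → U => x ∘ σ = y).card * Fintype.card U ^ 5 ≤ Fintype.card U ^ N := by
  have e : Fintype.card U ^ N = (univ : Finset (Fin N → U)).card := by simp
  have e2 : Fintype.card U ^ 5 = (univ : Finset (Fin 5 → U)).card := by simp
  rw [e, e2, ← card_product]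
  refine card_le_card_of_injOn (fun p => Function.extend σ p.2 p.1) (by intro _ _; simp) ?_
  rintro ⟨x, t⟩ hx ⟨x', t'⟩ hx' h
  simp only [coe_product, coe_filter, mem_univ, true_and, coe_univ, Set.mem_prod, Set.mem_ofPred_eq, Set.mem_univ, and_true] at hx hx' h
  have ht : t = t' := by
    funext k
    have := congrFun h (σ k)
    rwa [hσ.extend_apply, hσ.extend_apply] at this
  refine Prod.ext (funext fun i => ?_) ht
  by_cases hi : ∃ k, σ k = i
  · obtain ⟨k, rfl⟩ := hi
    have := congrFun (hx.trans hx'.symm) k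
    exact this
  · have := congrFun h i
    rwa [Function.extend_apply' _ _ _ hi, Function.extend_apply' _ _ _ hi] at this

theorem avgW (F : ι → Finset (Fin 5 → U)) (η m : ℝ)
    (hη : 0 < η) (hN : 0 < N) (hU : 0 < Fintype.card U)
    (hm : (Fintype.card U : ℝ) ^ N * m ≤ ∑ x : Fin N → U, nu F x) :
    ∃ W : ι → (Fin 5 → U) → ℝ, (∀ p y, 0 ≤ W p y) ∧ (∀ p y, W p y ≠ 0 → y ∈ F p) ∧
      (∀ v, ∑ p, ∑ y ∈ univ.filter (fun y : Fin 5 → U => ∃ k, y k = v), W p y ≤ 1) ∧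
      (∀ p y, W p y ≤ N ^ 4 / (Fintype.card U : ℝ) ^ 4) ∧
      (m - η) * Fintype.card U / N ≤ ∑ p, ∑ y, W p y := by
  classical
  choose w hw hwη using fun x : Fin N → U => nu_near F x η hη
  set n : ℝ := (Fintype.card U : ℝ) with hn
  have hn0 : 0 < n := by rw [hn]; exact_mod_cast hU
  have hN0 : (0:ℝ) < N := by exact_mod_cast hN
  set κ : ℝ := n / (N * n ^ N) with hκ
  have hκ0 : 0 < κ := by positivity
  refine ⟨fun p y => κ * ∑ x, ∑ σ, if x ∘ σ = y then w x p σ else 0, ?_, ?_, ?_, ?_, ?_⟩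
  · intro p y
    refine mul_nonneg hκ0.le (sum_nonneg fun x _ => sum_nonneg fun σ _ => ?_)
    split_ifs; exacts [(hw x).1 p σ, le_rfl]
  · intro p y hne
    have h1 := right_ne_zero_of_mul hne
    obtain ⟨x, -, h2⟩ := exists_ne_zero_of_sum_ne_zero h1
    obtain ⟨σ, -, h3⟩ := exists_ne_zero_of_sum_ne_zero h2
    split_ifs at h3 with h4
    · rw [← h4]; exact ((hw x).2.1 p σ h3).2
    · exact absurd rfl h3
  · intro v
    simp only [← mul_sum]
    have h1 : ∑ p, ∑ y ∈ univ.filter (fun y : Fin 5 → U => ∃ k, y k = v),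
        ∑ x, ∑ σ, (if x ∘ σ = y then w x p σ else 0) ≤
        ∑ x : Fin N → U, ∑ i ∈ univ.filter (fun i => x i = v), ∑ p,
          ∑ σ ∈ univ.filter (fun σ : Fin 5 → Fin N => ∃ k, σ k = i), w x p σ := by
      have e1 : ∀ p, ∑ y ∈ univ.filter (fun y : Fin 5 → U => ∃ k, y k = v),
        ∑ x, ∑ σ, (if x ∘ σ = y then w x p σ else 0) =
        ∑ x : Fin N → U, ∑ σ : Fin 5 → Fin N, if ∃ k, x (σ k) = v then w x p σ else 0 := by
        intro p
        rw [sum_comm]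
        refine sum_congr rfl fun x _ => ?_
        rw [sum_comm]
        refine sum_congr rfl fun σ _ => ?_
        rw [sum_filter, sum_eq_single (x ∘ σ)]
        · simp
        · intro y _ hy; simp [hy.symm]
        · simp
      simp only [e1]
      rw [sum_comm]
      refine sum_le_sum fun x _ => ?_
      rw [sum_comm (s := univ.filter (fun i => x i = v))]
      refine sum_le_sum fun p _ => ?_
      simp only [sum_filter (s := (univ : Finset (Fin 5 → Fin N)))]
      rw [sum_comm]
      refine sum_le_sum fun σ _ => ?_
      have hpos := (hw x).1 p σ
      split_ifs with hk
      · obtain ⟨k, hk⟩ := hk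
        have := single_le_sum (f := fun i => if ∃ k, σ k = i then w x p σ else 0)
          (s := univ.filter (fun i => x i = v))
          (fun i _ => by show 0 ≤ ite _ _ _; split_ifs; exacts [hpos, le_rfl])
          (show σ k ∈ _ from mem_filter.2 ⟨mem_univ _, hk⟩)
        simpa using this
      · exact sum_nonneg fun i _ => by split_ifs; exacts [hpos, le_rfl]
    have h2 : ∑ x : Fin N → U, ∑ i ∈ univ.filter (fun i => x i = v), ∑ p,
          ∑ σ ∈ univ.filter (fun σ : Fin 5 → Fin N => ∃ k, σ k = i), w x p σ ≤ N * (n ^ N / n) := by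
      refine (sum_le_sum fun x _ => sum_le_sum fun i _ => (hw x).2.2 i).trans ?_
      simp only [sum_filter]
      rw [sum_comm]
      have : ∀ i ∈ (univ : Finset (Fin N)), (∑ x : Fin N → U, if x i = v then (1:ℝ) else 0) ≤ n ^ N / n := by
        intro i _
        rw [le_div_iff₀ hn0]
        have h := hit_eq N i v
        rw [← sum_filter, sum_const, nsmul_eq_mul, mul_one, hn]
        exact_mod_cast h
      refine (sum_le_sum this).trans ?_
      simp
    have h3 := mul_le_mul_of_nonneg_left (h1.trans h2) hκ0.le
    refine h3.trans (le_of_eq ?_)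
    rw [hκ]; field_simp
  · intro p y
    have h1 : ∑ x : Fin N → U, ∑ σ, (if x ∘ σ = y then w x p σ else 0) ≤ N ^ 5 * (n ^ N / n ^ 5) := by
      rw [sum_comm]
      have h2 : ∀ σ ∈ (univ : Finset (Fin 5 → Fin N)), ∑ x : Fin N → U, (if x ∘ σ = y then w x p σ else 0) ≤
          n ^ N / n ^ 5 := by
        intro σ _
        by_cases hσ : Function.Injective σ
        · have h3 : ∀ x ∈ (univ : Finset (Fin N → U)), (if x ∘ σ = y then w x p σ else 0) ≤
              if x ∘ σ = y then (1:ℝ) else 0 := by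
            intro x _
            split_ifs
            · have h4 := (hw x).2.2 (σ 0)
              refine le_trans ?_ h4
              have h5 := single_le_sum (f := fun p => ∑ σ' ∈ univ.filter (fun σ' : Fin 5 → Fin N => ∃ k, σ' k = σ 0), w x p σ')
                (s := univ) (fun q _ => sum_nonneg fun σ' _ => (hw x).1 q σ') (mem_univ p)
              refine le_trans ?_ h5
              exact single_le_sum (f := fun σ' => w x p σ') (fun σ' _ => (hw x).1 p σ')
                (mem_filter.2 ⟨mem_univ σ, 0, rfl⟩)
            · exact le_rfl
          refine (sum_le_sum h3).trans ?_
          rw [le_div_iff₀ (by positivity)]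
          have h := fix5 σ hσ y
          rw [← sum_filter, sum_const, nsmul_eq_mul, mul_one, hn]
          exact_mod_cast h
        · have : ∀ x ∈ (univ : Finset (Fin N → U)), (if x ∘ σ = y then w x p σ else 0) = 0 := by
            intro x _
            split_ifs
            · by_contra hne
              exact hσ ((hw x).2.1 p σ hne).1
            · rfl
          rw [sum_congr rfl this]; simp only [sum_const_zero]; positivity
      refine (sum_le_sum h2).trans ?_
      simp
    refine (mul_le_mul_of_nonneg_left h1 hκ0.le).trans (le_of_eq ?_)
    rw [hκ]; field_simp
  · have e1 : ∑ p, ∑ y, κ * ∑ x, ∑ σ, (if x ∘ σ = y then w x p σ else 0) =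
        κ * ∑ x, ∑ p, ∑ σ, w x p σ := by
      simp only [← mul_sum]
      congr 1
      rw [sum_comm (s := (univ : Finset (Fin N → U)))]
      refine sum_congr rfl fun p _ => ?_
      rw [sum_comm]
      refine sum_congr rfl fun x _ => ?_
      rw [sum_comm]
      refine sum_congr rfl fun σ _ => ?_
      simp
    rw [e1]
    have h1 : n ^ N * (m - η) ≤ ∑ x, ∑ p, ∑ σ, w x p σ := by
      have := sum_le_sum (s := univ) fun x _ => hwη x
      rw [sum_sub_distrib, sum_const, nsmul_eq_mul, card_univ, Fintype.card_fun, Fintype.card_fin] at this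
      push_cast at this
      rw [← hn] at this
      linarith
    refine le_trans (le_of_eq ?_) (mul_le_mul_of_nonneg_left h1 hκ0.le)
    rw [hκ]; field_simp
end Q1
end TC

namespace TC
section Q2
variable {U : Type} [Fintype U] [DecidableEq U] {N K : ℕ}

def FQ (H : Bool → Finset (Fin 5 → U)) (ℓ : Bool → (Fin 4 → U) → Fin K) (Λ M : Bool → Fin K)
    (p : Bool × Bool) : Finset (Fin 5 → U) :=
  (H p.1).filter fun y => ℓ p.1 (ini y) = if p.2 then Λ p.1 else M p.1

theorem ini_comp {A B : Type*} (x : A → B) (σ : Fin 5 → A) : ini (x ∘ σ) = x ∘ ini σ := by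
  funext i; fin_cases i <;> rfl

theorem rt_comp {A B : Type*} (x : A → B) (σ : Fin 5 → A) : rt (x ∘ σ) = x ∘ rt σ := rfl

def sgm (e : Finset (Fin N)) : Finset (Fin 5 → Fin N) :=
  univ.filter fun σ => Function.Injective σ ∧ univ.image σ = e

theorem rt_sgm (e : Finset (Fin N)) (σ) (h : σ ∈ sgm e) : rt σ ∈ sgm e := by
  simp only [sgm, mem_filter, mem_univ, true_and] at h ⊢
  refine ⟨fun i k hik => add_right_cancel (h.1 hik), ?_⟩
  rw [← h.2]
  ext v
  simp only [mem_image, mem_univ, true_and]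
  constructor
  · rintro ⟨i, rfl⟩; exact ⟨i + 1, rfl⟩
  · rintro ⟨i, rfl⟩; exact ⟨i - 1, by simp [rt]⟩

theorem good_x (H : Bool → Finset (Fin 5 → U)) (ℓ : Bool → (Fin 4 → U) → Fin K)
    (col : Finset U → Bool) (hK : 0 < K)
    (hℓ : ∀ b, ∀ y ∈ H b, ℓ b (ini y) = ℓ b (tl y)) (hN : 31 ≤ N) (x : Fin N → U)
    (hx : ∀ σ : Fin 5 → Fin N, Function.Injective σ → x ∘ σ ∈ H (col (univ.image (x ∘ σ)))) :
    ∃ Λ M : Bool → Fin K, ((N : ℝ) - 30) / 5 ≤ nu (FQ H ℓ Λ M) x := by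
  classical
  set c : Finset (Fin N) → Bool := fun e => col (e.image x) with hc
  have hcσ : ∀ e, ∀ σ ∈ sgm e, col (univ.image (x ∘ σ)) = c e := by
    intro e σ hσ
    simp only [sgm, mem_filter, mem_univ, true_and] at hσ
    simp only [hc, ← hσ.2, image_image]
  have hmem : ∀ e, ∀ σ ∈ sgm e, x ∘ σ ∈ H (c e) := by
    intro e σ hσ
    rw [← hcσ e σ hσ]
    exact hx σ (mem_filter.1 hσ).2.1
  set LS : Finset (Fin N) → Finset (Fin K) := fun e => (sgm e).image fun σ => ℓ (c e) (ini (x ∘ σ)) with hLS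
  have hne : ∀ e : Finset (Fin N), e.card = 5 → (LS e).Nonempty := by
    intro e he
    refine Finset.Nonempty.image (s := sgm e) ⟨e.orderEmbOfFin he, ?_⟩ _
    simp only [sgm, mem_filter, mem_univ, true_and]
    exact ⟨(e.orderEmbOfFin he).injective, by simp⟩
  set lab : Finset (Fin N) → Fin K := fun e => if h : (LS e).Nonempty then (LS e).min' h else ⟨0, hK⟩ with hlab
  have hlabm : ∀ e : Finset (Fin N), e.card = 5 → ∃ σ ∈ sgm e, ℓ (c e) (ini (x ∘ σ)) = lab e := by
    intro e he
    have h1 : lab e ∈ LS e := by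
      simp only [hlab, dif_pos (hne e he)]; exact min'_mem _ _
    exact mem_image.1 h1
  have hrot : ∀ e, ∀ σ ∈ sgm e, ∀ v ∈ e, ∃ σ' ∈ sgm e, ℓ (c e) (ini (x ∘ σ')) = ℓ (c e) (ini (x ∘ σ)) ∧ σ' 4 = v := by
    intro e σ hσ v hv
    have st : ∀ σ' ∈ sgm e, ℓ (c e) (ini (x ∘ rt σ')) = ℓ (c e) (ini (x ∘ σ')) := by
      intro σ' h1
      rw [hℓ _ _ (hmem e σ' h1), ← ini_rt, rt_comp]
    have s1 := rt_sgm e _ hσ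
    have s2 := rt_sgm e _ s1
    have s3 := rt_sgm e _ s2
    have s4 := rt_sgm e _ s3
    have t1 := st _ hσ
    have t2 := (st _ s1).trans t1
    have t3 := (st _ s2).trans t2
    have t4 := (st _ s3).trans t3
    have hv' : v ∈ univ.image σ := by rw [(mem_filter.1 hσ).2.2]; exact hv
    obtain ⟨k, -, hk⟩ := mem_image.1 hv'
    rw [← hk]
    fin_cases k
    · exact ⟨_, s1, t1, rfl⟩
    · exact ⟨_, s2, t2, rfl⟩
    · exact ⟨_, s3, t3, rfl⟩
    · exact ⟨_, s4, t4, rfl⟩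
    · exact ⟨_, hσ, rfl, rfl⟩
  have hsub : ∀ e e' : Finset (Fin N), e.card = 5 → e'.card = 5 → (e ∩ e').card = 4 →
      c e = c e' → LS e ⊆ LS e' := by
    intro e e' he he' hee hcc a ha
    obtain ⟨σ, hσ, rfl⟩ := mem_image.1 ha
    obtain ⟨v, hv⟩ : (e \ e').Nonempty := by
      have := card_sdiff_add_card_inter e e'
      rw [← card_pos]; omega
    obtain ⟨v', hv'⟩ : (e' \ e).Nonempty := by
      have := card_sdiff_add_card_inter e' e
      rw [inter_comm] at this
      rw [← card_pos]; omega
    rw [mem_sdiff] at hv hv'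
    obtain ⟨σ', h1, h2, h3⟩ := hrot e σ hσ v hv.1
    obtain ⟨-, hi, him⟩ := mem_filter.1 h1
    have hse : ∀ i, σ' i ∈ e := fun i => by rw [← him]; exact mem_image_of_mem _ (mem_univ _)
    have hcd : e \ {v} = e ∩ e' := by
      symm
      apply eq_of_subset_of_card_le
      · intro u hu
        rw [mem_inter] at hu
        rw [mem_sdiff, mem_singleton]
        exact ⟨hu.1, fun h => hv.2 (h ▸ hu.2)⟩
      · rw [card_sdiff_of_subset (by simpa using hv.1), he, hee]; simp
    have hse' : ∀ i, i ≠ 4 → σ' i ∈ e' := by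
      intro i hi4
      have : σ' i ∈ e \ {v} := by
        rw [mem_sdiff, mem_singleton]
        exact ⟨hse i, fun h => hi4 (hi (h.trans h3.symm))⟩
      rw [hcd] at this
      exact (mem_inter.1 this).2
    set τ := Function.update σ' 4 v' with hτ
    have hτi : Function.Injective τ := by
      intro i k hik
      simp only [hτ, Function.update_apply] at hik
      split_ifs at hik with a b b
      · rw [a, b]
      · exact absurd (hik ▸ hse k) hv'.2
      · exact absurd (hik ▸ hse i) hv'.2
      · exact hi hik
    have hτm : τ ∈ sgm e' := by
      simp only [sgm, mem_filter, mem_univ, true_and]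
      refine ⟨hτi, eq_of_subset_of_card_le ?_ ?_⟩
      · intro u hu
        obtain ⟨i, -, rfl⟩ := mem_image.1 hu
        simp only [hτ, Function.update_apply]
        split_ifs with a
        · exact hv'.1
        · exact hse' i a
      · rw [card_image_of_injective _ hτi, he']; simp
    refine mem_image.2 ⟨τ, hτm, ?_⟩
    rw [← hcc]
    show ℓ (c e) (ini (x ∘ τ)) = ℓ (c e) (ini (x ∘ σ))
    rw [← h2, ini_comp, ini_comp]
    congr 2
  obtain ⟨Λ, M, w, ⟨hw0, hw1, hw2⟩, hws⟩ := core (V := Fin N) (by simpa using hN) c lab (by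
    intro e e' he he' hee hcc
    have : LS e = LS e' := (hsub e e' he he' hee hcc).antisymm
      (hsub e' e he' he (by rwa [inter_comm]) hcc.symm)
    simp only [hlab, this])
  refine ⟨Λ, M, ?_⟩
  have hch : ∀ e : Finset (Fin N), ∃ (σ : Fin 5 → Fin N) (s : Bool), w e ≠ 0 →
      σ ∈ sgm e ∧ ℓ (c e) (ini (x ∘ σ)) = if s then Λ (c e) else M (c e) := by
    intro e
    by_cases h : w e ≠ 0
    · obtain ⟨he, hF⟩ := hw1 e h
      obtain ⟨σ, h1, h2⟩ := hlabm e he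
      rcases hF with hF | hF
      · exact ⟨σ, true, fun _ => ⟨h1, by rw [h2, hF]; rfl⟩⟩
      · exact ⟨σ, false, fun _ => ⟨h1, by rw [h2, hF]; rfl⟩⟩
    · exact ⟨fun _ => ⟨0, by omega⟩, true, fun h' => absurd h' h⟩
  choose σ s hσ using hch
  set w' : Bool × Bool → (Fin 5 → Fin N) → ℝ := fun p τ => ∑ e, if (c e, s e) = p ∧ σ e = τ then w e else 0 with hw'
  have hTM : TM (FQ H ℓ Λ M) x w' := by
    refine ⟨?_, ?_, ?_⟩
    · intro p τ
      refine sum_nonneg fun e _ => ?_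
      split_ifs; exacts [hw0 e, le_rfl]
    · intro p τ hne
      obtain ⟨e, -, h⟩ := exists_ne_zero_of_sum_ne_zero hne
      split_ifs at h with hh
      · obtain ⟨rfl, rfl⟩ := hh
        obtain ⟨h1, h2⟩ := hσ e h
        exact ⟨(mem_filter.1 h1).2.1, mem_filter.2 ⟨hmem e _ h1, h2⟩⟩
      · exact absurd rfl h
    · intro i
      have e1 : ∑ p, ∑ τ ∈ univ.filter (fun τ : Fin 5 → Fin N => ∃ k, τ k = i), w' p τ =
          ∑ e, if ∃ k, σ e k = i then w e else 0 := by
        simp only [hw', sum_filter]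
        have : ∀ p, ∑ τ : Fin 5 → Fin N, (if ∃ k, τ k = i then ∑ e, (if (c e, s e) = p ∧ σ e = τ then w e else 0) else 0)
            = ∑ e, if (c e, s e) = p ∧ ∃ k, σ e k = i then w e else 0 := by
          intro p
          have : ∀ τ : Fin 5 → Fin N, (if ∃ k, τ k = i then ∑ e, (if (c e, s e) = p ∧ σ e = τ then w e else 0) else 0)
              = ∑ e, if (c e, s e) = p ∧ (∃ k, τ k = i) ∧ σ e = τ then w e else 0 := by
            intro τ
            split_ifs with h
            · simp [h]
            · simp [h]
          simp only [this]
          rw [sum_comm]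
          refine sum_congr rfl fun e _ => ?_
          rw [sum_eq_single (σ e)]
          · simp
          · intro τ _ hτ; rw [if_neg]; rintro ⟨-, -, h⟩; exact hτ h.symm
          · simp
        simp only [this]
        rw [sum_comm]
        refine sum_congr rfl fun e _ => ?_
        rw [sum_eq_single (c e, s e)]
        · simp
        · intro p _ hp; rw [if_neg]; rintro ⟨h, -⟩; exact hp h.symm
        · simp
      rw [e1]
      refine le_trans ?_ (hw2 i)
      rw [sum_filter]
      refine sum_le_sum fun e _ => ?_
      by_cases h0 : w e = 0
      · simp [h0]
      · have h1 := (mem_filter.1 (hσ e h0).1).2.2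
        have : (∃ k, σ e k = i) ↔ i ∈ e := by
          constructor
          · rintro ⟨k, rfl⟩; have := mem_image_of_mem (σ e) (mem_univ k); rwa [h1] at this
          · intro h; rw [← h1] at h; simpa using h
        by_cases hi : i ∈ e
        · rw [if_pos (this.2 hi), if_pos hi]
        · rw [if_neg (fun h => hi (this.1 h)), if_neg hi]
  have hsum : ∑ p, ∑ τ, w' p τ = ∑ e, w e := by
    simp only [hw']
    have : ∀ p, ∑ τ : Fin 5 → Fin N, ∑ e, (if (c e, s e) = p ∧ σ e = τ then w e else 0) =
        ∑ e, if (c e, s e) = p then w e else 0 := by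
      intro p
      rw [sum_comm]
      refine sum_congr rfl fun e _ => ?_
      rw [sum_eq_single (σ e)]
      · simp
      · intro τ _ hτ; rw [if_neg]; rintro ⟨-, h⟩; exact hτ h.symm
      · simp
    simp only [this]
    rw [sum_comm]
    refine sum_congr rfl fun e _ => ?_
    rw [sum_eq_single (c e, s e)]
    · simp
    · intro p _ hp; rw [if_neg]; intro h; exact hp h.symm
    · simp
  have := le_nu hTM
  rw [hsum] at this
  refine le_trans ?_ this
  rw [Fintype.card_fin] at hws
  linarith
end Q2
end TC

namespace TC

theorem decay80 (κ C : ℝ) (hκ : 0 < κ) (hC : 0 < C) : ∃ n0 : ℕ, ∀ n : ℕ, n0 ≤ n →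
    C * (n:ℝ) ^ 80 * Real.exp (- (κ * n)) < 1 := by
  have h := Real.tendsto_pow_mul_exp_neg_atTop_nhds_zero 80
  have h1 : Filter.Tendsto (fun n : ℕ => κ * (n:ℝ)) Filter.atTop Filter.atTop :=
    Filter.Tendsto.const_mul_atTop hκ tendsto_natCast_atTop_atTop
  have h2 := (h.comp h1).eventually (gt_mem_nhds (show (0:ℝ) < κ ^ 80 / C by positivity))
  obtain ⟨n0, h0⟩ := Filter.eventually_atTop.1 h2
  refine ⟨n0, fun n hn => ?_⟩
  have := h0 n hn
  simp only [Function.comp] at this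
  rw [mul_pow, lt_div_iff₀ hC] at this
  have hk : 0 < κ ^ 80 := by positivity
  refine lt_of_mul_lt_mul_left ?_ hk.le
  linarith

theorem fracW (η : ℝ) (hη : 0 < η) : ∃ (N : ℕ) (δ : ℝ), 0 < N ∧ 0 < δ ∧ δ ≤ 1 ∧
    ∀ (K : ℕ), 0 < K → (K : ℝ) ≤ 40000 / δ ^ 4 →
    ∀ (U : Type) [Fintype U] [DecidableEq U], 0 < Fintype.card U →
    ∀ (H : Bool → Finset (Fin 5 → U)) (ℓ : Bool → (Fin 4 → U) → Fin K) (col : Finset U → Bool),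
    (∀ b, ∀ y ∈ H b, ℓ b (ini y) = ℓ b (tl y)) →
    ((univ.filter fun y : Fin 5 → U => Function.Injective y → y ∉ H (col (univ.image y))).card : ℝ) ≤
      4 * δ * (Fintype.card U : ℝ) ^ 5 →
    ∃ (Λ M : Bool → Fin K) (W : Bool × Bool → (Fin 5 → U) → ℝ), (∀ p y, 0 ≤ W p y) ∧
      (∀ p y, W p y ≠ 0 → y ∈ FQ H ℓ Λ M p) ∧
      (∀ v, ∑ p, ∑ y ∈ univ.filter (fun y : Fin 5 → U => ∃ k, y k = v), W p y ≤ 1) ∧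
      (∀ p y, W p y ≤ N ^ 4 / (Fintype.card U : ℝ) ^ 4) ∧
      (1 - η) * Fintype.card U / 5 ≤ ∑ p, ∑ y, W p y := by
  obtain ⟨N1, hN1⟩ := decay80 (η ^ 2 / 800) (2 * (40000 * 8 ^ 4) ^ 4) (by positivity) (by positivity)
  obtain ⟨N2, hN2⟩ := exists_nat_gt (120 / η)
  rw [div_lt_iff₀ hη] at hN2
  set N := max (max N1 N2) 31 with hN
  have hNN1 : N1 ≤ N := (le_max_left _ _).trans (le_max_left _ _)
  have hNN2 : (N2:ℝ) ≤ N := by exact_mod_cast (le_max_right N1 N2).trans (le_max_left _ 31)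
  have hN31 : 31 ≤ N := le_max_right _ _
  have hN0 : 0 < N := by omega
  have hN0' : (0:ℝ) < N := by exact_mod_cast hN0
  have hN1' : (1:ℝ) ≤ N := by exact_mod_cast hN0
  have hdec := hN1 N hNN1
  clear_value N
  refine ⟨N, 1 / (8 * N ^ 5), hN0, by positivity, ?_, ?_⟩
  · rw [div_le_one (by positivity)]
    have : (1:ℝ) ≤ N ^ 5 := one_le_pow₀ hN1'
    linarith
  intro K hK hKb U _ _ hU H ℓ col hℓ hmiss
  classical
  set n : ℝ := (Fintype.card U : ℝ) with hn
  have hn0 : 0 < n := by rw [hn]; exact_mod_cast hU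
  have hK' : (0:ℝ) < K := by exact_mod_cast hK
  haveI : Nonempty U := Fintype.card_pos_iff.1 hU
  set Miss := univ.filter fun y : Fin 5 → U => Function.Injective y → y ∉ H (col (univ.image y)) with hMiss
  set B := univ.filter fun x : Fin N → U => ∃ σ : Fin 5 → Fin N, Function.Injective σ ∧ x ∘ σ ∈ Miss with hB
  have hBc : (B.card : ℝ) ≤ n ^ N / 2 := by
    have h1 : B ⊆ (univ.filter fun σ : Fin 5 → Fin N => Function.Injective σ).biUnion fun σ =>
        Miss.biUnion fun y => univ.filter fun x : Fin N → U => x ∘ σ = y := by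
      intro x hx
      obtain ⟨-, σ, h1, h2⟩ := mem_filter.1 hx
      exact mem_biUnion.2 ⟨σ, mem_filter.2 ⟨mem_univ _, h1⟩, mem_biUnion.2 ⟨x ∘ σ, h2, by simp⟩⟩
    have h2 := (card_le_card h1).trans (card_biUnion_le.trans (sum_le_sum fun σ _ => card_biUnion_le))
    have h3 : (B.card : ℝ) ≤ ∑ σ ∈ univ.filter (fun σ : Fin 5 → Fin N => Function.Injective σ),
        ∑ y ∈ Miss, ((univ.filter fun x : Fin N → U => x ∘ σ = y).card : ℝ) := by exact_mod_cast h2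
    have h4 : ∀ σ ∈ univ.filter (fun σ : Fin 5 → Fin N => Function.Injective σ),
        ∑ y ∈ Miss, ((univ.filter fun x : Fin N → U => x ∘ σ = y).card : ℝ) ≤ Miss.card * (n ^ N / n ^ 5) := by
      intro σ hσ
      rw [← nsmul_eq_mul, ← sum_const]
      refine sum_le_sum fun y _ => ?_
      rw [le_div_iff₀ (by positivity), hn]
      exact_mod_cast fix5 σ (mem_filter.1 hσ).2 y
    have h5 := h3.trans (sum_le_sum h4)
    rw [sum_const, nsmul_eq_mul] at h5
    have h6 : ((univ.filter (fun σ : Fin 5 → Fin N => Function.Injective σ)).card : ℝ) ≤ N ^ 5 := by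
      have := card_le_univ (univ.filter (fun σ : Fin 5 → Fin N => Function.Injective σ))
      rw [Fintype.card_fun, Fintype.card_fin, Fintype.card_fin] at this
      exact_mod_cast this
    refine h5.trans ?_
    calc _ ≤ (N:ℝ) ^ 5 * (4 * (1 / (8 * N ^ 5)) * n ^ 5 * (n ^ N / n ^ 5)) := by gcongr
      _ = n ^ N / 2 := by field_simp; norm_num
  have hgood : ∀ x ∈ Bᶜ, ∃ Q : (Bool → Fin K) × (Bool → Fin K), ((N : ℝ) - 30) / 5 ≤ nu (FQ H ℓ Q.1 Q.2) x := by
    intro x hx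
    have hx' : ∀ σ : Fin 5 → Fin N, Function.Injective σ → x ∘ σ ∈ H (col (univ.image (x ∘ σ))) := by
      intro σ hσ
      by_contra hcon
      exact (mem_compl.1 hx) (mem_filter.2 ⟨mem_univ _, σ, hσ, mem_filter.2 ⟨mem_univ _, fun _ => hcon⟩⟩)
    obtain ⟨Λ, M, h⟩ := good_x H ℓ col hK hℓ hN31 x hx'
    exact ⟨(Λ, M), h⟩
  have hNx : (Fintype.card (Fin N → U) : ℝ) = n ^ N := by simp [hn]
  -- mean bound
  have hmean : ∃ Q : (Bool → Fin K) × (Bool → Fin K),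
      n ^ N * (((N:ℝ) - 30) / 5 - η * N / 20) ≤ ∑ x : Fin N → U, nu (FQ H ℓ Q.1 Q.2) x := by
    by_contra hcon
    push Not at hcon
    have h1 : ∀ Q : (Bool → Fin K) × (Bool → Fin K),
        ((univ.filter fun x : Fin N → U => ((N : ℝ) - 30) / 5 ≤ nu (FQ H ℓ Q.1 Q.2) x).card : ℝ) ≤
          Real.exp (-(η ^ 2 / 800 * N)) * n ^ N := by
      intro Q
      have := mcdiarmid N (fun x => nu (FQ H ℓ Q.1 Q.2) x) 1 (η * N / 20)
        ((∑ x : Fin N → U, nu (FQ H ℓ Q.1 Q.2) x) / n ^ N) one_pos (by positivity)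
        (fun x i a => nu_lip _ x i a) (by rw [← hn]; field_simp)
      have e : (η * N / 20) ^ 2 / (2 * 1 ^ 2 * (N:ℝ)) = η ^ 2 / 800 * N := by field_simp; norm_num
      rw [e] at this
      refine le_trans ?_ this
      have hs : (univ.filter fun x : Fin N → U => ((N : ℝ) - 30) / 5 ≤ nu (FQ H ℓ Q.1 Q.2) x) ⊆
          univ.filter fun x => (∑ x : Fin N → U, nu (FQ H ℓ Q.1 Q.2) x) / n ^ N + η * N / 20 ≤ nu (FQ H ℓ Q.1 Q.2) x := by
        intro x hx
        rw [mem_filter] at hx ⊢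
        refine ⟨hx.1, le_trans ?_ hx.2⟩
        have : (∑ x : Fin N → U, nu (FQ H ℓ Q.1 Q.2) x) / n ^ N ≤ ((N:ℝ) - 30) / 5 - η * N / 20 := by
          rw [div_le_iff₀ (by positivity), mul_comm]; exact (hcon Q).le
        linarith
      exact_mod_cast card_le_card hs
    have h2 : (univ : Finset (Fin N → U)) ⊆ B ∪ univ.biUnion fun Q : (Bool → Fin K) × (Bool → Fin K) =>
        univ.filter fun x : Fin N → U => ((N : ℝ) - 30) / 5 ≤ nu (FQ H ℓ Q.1 Q.2) x := by
      intro x _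
      by_cases hx : x ∈ B
      · exact mem_union_left _ hx
      · obtain ⟨Q, hQ⟩ := hgood x (mem_compl.2 hx)
        exact mem_union_right _ (mem_biUnion.2 ⟨Q, mem_univ _, mem_filter.2 ⟨mem_univ _, hQ⟩⟩)
    have h3 := (card_le_card h2).trans ((card_union_le _ _).trans (Nat.add_le_add_left card_biUnion_le _))
    have h4 : n ^ N ≤ B.card + ∑ Q : (Bool → Fin K) × (Bool → Fin K),
        ((univ.filter fun x : Fin N → U => ((N : ℝ) - 30) / 5 ≤ nu (FQ H ℓ Q.1 Q.2) x).card : ℝ) := by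
      rw [← hNx, ← card_univ]; exact_mod_cast h3
    have h5 := sum_le_sum (s := univ) fun Q _ => h1 Q
    rw [sum_const, nsmul_eq_mul, card_univ] at h5
    have h6 : (Fintype.card ((Bool → Fin K) × (Bool → Fin K)) : ℝ) = (K:ℝ) ^ 4 := by
      simp; ring
    rw [h6] at h5
    have hKK : (K:ℝ) ≤ 40000 * 8 ^ 4 * N ^ 20 := by
      refine hKb.trans (le_of_eq ?_)
      field_simp
    have hK4 : 2 * (K:ℝ) ^ 4 ≤ 2 * (40000 * 8 ^ 4) ^ 4 * N ^ 80 := by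
      calc 2 * (K:ℝ) ^ 4 ≤ 2 * (40000 * 8 ^ 4 * N ^ 20) ^ 4 := by gcongr
        _ = _ := by ring
    have h7 : 2 * (K:ℝ) ^ 4 * Real.exp (-(η ^ 2 / 800 * N)) < 1 :=
      lt_of_le_of_lt (mul_le_mul_of_nonneg_right hK4 (Real.exp_pos _).le) hdec
    have h8 : 0 < n ^ N := by positivity
    have h9 := mul_lt_mul_of_pos_right h7 h8
    have h10 := h4.trans (add_le_add hBc h5)
    clear_value n
    nlinarith
  obtain ⟨Q, hQ⟩ := hmean
  obtain ⟨W, w1, w2, w3, w4, w5⟩ := avgW (FQ H ℓ Q.1 Q.2) (η * N / 10)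
    (((N:ℝ) - 30) / 5 - η * N / 20) (by positivity) hN0 hU hQ
  refine ⟨Q.1, Q.2, W, w1, w2, w3, w4, le_trans ?_ w5⟩
  rw [← hn, le_div_iff₀ hN0']
  have : (120:ℝ) ≤ N * η := by nlinarith
  nlinarith
end TC

namespace TC
section P1
variable {U : Type} [Fintype U] [DecidableEq U] {ι : Type} [Fintype ι]

def blk {α : Type} [DecidableEq α] (π : U → α) (τ : Fin 5 → α) : Finset (Fin 5 → U) :=
  univ.filter fun y => π ∘ y = τ

noncomputable def En {α : Type} [Fintype α] [DecidableEq α] (F : Finset (Fin 5 → U)) (π : U → α) : ℝ :=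
  ∑ τ, ((F ∩ blk π τ).card : ℝ) ^ 2 / (blk π τ).card

def part {α : Type} [DecidableEq α] (π : U → α) (p : α) : Finset U := univ.filter fun v => π v = p

def Bad {α : Type} [DecidableEq α] (d ε : ℝ) (F : Finset (Fin 5 → U)) (π : U → α) (τ : Fin 5 → α) : Prop :=
  d * (blk π τ).card ≤ (F ∩ blk π τ).card ∧ ∃ A : Fin 5 → Finset U, (∀ i, A i ⊆ part π (τ i)) ∧
    (∀ i, ε * (part π (τ i)).card ≤ (A i).card) ∧
    ((F ∩ Fintype.piFinset A).card : ℝ) < d / 2 * (Fintype.piFinset A).card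

theorem blk_box {α : Type} [DecidableEq α] (π : U → α) (τ : Fin 5 → α) :
    blk π τ = Fintype.piFinset fun i => part π (τ i) := by
  ext y; simp [blk, part, funext_iff]

theorem sum_blk {α : Type} [Fintype α] [DecidableEq α] (π : U → α) (g : (Fin 5 → U) → ℝ) :
    ∑ τ, ∑ y ∈ blk π τ, g y = ∑ y, g y := by
  simp only [blk]
  exact sum_fiberwise (s := univ) (g := fun y : Fin 5 → U => π ∘ y) (f := g)

theorem lin_le (x b c : ℝ) (hb : 0 ≤ b) (h : b = 0 → x = 0) : 2 * c * x - c ^ 2 * b ≤ x ^ 2 / b := by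
  rcases hb.eq_or_lt with h0 | h0
  · rw [h h0.symm, ← h0]; simp
  · rw [le_div_iff₀ h0]; nlinarith [sq_nonneg (x - c * b)]

theorem sum_ind (F S : Finset (Fin 5 → U)) : ∑ y ∈ S, (if y ∈ F then (1:ℝ) else 0) = (F ∩ S).card := by
  rw [← sum_filter, sum_const, nsmul_eq_mul, mul_one]
  congr 2; ext y; simp [and_comm]

theorem En_ge {β : Type} [Fintype β] [DecidableEq β] (F : Finset (Fin 5 → U)) (π : U → β)
    (φ : (Fin 5 → U) → ℝ) (hφ : ∀ y y', π ∘ y = π ∘ y' → φ y = φ y') :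
    ∑ y, (2 * φ y * (if y ∈ F then 1 else 0) - φ y ^ 2) ≤ En F π := by
  rw [← sum_blk π, En]
  refine sum_le_sum fun τ _ => ?_
  by_cases hne : (blk π τ).Nonempty
  · obtain ⟨y0, hy0⟩ := hne
    have hc : ∀ y ∈ blk π τ, φ y = φ y0 := fun y hy =>
      hφ _ _ ((mem_filter.1 hy).2.trans (mem_filter.1 hy0).2.symm)
    have e : ∑ y ∈ blk π τ, (2 * φ y * (if y ∈ F then 1 else 0) - φ y ^ 2) =
        2 * φ y0 * (F ∩ blk π τ).card - φ y0 ^ 2 * (blk π τ).card := by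
      rw [← sum_ind, mul_sum, mul_comm (φ y0 ^ 2), ← nsmul_eq_mul (blk π τ).card, ← sum_const, ← sum_sub_distrib]
      exact sum_congr rfl fun y hy => by rw [hc y hy]
    rw [e]
    exact lin_le _ _ _ (by positivity) (fun h => by
      have : (blk π τ).card = 0 := by exact_mod_cast h
      rw [card_eq_zero] at this; rw [this]; simp)
  · rw [not_nonempty_iff_eq_empty] at hne
    simp [hne]

theorem En_le {α : Type} [Fintype α] [DecidableEq α] (F : Finset (Fin 5 → U)) (π : U → α) :
    En F π ≤ (Fintype.card U : ℝ) ^ 5 := by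
  have h1 : En F π ≤ ∑ τ : Fin 5 → α, ∑ y ∈ blk π τ, (1:ℝ) := by
    refine sum_le_sum fun τ _ => ?_
    rw [sum_const, nsmul_eq_mul, mul_one]
    have h : ((F ∩ blk π τ).card : ℝ) ≤ (blk π τ).card := by exact_mod_cast card_le_card inter_subset_right
    refine div_le_of_le_mul₀ (by positivity) (by positivity) ?_
    rw [sq]
    exact mul_le_mul h h (by positivity) (by positivity)
  refine h1.trans (le_of_eq ?_)
  rw [sum_blk]; simp

open Classical in
theorem refine_step {α : Type} [Fintype α] (d ε : ℝ) (hd : 0 < d) (hε : 0 < ε)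
    (F : ι → Finset (Fin 5 → U)) (π : U → α) :
    ∃ π1 : U → (α × (ι × (Fin 5 → α) × Fin 5 → Bool)),
      (∑ q, En (F q) π) + d ^ 2 / 4 * ε ^ 5 * (∑ q, ∑ τ ∈ univ.filter (fun τ => Bad d ε (F q) π τ), ((blk π τ).card : ℝ)) ≤
      ∑ q, En (F q) π1 := by
  have hch : ∀ (q : ι) (τ : Fin 5 → α), ∃ A : Fin 5 → Finset U, Bad d ε (F q) π τ →
      (∀ i, A i ⊆ part π (τ i)) ∧ (∀ i, ε * (part π (τ i)).card ≤ (A i).card) ∧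
    ((F q ∩ Fintype.piFinset A).card : ℝ) < d / 2 * (Fintype.piFinset A).card := by
    intro q τ
    by_cases h : Bad d ε (F q) π τ
    · obtain ⟨-, A, hA⟩ := h; exact ⟨A, fun _ => hA⟩
    · exact ⟨fun _ => ∅, fun h' => absurd h' h⟩
  choose A hA using hch
  set π' : U → α × (ι × (Fin 5 → α) × Fin 5 → Bool) := fun v => (π v, fun a => decide (v ∈ A a.1 a.2.1 a.2.2)) with hπ'
  refine ⟨π', ?_⟩
  rw [mul_sum, ← sum_add_distrib]
  refine sum_le_sum fun q _ => ?_
  set D : (Fin 5 → α) → ℝ := fun τ => ((F q ∩ blk π τ).card : ℝ) / (blk π τ).card with hD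
  set φ : (Fin 5 → U) → ℝ := fun y => if Bad d ε (F q) π (π ∘ y) ∧ y ∈ Fintype.piFinset (A q (π ∘ y))
    then d / 2 else D (π ∘ y) with hφ
  have hfac : ∀ y y', π' ∘ y = π' ∘ y' → φ y = φ y' := by
    intro y y' h
    have h1 : π ∘ y = π ∘ y' := by
      funext i; exact congrArg Prod.fst (congrFun h i)
    have h2 : ∀ τ, y ∈ Fintype.piFinset (A q τ) ↔ y' ∈ Fintype.piFinset (A q τ) := by
      intro τ
      rw [Fintype.mem_piFinset, Fintype.mem_piFinset]
      refine forall_congr' fun i => ?_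
      have := congrFun (congrArg Prod.snd (congrFun h i)) (q, τ, i)
      simpa [hπ'] using this
    simp only [hφ, h1, h2]
  refine le_trans ?_ (En_ge (F q) π' φ hfac)
  rw [← sum_blk π, En, sum_filter, mul_sum, ← sum_add_distrib]
  refine sum_le_sum fun τ _ => ?_
  have hDe : ((F q ∩ blk π τ).card : ℝ) = D τ * (blk π τ).card := by
    by_cases h0 : (blk π τ).card = 0
    · have : blk π τ = ∅ := card_eq_zero.1 h0
      simp [this]
    · simp only [hD]; field_simp
  have hsum : ∀ (c : ℝ) (S : Finset (Fin 5 → U)), ∑ y ∈ S, (2 * c * (if y ∈ F q then 1 else 0) - c ^ 2) =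
        2 * c * (F q ∩ S).card - c ^ 2 * S.card := by
    intro c S
    rw [← sum_ind, mul_sum, mul_comm (c ^ 2), ← nsmul_eq_mul S.card, ← sum_const, ← sum_sub_distrib]
  have hsq : ((F q ∩ blk π τ).card : ℝ) ^ 2 / (blk π τ).card = D τ ^ 2 * (blk π τ).card := by
    by_cases h0 : (blk π τ).card = 0
    · have : blk π τ = ∅ := card_eq_zero.1 h0
      simp [this]
    · simp only [hD]; field_simp
  rw [hsq]
  by_cases hb : Bad d ε (F q) π τ
  · rw [if_pos hb]
    obtain ⟨h1, h2, h3⟩ := hA q τ hb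
    set S := Fintype.piFinset (A q τ) with hS
    have hSb : S ⊆ blk π τ := by
      rw [blk_box]; exact Fintype.piFinset_subset _ _ h1
    have hScard : ε ^ 5 * (blk π τ).card ≤ S.card := by
      rw [blk_box, hS, Fintype.card_piFinset, Fintype.card_piFinset]
      push_cast
      calc ε ^ 5 * ∏ i, ((part π (τ i)).card : ℝ) = ∏ i, (ε * (part π (τ i)).card) := by
            rw [prod_mul_distrib]; simp
        _ ≤ _ := prod_le_prod (fun i _ => mul_nonneg hε.le (Nat.cast_nonneg _)) (fun i _ => h2 i)
    have e1 : ∑ y ∈ S, (2 * φ y * (if y ∈ F q then 1 else 0) - φ y ^ 2) =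
        2 * (d / 2) * (F q ∩ S).card - (d / 2) ^ 2 * S.card := by
      rw [← hsum]
      refine sum_congr rfl fun y hy => ?_
      have ht : π ∘ y = τ := (mem_filter.1 (hSb hy)).2
      have : φ y = d / 2 := by simp only [hφ, ht]; rw [if_pos ⟨hb, hy⟩]
      rw [this]
    have e2 : ∑ y ∈ blk π τ \ S, (2 * φ y * (if y ∈ F q then 1 else 0) - φ y ^ 2) =
        2 * D τ * (F q ∩ (blk π τ \ S)).card - D τ ^ 2 * (blk π τ \ S).card := by
      rw [← hsum]
      refine sum_congr rfl fun y hy => ?_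
      rw [mem_sdiff] at hy
      have ht : π ∘ y = τ := (mem_filter.1 hy.1).2
      have : φ y = D τ := by simp only [hφ, ht]; rw [if_neg (fun h => hy.2 h.2)]
      rw [this]
    rw [← sum_sdiff hSb, e1, e2]
    have c1 : ((blk π τ \ S).card : ℝ) = (blk π τ).card - S.card := by
      rw [card_sdiff_of_subset hSb, Nat.cast_sub (card_le_card hSb)]
    have c2 : ((F q ∩ (blk π τ \ S)).card : ℝ) = (F q ∩ blk π τ).card - (F q ∩ S).card := by
      rw [← inter_sdiff_assoc, ← Nat.cast_sub (card_le_card (inter_subset_inter_left hSb))]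
      congr 1
      rw [← card_sdiff_of_subset (inter_subset_inter_left hSb)]
      congr 1; ext y; simp only [mem_sdiff, mem_inter]; tauto
    rw [c1, c2, hDe]
    have hDd : d * (blk π τ).card ≤ D τ * (blk π τ).card := by rw [← hDe]; exact hb.1
    have hSpos : (0:ℝ) < S.card := by
      rcases Nat.eq_zero_or_pos S.card with h | h
      · rw [h] at h3; simp only [Nat.cast_zero, mul_zero] at h3
        exact absurd h3 (not_lt.2 (Nat.cast_nonneg _))
      · exact_mod_cast h
    have hBpos : (0:ℝ) < (blk π τ).card := lt_of_lt_of_le hSpos (by exact_mod_cast card_le_card hSb)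
    have hDd' : d ≤ D τ := le_of_mul_le_mul_right hDd hBpos
    set f : ℝ := ((F q ∩ S).card : ℝ)
    set a : ℝ := (S.card : ℝ)
    set B : ℝ := ((blk π τ).card : ℝ)
    have k1 : (D τ - d / 2) * (d / 2 * a) ≤ (D τ - d / 2) * ((d / 2 + D τ) * a - 2 * f) := by
      refine mul_le_mul_of_nonneg_left ?_ (by linarith)
      nlinarith
    have k2 : d / 2 * (d / 2 * a) ≤ (D τ - d / 2) * (d / 2 * a) :=
      mul_le_mul_of_nonneg_right (by linarith) (mul_nonneg (by linarith) hSpos.le)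
    have k3 : d ^ 2 / 4 * ε ^ 5 * B ≤ d ^ 2 / 4 * a := by
      rw [mul_assoc]; exact mul_le_mul_of_nonneg_left hScard (by positivity)
    nlinarith
  · rw [if_neg hb]
    have e2 : ∑ y ∈ blk π τ, (2 * φ y * (if y ∈ F q then 1 else 0) - φ y ^ 2) =
        2 * D τ * (F q ∩ blk π τ).card - D τ ^ 2 * (blk π τ).card := by
      rw [← hsum]
      refine sum_congr rfl fun y hy => ?_
      have ht : π ∘ y = τ := (mem_filter.1 hy).2
      have : φ y = D τ := by simp only [hφ, ht]; rw [if_neg (fun h => hb h.1)]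
      rw [this]
    rw [e2, hDe]
    apply le_of_eq; ring
end P1
end TC

namespace TC
section P2

theorem En_inst {U : Type} [Fintype U] [DecidableEq U] {α : Type} (i1 : Fintype α) (i2 i4 : DecidableEq α)
    (F : Finset (Fin 5 → U)) (π : U → α) :
    @En U _ _ α i1 i2 F π = @En U _ _ α i1 i4 F π := by
  have h2 : i2 = i4 := Subsingleton.elim _ _
  rw [h2]

open Classical in
theorem reg_aux (ι : Type) [Fintype ι] (d ε e1 : ℝ) (hd : 0 < d) (hε : 0 < ε) (k : ℕ) :
    ∃ T : ℕ, ∀ (U : Type) [Fintype U] (F : ι → Finset (Fin 5 → U)),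
      ∃ (α : Type) (_ : Fintype α) (π : U → α), Fintype.card α ≤ T ∧
       ((∑ q, ∑ τ ∈ univ.filter (fun τ => Bad d ε (F q) π τ), ((blk π τ).card : ℝ)) ≤ e1 * (Fintype.card U : ℝ) ^ 5 ∨
        (k : ℝ) * (d ^ 2 / 4 * ε ^ 5 * e1) * (Fintype.card U : ℝ) ^ 5 ≤ ∑ q, En (F q) π) := by
  induction k with
  | zero =>
    refine ⟨1, fun U _ F => ⟨Unit, inferInstance, fun _ => (), by simp, Or.inr ?_⟩⟩
    simp only [Nat.cast_zero, zero_mul]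
    refine sum_nonneg fun q _ => sum_nonneg fun τ _ => ?_
    exact div_nonneg (sq_nonneg _) (Nat.cast_nonneg _)
  | succ k ih =>
    obtain ⟨T, hT⟩ := ih
    refine ⟨T * 2 ^ (Fintype.card ι * (T ^ 5 * 5)), fun U _ F => ?_⟩
    obtain ⟨α, _, π, hα, h⟩ := hT U F
    by_cases hg : (∑ q, ∑ τ ∈ univ.filter (fun τ => Bad d ε (F q) π τ), ((blk π τ).card : ℝ)) ≤ e1 * (Fintype.card U : ℝ) ^ 5
    · refine ⟨α, inferInstance, π, hα.trans ?_, Or.inl hg⟩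
      exact Nat.le_mul_of_pos_right _ (Nat.two_pow_pos _)
    · have h' := h.resolve_left hg
      obtain ⟨π1, h1⟩ := refine_step d ε hd hε F π
      refine ⟨α × (ι × (Fin 5 → α) × Fin 5 → Bool), _, π1, ?_, Or.inr (le_trans ?_ (le_trans h1
        (le_of_eq (sum_congr rfl fun q _ => En_inst _ _ _ _ _))))⟩
      · simp only [Fintype.card_prod, Fintype.card_fun, Fintype.card_bool, Fintype.card_fin]
        gcongr
        norm_num
      · push_cast
        have : d ^ 2 / 4 * ε ^ 5 * (e1 * (Fintype.card U : ℝ) ^ 5) ≤ d ^ 2 / 4 * ε ^ 5 * (∑ q, ∑ τ ∈ univ.filter (fun τ => Bad d ε (F q) π τ), ((blk π τ).card : ℝ)) :=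
          mul_le_mul_of_nonneg_left (not_le.1 hg).le (by positivity)
        nlinarith

open Classical in
theorem regularity (ι : Type) [Fintype ι] (d ε e1 : ℝ) (hd : 0 < d) (hε : 0 < ε) (he : 0 < e1) :
    ∃ T : ℕ, ∀ (U : Type) [Fintype U] (F : ι → Finset (Fin 5 → U)), 0 < Fintype.card U →
      ∃ (α : Type) (_ : Fintype α) (π : U → α), Fintype.card α ≤ T ∧
       (∑ q, ∑ τ ∈ univ.filter (fun τ => Bad d ε (F q) π τ), ((blk π τ).card : ℝ)) ≤ e1 * (Fintype.card U : ℝ) ^ 5 := by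
  have hξ : 0 < d ^ 2 / 4 * ε ^ 5 * e1 := by positivity
  obtain ⟨k, hk⟩ := exists_nat_gt ((Fintype.card ι : ℝ) / (d ^ 2 / 4 * ε ^ 5 * e1))
  obtain ⟨T, hT⟩ := reg_aux ι d ε e1 hd hε k
  refine ⟨T, fun U _ F hU => ?_⟩
  obtain ⟨α, i, π, hα, h⟩ := hT U F
  refine ⟨α, i, π, hα, h.resolve_right fun h => ?_⟩
  rw [div_lt_iff₀ hξ] at hk
  have h2 : ∑ q, En (F q) π ≤ ∑ q : ι, (Fintype.card U : ℝ) ^ 5 := sum_le_sum fun q _ => En_le _ _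
  rw [sum_const, card_univ, nsmul_eq_mul] at h2
  have hn : (0:ℝ) < (Fintype.card U : ℝ) ^ 5 := by
    have : (0:ℝ) < Fintype.card U := by exact_mod_cast hU
    positivity
  have := h.trans h2
  have := le_of_mul_le_mul_right this hn
  linarith
end P2
end TC

namespace TC
section P3
variable {U : Type} [Fintype U] [DecidableEq U]

theorem prepend (F G : Finset (Fin 5 → U)) (hGF : G ⊆ F) (hrot : ∀ y ∈ F, rt y ∈ F)
    (m : Fin 5 → ℝ) (hc : CleanSet G m) (S : Finset U) (hS : ∀ i, (S.card : ℝ) < m i) (y : Fin 5 → U) (hy : y ∈ G) :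
    ∃ y' ∈ G, TWl F (tl y') (List.ofFn y) ∧ ∀ i, y' i ∉ S := by
  have ext1 : ∀ z ∈ G, ∀ i, ∃ v, v ∉ S ∧ Function.update z i v ∈ G := by
    intro z hz i
    by_contra! hcon
    have h1 : (univ.filter fun v => Function.update z i v ∈ G) ⊆ S := by
      intro v hv
      by_contra h
      exact hcon v h (mem_filter.1 hv).2
    have h2 : ((univ.filter fun v => Function.update z i v ∈ G).card : ℝ) ≤ S.card := by
      exact_mod_cast card_le_card h1
    linarith [hc z hz i, hS i]
  obtain ⟨v4, n4, g4⟩ := ext1 y hy 4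
  obtain ⟨v3, n3, g3⟩ := ext1 _ g4 3
  obtain ⟨v2, n2, g2⟩ := ext1 _ g3 2
  obtain ⟨v1, n1, g1⟩ := ext1 _ g2 1
  obtain ⟨v0, n0, g0⟩ := ext1 _ g1 0
  have e4 : Function.update y 4 v4 = ![y 0, y 1, y 2, y 3, v4] := by
    funext i; fin_cases i <;> simp
  rw [e4] at g4 g3 g2 g1 g0
  have e3 : Function.update ![y 0, y 1, y 2, y 3, v4] 3 v3 = ![y 0, y 1, y 2, v3, v4] := by
    funext i; fin_cases i <;> simp
  rw [e3] at g3 g2 g1 g0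
  have e2 : Function.update ![y 0, y 1, y 2, v3, v4] 2 v2 = ![y 0, y 1, v2, v3, v4] := by
    funext i; fin_cases i <;> simp
  rw [e2] at g2 g1 g0
  have e1 : Function.update ![y 0, y 1, v2, v3, v4] 1 v1 = ![y 0, v1, v2, v3, v4] := by
    funext i; fin_cases i <;> simp
  rw [e1] at g1 g0
  have e0 : Function.update ![y 0, v1, v2, v3, v4] 0 v0 = ![v0, v1, v2, v3, v4] := by
    funext i; fin_cases i <;> simp
  rw [e0] at g0
  refine ⟨_, g0, ?_, ?_⟩
  · have r1 := hrot _ (hGF g1)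
    rw [rt_mk] at r1
    have r2 := hrot _ (hrot _ (hGF g2))
    rw [rt_mk, rt_mk] at r2
    have r3 := hrot _ (hrot _ (hrot _ (hGF g3)))
    rw [rt_mk, rt_mk, rt_mk] at r3
    have r4 := hrot _ (hrot _ (hrot _ (hrot _ (hGF g4))))
    rw [rt_mk, rt_mk, rt_mk, rt_mk] at r4
    have r5 := hGF hy
    rw [eta5 y] at r5
    simp only [List.ofFn_succ, List.ofFn_zero, TWl]
    exact ⟨r1, r2, r3, r4, r5, trivial⟩
  · intro i; fin_cases i <;> assumption

def vts (Y : List (Fin 5 → U)) : List U := Y.flatMap fun y => List.ofFn y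

theorem vts_length (Y : List (Fin 5 → U)) : (vts Y).length = 5 * Y.length := by
  induction Y with
  | nil => rfl
  | cons y Y ih => simp only [vts, List.flatMap_cons, List.length_append, List.length_ofFn, List.length_cons] at *; omega

theorem mem_vts (Y : List (Fin 5 → U)) (v : U) : v ∈ vts Y ↔ ∃ y ∈ Y, ∃ i, y i = v := by
  simp only [vts, List.mem_flatMap, List.mem_ofFn, Set.mem_range]

theorem vts_cons (y : Fin 5 → U) (Y : List (Fin 5 → U)) : vts (y :: Y) = List.ofFn y ++ vts Y := by
  simp [vts]

/-- a round path -/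
def RP (F : Finset (Fin 5 → U)) (Y : List (Fin 5 → U)) : Prop :=
  (∀ y ∈ Y, y ∈ F) ∧ List.IsChain (fun y y' => TWl F (tl y) (List.ofFn y')) Y

theorem blkpath_aux (F G : Finset (Fin 5 → U)) (hGF : G ⊆ F) (hrot : ∀ y ∈ F, rt y ∈ F)
    (hinj : ∀ y ∈ F, Function.Injective y) (hne : G.Nonempty)
    (m : Fin 5 → ℝ) (hc : CleanSet G m) (t : ℕ) (hS : ∀ i, (5 * t : ℝ) < m i) (s : ℕ) (hs : s + 1 ≤ t) :
    ∃ y Y, (y :: Y).length = s + 1 ∧ RP F (y :: Y) ∧ (∀ z ∈ y :: Y, z ∈ G) ∧ (vts (y :: Y)).Nodup := by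
  induction s with
  | zero =>
    obtain ⟨y, hy⟩ := hne
    refine ⟨y, [], rfl, ⟨by simpa using hGF hy, by simp⟩, by simpa using hy, ?_⟩
    rw [vts_cons]; simp only [vts, List.flatMap_nil, List.append_nil]
    exact List.nodup_ofFn.2 (hinj y (hGF hy))
  | succ s ih =>
    obtain ⟨y, Y, h1, h2, h3, h4⟩ := ih (by omega)
    obtain ⟨y', hy', hw, hf⟩ := prepend F G hGF hrot m hc (vts (y :: Y)).toFinset (by
      intro i
      refine lt_of_le_of_lt ?_ (hS i)
      have : (vts (y :: Y)).toFinset.card ≤ 5 * t := by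
        refine (List.toFinset_card_le _).trans ?_
        rw [vts_length, h1]; omega
      exact_mod_cast this) y (h3 y (by simp))
    refine ⟨y', y :: Y, by rw [List.length_cons, h1], ⟨?_, ?_⟩, ?_, ?_⟩
    · intro z hz
      rcases List.mem_cons.1 hz with rfl | hz
      · exact hGF hy'
      · exact h2.1 z hz
    · exact List.IsChain.cons_cons hw h2.2
    · intro z hz
      rcases List.mem_cons.1 hz with rfl | hz
      · exact hy'
      · exact h3 z hz
    · rw [vts_cons, List.nodup_append']
      refine ⟨List.nodup_ofFn.2 (hinj y' (hGF hy')), h4, ?_⟩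
      intro v hv hv'
      rw [List.mem_ofFn] at hv
      obtain ⟨i, rfl⟩ := hv
      exact hf i (List.mem_toFinset.2 hv')

theorem blkpath (F : Finset (Fin 5 → U)) (hrot : ∀ y ∈ F, rt y ∈ F)
    (hinj : ∀ y ∈ F, Function.Injective y) (d : ℝ) (hd : 0 < d) (t : ℕ) (ht : 1 ≤ t) (R : Fin 5 → Finset U)
    (hdens : d / 2 * (Fintype.piFinset R).card ≤ (F ∩ Fintype.piFinset R).card)
    (hbig : ∀ i, (5 * t : ℝ) < d / 12 * (R i).card) :
    ∃ Y, Y.length = t ∧ RP F Y ∧ (∀ z ∈ Y, z ∈ Fintype.piFinset R) ∧ (vts Y).Nodup := by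
  obtain ⟨G, hG, hcl, hcard⟩ := clean (fun i => d / 12 * (R i).card) (fun i => by positivity) _ (F ∩ Fintype.piFinset R) le_rfl
  have hR : ∀ i, (0:ℝ) < (R i).card := by
    intro i
    have h := hbig i
    by_contra hcon
    have h0 : ((R i).card : ℝ) = 0 := le_antisymm (not_lt.1 hcon) (by positivity)
    rw [h0, mul_zero] at h
    have : (0:ℝ) ≤ 5 * t := by positivity
    linarith
  have hP : ((Fintype.piFinset R).card : ℝ) = ∏ i, ((R i).card : ℝ) := by
    rw [Fintype.card_piFinset]; push_cast; rfl
  have hPpos : (0:ℝ) < ∏ i, ((R i).card : ℝ) := prod_pos fun i _ => hR i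
  have hsum : ∑ i, d / 12 * ((R i).card : ℝ) * (((F ∩ Fintype.piFinset R).image (fun y => Fin.removeNth i y)).card : ℝ) ≤
      ∑ i : Fin 5, d / 12 * ∏ i, ((R i).card : ℝ) := by
    refine sum_le_sum fun i _ => ?_
    have h1 : ((F ∩ Fintype.piFinset R).image (fun y => Fin.removeNth i y)) ⊆
        Fintype.piFinset (fun j => R (i.succAbove j)) := by
      intro z hz
      obtain ⟨y, hy, rfl⟩ := mem_image.1 hz
      rw [Fintype.mem_piFinset]
      intro j
      exact Fintype.mem_piFinset.1 (mem_inter.1 hy).2 _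
    have h2 := card_le_card h1
    rw [Fintype.card_piFinset] at h2
    have h3 : (((F ∩ Fintype.piFinset R).image (fun y => Fin.removeNth i y)).card : ℝ) ≤ ∏ j, ((R (i.succAbove j)).card : ℝ) := by
      exact_mod_cast h2
    rw [Fin.prod_univ_succAbove _ i, ← mul_assoc]
    exact mul_le_mul_of_nonneg_left h3 (by positivity)
  rw [sum_const, card_univ, Fintype.card_fin, nsmul_eq_mul] at hsum
  have hGpos : (0:ℝ) < G.card := by
    rw [hP] at hdens
    push_cast at hsum
    have : 0 < d * ∏ i, ((R i).card : ℝ) := by positivity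
    nlinarith
  have hGne : G.Nonempty := card_pos.1 (by exact_mod_cast hGpos)
  obtain ⟨s, rfl⟩ : ∃ s, t = s + 1 := ⟨t - 1, by omega⟩
  obtain ⟨y, Y, h1, h2, h3, h4⟩ := blkpath_aux F G (hG.trans inter_subset_left) hrot hinj hGne _ hcl (s+1) hbig s le_rfl
  exact ⟨y :: Y, h1, h2, fun z hz => (mem_inter.1 (hG (h3 z hz))).2, h4⟩
end P3
end TC

namespace TC
section P4
variable {U : Type} [Fintype U] [DecidableEq U] {ι : Type} {α : Type} [DecidableEq α]

def mult (τ : Fin 5 → α) (p : α) : ℕ := (univ.filter fun i => τ i = p).card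

theorem vts_count (π : U → α) (τ : Fin 5 → α) (p : α) (Y : List (Fin 5 → U)) (h : ∀ y ∈ Y, π ∘ y = τ) :
    ((vts Y).toFinset.filter fun v => π v = p).card ≤ Y.length * mult τ p := by
  induction Y with
  | nil => simp [vts]
  | cons y Y ih =>
    have ih := ih (fun z hz => h z (List.mem_cons_of_mem _ hz))
    rw [vts_cons, List.toFinset_append, filter_union, List.length_cons, add_mul, one_mul]
    refine (card_union_le _ _).trans ?_
    have h1 : ((List.ofFn y).toFinset.filter fun v => π v = p) ⊆ (univ.filter fun i => τ i = p).image y := by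
      intro v hv
      obtain ⟨hv1, hv2⟩ := mem_filter.1 hv
      rw [List.mem_toFinset, List.mem_ofFn] at hv1
      obtain ⟨i, rfl⟩ := hv1
      refine mem_image.2 ⟨i, mem_filter.2 ⟨mem_univ _, ?_⟩, rfl⟩
      rw [← h y (by simp)]; exact hv2
    have h2 := (card_le_card h1).trans card_image_le
    simp only [mult] at *
    omega

/-- all vertices of a family of paths -/
def avts (P : List (ι × List (Fin 5 → U))) : List U := P.flatMap fun x => vts x.2

theorem avts_cons (x : ι × List (Fin 5 → U)) (P : List (ι × List (Fin 5 → U))) : avts (x :: P) = vts x.2 ++ avts P := by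
  simp [avts]

theorem packL (d ε : ℝ) (hd : 0 < d) (t : ℕ) (ht : 1 ≤ t) (F : ι → Finset (Fin 5 → U))
    (hrot : ∀ q, ∀ y ∈ F q, rt y ∈ F q) (hinj : ∀ q, ∀ y ∈ F q, Function.Injective y) (π : U → α)
    (L : List (ι × (Fin 5 → α)))
    (hL : ∀ x ∈ L, ¬ Bad d ε (F x.1) π x.2 ∧ d * (blk π x.2).card ≤ (F x.1 ∩ blk π x.2).card ∧
      ∀ i, (5 * t : ℝ) < d / 12 * (ε * (part π (x.2 i)).card))
    (hcap : ∀ p, (t : ℝ) * ((L.map fun x => mult x.2 p).sum : ℕ) ≤ (1 - ε) * (part π p).card) :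
    ∃ P : List (ι × List (Fin 5 → U)), P.length = L.length ∧ (∀ x ∈ P, x.2.length = t ∧ RP (F x.1) x.2) ∧
      (avts P).Nodup ∧ ∀ p, ((avts P).toFinset.filter fun v => π v = p).card ≤ t * (L.map fun x => mult x.2 p).sum := by
  induction L with
  | nil => exact ⟨[], rfl, by simp, by simp [avts], by simp [avts]⟩
  | cons x L ih =>
    obtain ⟨P, h1, h2, h3, h4⟩ := ih (fun z hz => hL z (List.mem_cons_of_mem _ hz)) (by
      intro p
      refine le_trans ?_ (hcap p)
      refine mul_le_mul_of_nonneg_left ?_ (Nat.cast_nonneg _)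
      rw [List.map_cons, List.sum_cons]; push_cast
      have : (0:ℝ) ≤ (mult x.2 p : ℝ) := Nat.cast_nonneg _
      linarith)
    obtain ⟨hb, hden, hbig⟩ := hL x (by simp)
    set R : Fin 5 → Finset U := fun i => part π (x.2 i) \ (avts P).toFinset with hR
    have hRc : ∀ i, ε * (part π (x.2 i)).card ≤ (R i).card := by
      intro i
      have hc := hcap (x.2 i)
      rw [List.map_cons, List.sum_cons] at hc
      have h4' := h4 (x.2 i)
      have e1 : (part π (x.2 i)).card ≤ (R i).card + ((avts P).toFinset.filter fun v => π v = x.2 i).card := by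
        refine (card_le_card ?_).trans (card_union_le _ _)
        intro v hv
        by_cases h : v ∈ (avts P).toFinset
        · exact mem_union_right _ (mem_filter.2 ⟨h, (mem_filter.1 hv).2⟩)
        · exact mem_union_left _ (mem_sdiff.2 ⟨hv, h⟩)
      have e2 : ((part π (x.2 i)).card : ℝ) ≤ (R i).card + (t * (L.map fun z => mult z.2 (x.2 i)).sum : ℕ) := by
        exact_mod_cast e1.trans (Nat.add_le_add_left h4' _)
      push_cast at hc e2
      have : (0:ℝ) ≤ t * (mult x.2 (x.2 i) : ℝ) := by positivity
      nlinarith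
    obtain ⟨Y, y1, y2, y3, y4⟩ := blkpath (F x.1) (hrot _) (hinj _) d hd t ht R (by
        by_contra hcon
        exact hb ⟨hden, R, fun i => sdiff_subset, hRc, not_le.1 hcon⟩) (by
        intro i
        refine (hbig i).trans_le ?_
        exact mul_le_mul_of_nonneg_left (hRc i) (by positivity))
    have hπ : ∀ y ∈ Y, π ∘ y = x.2 := by
      intro y hy
      funext i
      have := Fintype.mem_piFinset.1 (y3 y hy) i
      exact (mem_filter.1 (mem_sdiff.1 this).1).2
    refine ⟨(x.1, Y) :: P, by simp [h1], ?_, ?_, ?_⟩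
    · intro z hz
      rcases List.mem_cons.1 hz with rfl | hz
      · exact ⟨y1, y2⟩
      · exact h2 z hz
    · rw [avts_cons, List.nodup_append']
      refine ⟨y4, h3, ?_⟩
      intro v hv hv'
      obtain ⟨y, hy, i, rfl⟩ := (mem_vts _ _).1 hv
      have := Fintype.mem_piFinset.1 (y3 y hy) i
      exact (mem_sdiff.1 this).2 (List.mem_toFinset.2 hv')
    · intro p
      rw [avts_cons, List.toFinset_append, filter_union, List.map_cons, List.sum_cons, mul_add]
      refine (card_union_le _ _).trans (Nat.add_le_add ?_ (h4 p))
      have := vts_count π x.2 p Y hπ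
      rwa [y1] at this
end P4
end TC

namespace TC
section P5

theorem repl_sum {X : Type} (m g : X → ℕ) (l : List X) :
    ((l.flatMap fun x => List.replicate (m x) x).map g).sum = (l.map fun x => m x * g x).sum := by
  induction l with
  | nil => rfl
  | cons a l ih => simp [ih]

theorem repl_len {X : Type} (m : X → ℕ) (l : List X) :
    ((l.flatMap fun x => List.replicate (m x) x)).length = (l.map fun x => m x).sum := by
  induction l with
  | nil => rfl
  | cons a l ih => simp [ih]

theorem load_le {U : Type} [Fintype U] [DecidableEq U] {ι : Type} [Fintype ι] (W : ι → (Fin 5 → U) → ℝ)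
    (hinj : ∀ q y, W q y ≠ 0 → Function.Injective y)
    (hload : ∀ v, ∑ q, ∑ y ∈ univ.filter (fun y : Fin 5 → U => ∃ k, y k = v), W q y ≤ 1) (S : Finset U) :
    ∑ q, ∑ y, W q y * ((univ.filter fun i => y i ∈ S).card : ℝ) ≤ S.card := by
  have e : ∀ q y, W q y * ((univ.filter fun i => y i ∈ S).card : ℝ) = ∑ v ∈ S, if ∃ k, y k = v then W q y else 0 := by
    intro q y
    by_cases h : W q y = 0
    · simp [h]
    · have hi := hinj q y h
      rw [← sum_filter, sum_const, nsmul_eq_mul, mul_comm]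
      congr 2
      rw [← card_image_of_injective _ hi]
      congr 1
      ext v
      simp only [mem_image, mem_filter, mem_univ, true_and]
      constructor
      · rintro ⟨i, h1, rfl⟩; exact ⟨h1, i, rfl⟩
      · rintro ⟨h1, i, rfl⟩; exact ⟨i, h1, rfl⟩
  simp only [e]
  calc ∑ q, ∑ y, ∑ v ∈ S, (if ∃ k, y k = v then W q y else 0)
      = ∑ v ∈ S, ∑ q, ∑ y ∈ univ.filter (fun y : Fin 5 → U => ∃ k, y k = v), W q y := by
        rw [sum_comm (s := S)]
        refine sum_congr rfl fun q _ => ?_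
        rw [sum_comm]
        refine sum_congr rfl fun v _ => ?_
        rw [sum_filter]
    _ ≤ ∑ v ∈ S, 1 := sum_le_sum fun v _ => hload v
    _ = S.card := by simp

open Classical in
theorem pack (ι : Type) [Fintype ι] (η C : ℝ) (hη : 0 < η) (hη1 : η < 1) (hC : 0 < C) (t : ℕ) (ht : 1 ≤ t) :
    ∃ n0 : ℕ, ∀ (U : Type) [Fintype U], n0 ≤ Fintype.card U → 0 < Fintype.card U →
      ∀ (F : ι → Finset (Fin 5 → U)) (W : ι → (Fin 5 → U) → ℝ),
      (∀ q, ∀ y ∈ F q, rt y ∈ F q) → (∀ q, ∀ y ∈ F q, Function.Injective y) →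
      (∀ q y, 0 ≤ W q y) → (∀ q y, W q y ≠ 0 → y ∈ F q) →
      (∀ v, ∑ q, ∑ y ∈ univ.filter (fun y : Fin 5 → U => ∃ k, y k = v), W q y ≤ 1) →
      (∀ q y, W q y ≤ C / (Fintype.card U : ℝ) ^ 4) →
      (1 - η) * Fintype.card U / 5 ≤ ∑ q, ∑ y, W q y →
      ∃ P : List (ι × List (Fin 5 → U)), (∀ x ∈ P, x.2.length = t ∧ RP (F x.1) x.2) ∧
      (avts P).Nodup ∧ (1 - 5 * η) * Fintype.card U ≤ 5 * t * P.length := by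
  set cι : ℝ := (Fintype.card ι : ℝ) + 1 with hcι
  have hcpos : 0 < cι := by positivity
  set d : ℝ := η / (5 * C * cι) with hd
  have hdpos : 0 < d := by positivity
  set e1 : ℝ := η / (5 * C) with he1
  have he1pos : 0 < e1 := by positivity
  obtain ⟨T, hT⟩ := regularity ι d η e1 hdpos hη he1pos
  obtain ⟨n0, hn0⟩ := exists_nat_gt ((T * (60 * t / (d * η)) + cι * T ^ 5 * t) / (η / 5))
  refine ⟨n0, fun U _ hU hUpos F W hrot hinj hW0 hWF hload hWC hWtot => ?_⟩
  obtain ⟨α, iα, π, hα, hbad⟩ := hT U F hUpos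
  set n : ℝ := (Fintype.card U : ℝ) with hn
  have hnpos : 0 < n := by rw [hn]; exact_mod_cast hUpos
  have hnbig : T * (60 * t / (d * η)) + cι * T ^ 5 * t ≤ η / 5 * n := by
    rw [div_lt_iff₀ (by positivity)] at hn0
    have : (n0 : ℝ) ≤ n := by rw [hn]; exact_mod_cast hU
    nlinarith
  set D : ι × (Fin 5 → α) → ℝ := fun x => ∑ y ∈ blk π x.2, W x.1 y with hD
  have hD0 : ∀ x, 0 ≤ D x := fun x => sum_nonneg fun y _ => hW0 _ _
  set Big : (Fin 5 → α) → Prop := fun τ => ∀ i, (5 * t : ℝ) < d / 12 * (η * (part π (τ i)).card) with hBig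
  set Keep : ι × (Fin 5 → α) → Prop := fun x => ¬ Bad d η (F x.1) π x.2 ∧
    d * (blk π x.2).card ≤ (F x.1 ∩ blk π x.2).card ∧ Big x.2 with hKeep
  set m : ι × (Fin 5 → α) → ℕ := fun x => ⌊(1 - η) * D x / t⌋₊ with hm
  have htpos : (0:ℝ) < t := by exact_mod_cast ht
  have hm1 : ∀ x, (t:ℝ) * m x ≤ (1 - η) * D x := by
    intro x
    have h := Nat.floor_le (a := (1 - η) * D x / t) (div_nonneg (mul_nonneg (by linarith) (hD0 x)) htpos.le)
    rw [le_div_iff₀ htpos] at h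
    linarith
  have hm2 : ∀ x, (1 - η) * D x - t ≤ t * m x := by
    intro x
    have h := Nat.lt_floor_add_one ((1 - η) * D x / t)
    rw [div_lt_iff₀ htpos] at h
    nlinarith
  set L : List (ι × (Fin 5 → α)) := (univ.filter Keep).toList.flatMap fun x => List.replicate (m x) x with hLdef
  have hLmem : ∀ x ∈ L, Keep x := by
    intro x hx
    obtain ⟨z, hz, hzx⟩ := List.mem_flatMap.1 hx
    rw [List.eq_of_mem_replicate hzx]
    exact (mem_filter.1 (mem_toList.1 hz)).2
  have hLlen : L.length = ∑ x ∈ univ.filter Keep, m x := by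
    rw [hLdef, repl_len, Finset.sum_map_toList]
  have hLsum : ∀ g : ι × (Fin 5 → α) → ℕ, (L.map g).sum = ∑ x ∈ univ.filter Keep, m x * g x := by
    intro g
    rw [hLdef, repl_sum, Finset.sum_map_toList]
  have hWinj : ∀ q y, W q y ≠ 0 → Function.Injective y := fun q y h => hinj q y (hWF q y h)
  have hsw : ∀ g : (Fin 5 → α) → ℝ, ∑ x, D x * g x.2 = ∑ q, ∑ y, W q y * g (π ∘ y) := by
    intro g
    rw [Fintype.sum_prod_type]
    refine sum_congr rfl fun q _ => ?_
    rw [← sum_blk π]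
    refine sum_congr rfl fun τ _ => ?_
    rw [hD, sum_mul]
    refine sum_congr rfl fun y hy => ?_
    rw [(mem_filter.1 hy).2]
  have hcap : ∀ p, (t : ℝ) * ((L.map fun x => mult x.2 p).sum : ℕ) ≤ (1 - η) * (part π p).card := by
    intro p
    rw [hLsum (fun x => mult x.2 p)]
    push_cast
    rw [mul_sum]
    calc ∑ x ∈ univ.filter Keep, (t:ℝ) * (m x * mult x.2 p)
        ≤ ∑ x ∈ univ.filter Keep, (1 - η) * (D x * mult x.2 p) := by
          refine sum_le_sum fun x _ => ?_
          rw [← mul_assoc, ← mul_assoc]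
          exact mul_le_mul_of_nonneg_right (hm1 x) (Nat.cast_nonneg _)
      _ ≤ ∑ x, (1 - η) * (D x * mult x.2 p) := by
          refine sum_le_sum_of_subset_of_nonneg (filter_subset _ _) fun x _ _ => ?_
          exact mul_nonneg (by linarith) (mul_nonneg (hD0 x) (Nat.cast_nonneg _))
      _ = (1 - η) * ∑ q, ∑ y, W q y * mult (π ∘ y) p := by
          rw [← mul_sum, hsw (fun τ => (mult τ p : ℝ))]
      _ ≤ (1 - η) * (part π p).card := by
          refine mul_le_mul_of_nonneg_left ?_ (by linarith)
          have := load_le W hWinj hload (part π p)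
          refine le_trans (le_of_eq ?_) this
          refine sum_congr rfl fun q _ => sum_congr rfl fun y _ => ?_
          simp only [mult, part, mem_filter, mem_univ, true_and, Function.comp]
  obtain ⟨P, hP1, hP2, hP3, -⟩ := packL d η hdpos t ht F hrot hinj π L hLmem hcap
  refine ⟨P, hP2, hP3, ?_⟩
  rw [hP1, hLlen]
  push_cast
  -- losses
  have hblk : ∑ τ : Fin 5 → α, ((blk π τ).card : ℝ) = n ^ 5 := by
    have := sum_blk π (fun _ => (1:ℝ))
    simp only [sum_const, nsmul_eq_mul, mul_one] at this
    rw [this, card_univ, Fintype.card_fun, Fintype.card_fin]; push_cast; rfl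
  have hl1 : ∑ x, (if Bad d η (F x.1) π x.2 then D x else 0) ≤ η / 5 * n := by
    have : ∑ x, (if Bad d η (F x.1) π x.2 then D x else 0) ≤ C / n ^ 4 * ∑ q, ∑ τ ∈ univ.filter (fun τ => Bad d η (F q) π τ), ((blk π τ).card : ℝ) := by
      rw [Fintype.sum_prod_type, mul_sum]
      refine sum_le_sum fun q _ => ?_
      rw [← sum_filter, mul_sum]
      refine sum_le_sum fun τ _ => ?_
      rw [hD, mul_comm, ← nsmul_eq_mul]
      exact sum_le_card_nsmul _ _ _ fun y _ => hWC q y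
    refine this.trans ((mul_le_mul_of_nonneg_left hbad (by positivity)).trans (le_of_eq ?_))
    rw [he1]; field_simp
  have hl2 : ∑ x, (if ¬ (d * (blk π x.2).card ≤ (F x.1 ∩ blk π x.2).card) then D x else 0) ≤ η / 5 * n := by
    have h1 : ∀ x : ι × (Fin 5 → α), (if ¬ (d * (blk π x.2).card ≤ (F x.1 ∩ blk π x.2).card) then D x else 0) ≤
        C / n ^ 4 * d * (blk π x.2).card := by
      intro x
      split_ifs with h
      · exact mul_nonneg (by positivity) (Nat.cast_nonneg _)
      · have e : D x = ∑ y ∈ F x.1 ∩ blk π x.2, W x.1 y := by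
          symm
          refine sum_subset inter_subset_right fun y hy hy' => ?_
          by_contra h0
          exact hy' (mem_inter.2 ⟨hWF _ _ h0, hy⟩)
        have h2 : D x ≤ (F x.1 ∩ blk π x.2).card • (C / n ^ 4) := by
          rw [e]; exact sum_le_card_nsmul _ _ _ fun y _ => hWC _ y
        rw [nsmul_eq_mul] at h2
        have h3 := mul_le_mul_of_nonneg_left (not_le.1 h).le (show 0 ≤ C / n ^ 4 by positivity)
        linarith
    refine (sum_le_sum fun x _ => h1 x).trans ?_
    rw [← mul_sum, Fintype.sum_prod_type]
    simp only [hblk, sum_const, card_univ, nsmul_eq_mul]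
    have h4 : (Fintype.card ι : ℝ) ≤ cι := by rw [hcι]; linarith
    calc C / n ^ 4 * d * (Fintype.card ι * n ^ 5) ≤ C / n ^ 4 * d * (cι * n ^ 5) := by gcongr
      _ = η / 5 * n := by rw [hd]; field_simp
  set sm : Finset U := univ.filter fun v => ¬ ((5 * t : ℝ) < d / 12 * (η * (part π (π v)).card)) with hsm
  have hsmc : (sm.card : ℝ) ≤ T * (60 * t / (d * η)) := by
    have h1 : sm ⊆ (univ.filter fun p : α => ¬ ((5 * t : ℝ) < d / 12 * (η * (part π p).card))).biUnion (part π) := by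
      intro v hv
      refine mem_biUnion.2 ⟨π v, mem_filter.2 ⟨mem_univ _, (mem_filter.1 hv).2⟩, by simp [part]⟩
    have h2 : (sm.card : ℝ) ≤ ∑ p ∈ (univ.filter fun p : α => ¬ ((5 * t : ℝ) < d / 12 * (η * (part π p).card))), ((part π p).card : ℝ) := by
      exact_mod_cast (card_le_card h1).trans card_biUnion_le
    have h3 : ∀ p ∈ (univ.filter fun p : α => ¬ ((5 * t : ℝ) < d / 12 * (η * (part π p).card))), ((part π p).card : ℝ) ≤ 60 * t / (d * η) := by
      intro p hp
      have := not_lt.1 (mem_filter.1 hp).2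
      rw [le_div_iff₀ (by positivity)]
      linarith
    refine h2.trans ((sum_le_card_nsmul _ _ _ h3).trans ?_)
    rw [nsmul_eq_mul]
    refine mul_le_mul_of_nonneg_right ?_ (by positivity)
    exact_mod_cast (card_le_univ _).trans hα
  have hl3 : ∑ x, (if ¬ Big x.2 then D x else 0) ≤ T * (60 * t / (d * η)) := by
    have e : ∑ x, (if ¬ Big x.2 then D x else 0) = ∑ x, D x * (if ¬ Big x.2 then 1 else 0) :=
      sum_congr rfl fun x _ => by split_ifs <;> simp
    rw [e, hsw (fun τ => if ¬ Big τ then 1 else 0)]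
    refine le_trans ?_ ((load_le W hWinj hload sm).trans hsmc)
    refine sum_le_sum fun q _ => sum_le_sum fun y _ => mul_le_mul_of_nonneg_left ?_ (hW0 q y)
    by_cases hb : Big (π ∘ y)
    · rw [if_neg (not_not.2 hb)]; exact Nat.cast_nonneg _
    · rw [if_pos hb]
      simp only [hBig] at hb
      push Not at hb
      obtain ⟨i, hi⟩ := hb
      have : 0 < (univ.filter fun i => y i ∈ sm).card := card_pos.2 ⟨i, mem_filter.2 ⟨mem_univ _,
        mem_filter.2 ⟨mem_univ _, not_lt.2 hi⟩⟩⟩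
      exact_mod_cast this
  have hDtot : ∑ x, D x = ∑ q, ∑ y, W q y := by
    have := hsw (fun _ => 1)
    simpa using this
  have hkeepD : ∑ x, D x ≤ ∑ x ∈ univ.filter Keep, D x + (η / 5 * n + η / 5 * n + T * (60 * t / (d * η))) := by
    have : ∑ x, D x ≤ ∑ x, ((if Keep x then D x else 0) + ((if Bad d η (F x.1) π x.2 then D x else 0) +
        (if ¬ (d * (blk π x.2).card ≤ (F x.1 ∩ blk π x.2).card) then D x else 0) + (if ¬ Big x.2 then D x else 0))) := by
      refine sum_le_sum fun x _ => ?_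
      have h0 := hD0 x
      by_cases h1 : Bad d η (F x.1) π x.2
      · rw [if_pos h1]
        have a1 : 0 ≤ (if Keep x then D x else 0) := by split_ifs <;> simp [h0]
        have a2 : 0 ≤ (if ¬ (d * (blk π x.2).card ≤ (F x.1 ∩ blk π x.2).card) then D x else 0) := by split_ifs <;> simp [h0]
        have a3 : 0 ≤ (if ¬ Big x.2 then D x else 0) := by split_ifs <;> simp [h0]
        linarith
      rw [if_neg h1]
      by_cases h2 : d * (blk π x.2).card ≤ (F x.1 ∩ blk π x.2).card
      · rw [if_neg (not_not.2 h2)]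
        by_cases h3 : Big x.2
        · rw [if_pos ⟨h1, h2, h3⟩, if_neg (not_not.2 h3)]; linarith
        · rw [if_pos h3]
          have a1 : 0 ≤ (if Keep x then D x else 0) := by split_ifs <;> simp [h0]
          linarith
      · rw [if_pos h2]
        have a1 : 0 ≤ (if Keep x then D x else 0) := by split_ifs <;> simp [h0]
        have a3 : 0 ≤ (if ¬ Big x.2 then D x else 0) := by split_ifs <;> simp [h0]
        linarith
    rw [sum_add_distrib, sum_add_distrib, sum_add_distrib, ← sum_filter] at this
    linarith
  have hcardK : ((univ.filter Keep).card : ℝ) ≤ cι * T ^ 5 := by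
    have h1 : (univ.filter Keep).card ≤ Fintype.card ι * T ^ 5 := by
      refine (card_le_univ _).trans ?_
      rw [Fintype.card_prod, Fintype.card_fun, Fintype.card_fin]
      exact Nat.mul_le_mul_left _ (Nat.pow_le_pow_left hα 5)
    have h2 : ((univ.filter Keep).card : ℝ) ≤ Fintype.card ι * (T:ℝ) ^ 5 := by exact_mod_cast h1
    refine h2.trans (mul_le_mul_of_nonneg_right ?_ (by positivity))
    rw [hcι]; linarith
  have hfin : (1 - η) * ∑ x ∈ univ.filter Keep, D x - cι * T ^ 5 * t ≤ t * ∑ x ∈ univ.filter Keep, (m x : ℝ) := by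
    have h1 : ∑ x ∈ univ.filter Keep, ((1 - η) * D x - t) ≤ ∑ x ∈ univ.filter Keep, (t : ℝ) * m x :=
      sum_le_sum fun x _ => hm2 x
    rw [sum_sub_distrib, ← mul_sum, ← mul_sum, sum_const, nsmul_eq_mul] at h1
    have := mul_le_mul_of_nonneg_right hcardK htpos.le
    linarith
  set X := ∑ x ∈ univ.filter Keep, D x
  rw [hDtot] at hkeepD
  have hXn : (1 - η) * n / 5 - 2 * (η / 5 * n) - T * (60 * t / (d * η)) ≤ X := by linarith
  have hE : 0 ≤ T * (60 * t / (d * η)) := by positivity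
  have := mul_le_mul_of_nonneg_left hXn (show 0 ≤ 1 - η by linarith)
  set E := T * (60 * t / (d * η))
  have h9 : 0 ≤ η * E := by positivity
  have h10 : 0 ≤ η * (η * n) := by positivity
  nlinarith
end P5
end TC

namespace TC
section A1
variable {V : Type} [Fintype V] [DecidableEq V]

def ed (f : Fin 4 → V) (l : List V) : Fin 4 → V := l.foldl nx f

theorem TWl_append (H : Finset (Fin 5 → V)) (f : Fin 4 → V) (l1 l2 : List V) :
    TWl H f (l1 ++ l2) ↔ TWl H f l1 ∧ TWl H (ed f l1) l2 := by
  induction l1 generalizing f with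
  | nil => simp [TWl, ed]
  | cons a l1 ih => simp only [List.cons_append, TWl, ih, ed, List.foldl_cons, and_assoc]

theorem ed_append (f : Fin 4 → V) (l1 l2 : List V) : ed f (l1 ++ l2) = ed (ed f l1) l2 := by
  simp [ed]

theorem ed_four (f g : Fin 4 → V) : ed f (List.ofFn g) = g := by
  simp only [ed, List.ofFn_succ, List.ofFn_zero, List.foldl_cons, List.foldl_nil]
  funext i; fin_cases i <;> simp [nx]

theorem ed_five (f : Fin 4 → V) (g : Fin 5 → V) : ed f (List.ofFn g) = tl g := by
  simp only [ed, List.ofFn_succ, List.ofFn_zero, List.foldl_cons, List.foldl_nil]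
  funext i; fin_cases i <;> simp [nx, tl]

theorem window (H : Finset (Fin 5 → V)) (g : ℕ → V) (N : ℕ) : ∀ (f : Fin 4 → V) (a : ℕ),
    TWl H f ((List.range' a N).map g) → ∀ i, i + 4 < N →
    ![g (a + i), g (a + i + 1), g (a + i + 2), g (a + i + 3), g (a + i + 4)] ∈ H := by
  induction N with
  | zero => intro f a _ i hi; omega
  | succ N ih =>
    intro f a h i hi
    rw [List.range'_succ, List.map_cons] at h
    rcases i with _ | i
    · obtain ⟨M, rfl⟩ : ∃ M, N = M + 4 := ⟨N - 4, by omega⟩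
      simp only [List.range'_succ, List.map_cons, TWl] at h
      exact h.2.2.2.2.1
    · have := ih _ _ h.2 i (by omega)
      rw [show a + (i + 1) = a + 1 + i by ring]; exact this

theorem closed_cycle (H : Finset (Fin 5 → V)) (E : Finset V → Prop) (hHE : ∀ y ∈ H, E (univ.image y))
    (f : Fin 4 → V) (l : List V) (hl : l.Nodup) (hne : l ≠ []) (hw : TWl H f l) (he : ed f l = f) :
    IsTightCycleSetOn 5 E l.toFinset := by
  right
  have hpos : 0 < l.length := List.length_pos_iff.2 hne
  have hcard : l.toFinset.card = l.length := List.toFinset_card_of_nodup hl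
  rw [hcard]
  set g : ℕ → V := fun i => l[i % l.length]'(Nat.mod_lt _ hpos) with hg
  have hper : ∀ i, g (i + l.length) = g i := by
    intro i; simp only [hg, Nat.add_mod_right]
  have hall : ∀ N, TWl H f ((List.range (N * l.length)).map g) ∧ ed f ((List.range (N * l.length)).map g) = f := by
    intro N
    induction N with
    | zero => simp [TWl, ed]
    | succ N ih =>
      have e : (List.range ((N + 1) * l.length)).map g = (List.range (N * l.length)).map g ++ l := by
        rw [add_mul, one_mul, List.range_add, List.map_append]
        congr 1
        rw [List.map_map]
        apply List.ext_getElem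
        · simp
        · intro i h1 h2
          simp only [List.getElem_map, List.getElem_range, Function.comp, hg]
          congr 1
          rw [add_comm, Nat.add_mul_mod_self_right, Nat.mod_eq_of_lt h2]
      rw [e, TWl_append, ed_append, ih.2]
      exact ⟨⟨ih.1, hw⟩, he⟩
  refine ⟨g, hper, ?_, ?_, ?_, ?_⟩
  · intro i; rw [List.mem_toFinset]; exact List.getElem_mem _
  · intro i j hi hj h
    simp only [hg] at h
    have := (List.Nodup.getElem_inj_iff hl).1 h
    rwa [Nat.mod_eq_of_lt hi, Nat.mod_eq_of_lt hj] at this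
  · intro v hv
    rw [List.mem_toFinset] at hv
    obtain ⟨i, hi, rfl⟩ := List.getElem_of_mem hv
    exact ⟨i, by simp only [hg, Nat.mod_eq_of_lt hi]⟩
  · intro i
    have h := window H g ((i + 5) * l.length) f 0 (by rw [← List.range_eq_range']; exact (hall _).1) i (by
      nlinarith)
    have := hHE _ h
    convert this using 1
    ext v
    simp only [mem_image, mem_range, mem_univ, true_and, zero_add]
    constructor
    · rintro ⟨j, hj, rfl⟩
      refine ⟨⟨j, hj⟩, ?_⟩
      interval_cases j <;> rfl
    · rintro ⟨j, rfl⟩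
      refine ⟨j.1, j.2, ?_⟩
      fin_cases j <;> rfl

theorem RP_walk (F : Finset (Fin 5 → V)) (Y : List (Fin 5 → V)) : ∀ w, RP F (w :: Y) →
    ∃ u ∈ F, TWl F (ini w) (w 4 :: vts Y) ∧ ed (ini w) (w 4 :: vts Y) = tl u := by
  induction Y with
  | nil =>
    intro w h
    have hw := h.1 w (by simp)
    refine ⟨w, hw, ⟨by rwa [sn_ini], trivial⟩, ?_⟩
    simp only [vts, List.flatMap_nil, ed, List.foldl_cons, List.foldl_nil, nx_ini]
  | cons y Y ih =>
    intro w h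
    have hw := h.1 w (by simp)
    obtain ⟨hc1, hc2⟩ := List.isChain_cons_cons.1 h.2
    obtain ⟨u, hu, h1, h2⟩ := ih y ⟨fun z hz => h.1 z (List.mem_cons_of_mem _ hz), hc2⟩
    refine ⟨u, hu, ⟨by rwa [sn_ini], ?_⟩, ?_⟩
    · rw [nx_ini, vts_cons, TWl_append, ed_five]
      refine ⟨hc1, ?_⟩
      have := h1.2; rwa [nx_ini] at this
    · simp only [ed, List.foldl_cons, nx_ini] at h2 ⊢
      rw [vts_cons, List.foldl_append, ← h2]
      congr 1

/-- connecting property -/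
def CP (H F : Finset (Fin 5 → V)) (X : Finset V) (L B : ℕ) : Prop :=
  ∀ y ∈ F, ∀ y' ∈ F, ∀ S : Finset V, S.card ≤ B → ∃ z : List V, z.length ≤ L ∧ z.Nodup ∧
    (∀ v ∈ z, v ∈ X ∧ v ∉ S) ∧ TWl H (ini y) (z ++ List.ofFn (ini y'))

theorem vts_head (w : Fin 5 → V) (Y : List (Fin 5 → V)) : vts (w :: Y) = List.ofFn (ini w) ++ (w 4 :: vts Y) := by
  rw [vts_cons]
  simp only [List.ofFn_succ, List.ofFn_zero, List.cons_append, List.nil_append]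
  rfl

theorem chainup (H F : Finset (Fin 5 → V)) (hFH : F ⊆ H) (hrot : ∀ y ∈ F, rt y ∈ F) (X : Finset V) (L B : ℕ)
    (hC : CP H F X L B) (y0 : Fin 5 → V) (hy0 : y0 ∈ F) (Q : List (List (Fin 5 → V))) :
    ∀ (y : Fin 5 → V) (S : Finset V), y ∈ F → (∀ Y ∈ Q, Y ≠ [] ∧ RP F Y) → (Q.flatMap vts).Nodup →
      (∀ v ∈ Q.flatMap vts, v ∉ X) → S.card + (Q.length + 1) * L ≤ B →
      ∃ l, TWl H (ini y) (l ++ List.ofFn (ini y0)) ∧ l.Nodup ∧ (∀ v ∈ Q.flatMap vts, v ∈ l) ∧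
        (∀ v ∈ l, (v ∈ X ∧ v ∉ S) ∨ v ∈ Q.flatMap vts) ∧ (l.toFinset ∩ X).card ≤ (Q.length + 1) * L := by
  induction Q with
  | nil =>
    intro y S hy _ _ _ hS
    obtain ⟨z, z1, z2, z3, z4⟩ := hC y hy y0 hy0 S (by omega)
    refine ⟨z, z4, z2, by simp, fun v hv => Or.inl (z3 v hv), ?_⟩
    refine (card_le_card inter_subset_left).trans ((List.toFinset_card_le _).trans ?_)
    simpa using z1
  | cons Y Q ih =>
    intro y S hy hQ hnd hX hS
    obtain ⟨hY1, hY2⟩ := hQ Y (by simp)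
    obtain ⟨w, Y', rfl⟩ := List.exists_cons_of_ne_nil hY1
    rw [List.flatMap_cons] at hnd hX
    rw [List.nodup_append'] at hnd
    obtain ⟨nd1, nd2, nd3⟩ := hnd
    have hwF := hY2.1 w (by simp)
    rw [List.length_cons] at hS
    have hS' : S.card + (Q.length + 1) * L + L ≤ B := by
      have : (Q.length + 1 + 1) * L = (Q.length + 1) * L + L := by ring
      omega
    obtain ⟨z, z1, z2, z3, z4⟩ := hC y hy w hwF S (by omega)
    obtain ⟨u, hu, u1, u2⟩ := RP_walk F Y' w hY2
    obtain ⟨l, l1, l2, l3, l4, l5⟩ := ih (rt u) (S ∪ z.toFinset) (hrot _ hu)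
      (fun Y hY => hQ Y (List.mem_cons_of_mem _ hY)) nd2 (fun v hv => hX v (List.mem_append_right _ hv)) (by
        have := card_union_le S z.toFinset
        have := List.toFinset_card_le z
        omega)
    refine ⟨z ++ (vts (w :: Y') ++ l), ?_, ?_, ?_, ?_, ?_⟩
    · rw [vts_head]
      have e : z ++ (List.ofFn (ini w) ++ w 4 :: vts Y' ++ l) ++ List.ofFn (ini y0) =
          (z ++ List.ofFn (ini w)) ++ ((w 4 :: vts Y') ++ (l ++ List.ofFn (ini y0))) := by
        simp only [List.append_assoc, List.cons_append]
      rw [e, TWl_append]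
      refine ⟨z4, ?_⟩
      rw [ed_append, ed_four, TWl_append, u2, ← ini_rt]
      exact ⟨TWl_mono hFH _ _ u1, l1⟩
    · rw [List.nodup_append', List.nodup_append']
      refine ⟨z2, ⟨nd1, l2, ?_⟩, ?_⟩
      · intro v hv hv'
        rcases l4 v hv' with h | h
        · exact hX v (List.mem_append_left _ hv) h.1
        · exact nd3 hv h
      · intro v hv hv'
        rcases List.mem_append.1 hv' with h | h
        · exact hX v (List.mem_append_left _ h) (z3 v hv).1
        · rcases l4 v h with h | h
          · exact h.2 (mem_union_right _ (List.mem_toFinset.2 hv))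
          · exact hX v (List.mem_append_right _ h) (z3 v hv).1
    · intro v hv
      rw [List.flatMap_cons] at hv
      rcases List.mem_append.1 hv with h | h
      · exact List.mem_append_right _ (List.mem_append_left _ h)
      · exact List.mem_append_right _ (List.mem_append_right _ (l3 v h))
    · intro v hv
      rw [List.flatMap_cons]
      rcases List.mem_append.1 hv with h | h
      · exact Or.inl (z3 v h)
      · rcases List.mem_append.1 h with h | h
        · exact Or.inr (List.mem_append_left _ h)
        · rcases l4 v h with h | h
          · exact Or.inl ⟨h.1, fun h' => h.2 (mem_union_left _ h')⟩
          · exact Or.inr (List.mem_append_right _ h)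
    · have hsub : (z ++ (vts (w :: Y') ++ l)).toFinset ∩ X ⊆ z.toFinset ∪ (l.toFinset ∩ X) := by
        intro v hv
        obtain ⟨h1, h2⟩ := mem_inter.1 hv
        rw [List.mem_toFinset] at h1
        rcases List.mem_append.1 h1 with h | h
        · exact mem_union_left _ (List.mem_toFinset.2 h)
        · rcases List.mem_append.1 h with h | h
          · exact absurd h2 (hX v (List.mem_append_left _ h))
          · exact mem_union_right _ (mem_inter.2 ⟨List.mem_toFinset.2 h, h2⟩)
      refine (card_le_card hsub).trans ((card_union_le _ _).trans ?_)
      have := List.toFinset_card_le z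
      rw [List.length_cons]
      have : (Q.length + 1 + 1) * L = (Q.length + 1) * L + L := by ring
      omega

theorem cyc (H F : Finset (Fin 5 → V)) (hFH : F ⊆ H) (hrot : ∀ y ∈ F, rt y ∈ F) (X : Finset V) (L B : ℕ)
    (hC : CP H F X L B) (E : Finset V → Prop) (hHE : ∀ y ∈ H, E (univ.image y)) (Q : List (List (Fin 5 → V)))
    (S : Finset V) (hQ : ∀ Y ∈ Q, Y ≠ [] ∧ RP F Y) (hnd : (Q.flatMap vts).Nodup)
    (hX : ∀ v ∈ Q.flatMap vts, v ∉ X) (hS : S.card + (Q.length + 1) * L ≤ B) :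
    ∃ W : Finset V, IsTightCycleSetOn 5 E W ∧ (∀ v ∈ Q.flatMap vts, v ∈ W) ∧
        (∀ v ∈ W, (v ∈ X ∧ v ∉ S) ∨ v ∈ Q.flatMap vts) ∧ (W ∩ X).card ≤ (Q.length + 1) * L := by
  rcases Q with _ | ⟨Y, Q⟩
  · exact ⟨∅, Or.inl (by simp), by simp, by simp, by simp⟩
  obtain ⟨hY1, hY2⟩ := hQ Y (by simp)
  obtain ⟨w, Y', rfl⟩ := List.exists_cons_of_ne_nil hY1
  rw [List.flatMap_cons] at hnd hX
  rw [List.nodup_append'] at hnd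
  obtain ⟨nd1, nd2, nd3⟩ := hnd
  have hwF := hY2.1 w (by simp)
  rw [List.length_cons] at hS ⊢
  have hS' : (Q.length + 1 + 1) * L = (Q.length + 1) * L + L := by ring
  obtain ⟨u, hu, u1, u2⟩ := RP_walk F Y' w hY2
  obtain ⟨l, l1, l2, l3, l4, l5⟩ := chainup H F hFH hrot X L B hC w hwF Q (rt u) S (hrot _ hu)
      (fun Y hY => hQ Y (List.mem_cons_of_mem _ hY)) nd2 (fun v hv => hX v (List.mem_append_right _ hv)) (by omega)
  have hperm : List.Perm ((w 4 :: vts Y') ++ (l ++ List.ofFn (ini w))) (vts (w :: Y') ++ l) := by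
    rw [vts_head, ← List.append_assoc]
    refine List.perm_append_comm.trans ?_
    rw [List.append_assoc]
  have hmem : ∀ v, v ∈ ((w 4 :: vts Y') ++ (l ++ List.ofFn (ini w))).toFinset ↔ v ∈ vts (w :: Y') ∨ v ∈ l := by
    intro v
    rw [List.mem_toFinset, hperm.mem_iff, List.mem_append]
  refine ⟨((w 4 :: vts Y') ++ (l ++ List.ofFn (ini w))).toFinset, ?_, ?_, ?_, ?_⟩
  · refine closed_cycle H E hHE (ini w) _ ?_ (by simp) ?_ ?_
    · rw [hperm.nodup_iff, List.nodup_append']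
      refine ⟨nd1, l2, ?_⟩
      intro v hv hv'
      rcases l4 v hv' with h | h
      · exact hX v (List.mem_append_left _ hv) h.1
      · exact nd3 hv h
    · rw [TWl_append, u2, ← ini_rt]
      exact ⟨TWl_mono hFH _ _ u1, l1⟩
    · rw [ed_append, ed_append, ed_four]
  · intro v hv
    rw [hmem]
    rw [List.flatMap_cons] at hv
    rcases List.mem_append.1 hv with h | h
    · exact Or.inl h
    · exact Or.inr (l3 v h)
  · intro v hv
    rw [hmem] at hv
    rw [List.flatMap_cons]
    rcases hv with h | h
    · exact Or.inr (List.mem_append_left _ h)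
    · rcases l4 v h with h | h
      · exact Or.inl h
      · exact Or.inr (List.mem_append_right _ h)
  · refine (card_le_card (t := l.toFinset ∩ X) ?_).trans (by omega)
    intro v hv
    obtain ⟨h1, h2⟩ := mem_inter.1 hv
    rw [hmem] at h1
    rcases h1 with h | h
    · exact absurd h2 (hX v (List.mem_append_left _ h))
    · exact mem_inter.2 ⟨List.mem_toFinset.2 h, h2⟩
end A1
end TC

namespace TC
section A2
variable {V : Type} [Fintype V] [DecidableEq V]

theorem cycs {ι : Type} [DecidableEq ι] (H F : ι → Finset (Fin 5 → V)) (hFH : ∀ q, F q ⊆ H q)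
    (hrot : ∀ q, ∀ y ∈ F q, rt y ∈ F q) (X : Finset V) (L B k : ℕ)
    (hC : ∀ q, CP (H q) (F q) X L B) (E : ι → Finset V → Prop) (hHE : ∀ q, ∀ y ∈ H q, E q (univ.image y))
    (Q : ι → List (List (Fin 5 → V)))
    (hQ : ∀ q, ∀ Y ∈ Q q, Y ≠ [] ∧ RP (F q) Y) (hnd : ∀ q, ((Q q).flatMap vts).Nodup)
    (hX : ∀ q, ∀ v ∈ (Q q).flatMap vts, v ∉ X) (hlen : ∀ q, (Q q).length ≤ k)
    (hdis : ∀ q q', q ≠ q' → ∀ v ∈ (Q q).flatMap vts, v ∉ (Q q').flatMap vts) (qs : List ι) (hqs : qs.Nodup) :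
    ∀ S : Finset V, S.card + qs.length * ((k + 1) * L) ≤ B →
    ∃ W : ι → Finset V, (∀ q ∈ qs, IsTightCycleSetOn 5 (E q) (W q) ∧ (∀ v ∈ (Q q).flatMap vts, v ∈ W q) ∧
        (∀ v ∈ W q, (v ∈ X ∧ v ∉ S) ∨ v ∈ (Q q).flatMap vts)) ∧
        ∀ q ∈ qs, ∀ q' ∈ qs, q ≠ q' → Disjoint (W q) (W q') := by
  induction qs with
  | nil => intro S _; exact ⟨fun _ => ∅, by simp, by simp⟩
  | cons q qs ih =>
    intro S hS
    obtain ⟨hq, hqs'⟩ := List.nodup_cons.1 hqs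
    rw [List.length_cons, add_mul, one_mul] at hS
    have hk : ((Q q).length + 1) * L ≤ (k + 1) * L := Nat.mul_le_mul_right _ (by have := hlen q; omega)
    obtain ⟨W0, w1, w2, w3, w4⟩ := cyc (H q) (F q) (hFH q) (hrot q) X L B (hC q) (E q) (hHE q) (Q q) S (hQ q) (hnd q) (hX q)
      (by omega)
    obtain ⟨W, hW1, hW2⟩ := ih hqs' (S ∪ (W0 ∩ X)) (by
      have := card_union_le S (W0 ∩ X)
      omega)
    have hne : ∀ q' ∈ qs, q' ≠ q := fun q' h h' => hq (h' ▸ h)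
    have hd0 : ∀ q' ∈ qs, Disjoint W0 (W q') := by
      intro q' hq'
      rw [disjoint_left]
      intro v hv hv'
      rcases (hW1 q' hq').2.2 v hv' with h | h
      · exact h.2 (mem_union_right _ (mem_inter.2 ⟨hv, h.1⟩))
      · rcases w3 v hv with h' | h'
        · exact hX q' v h h'.1
        · exact hdis q q' (hne q' hq').symm v h' h
    refine ⟨Function.update W q W0, ?_, ?_⟩
    · intro q' hq'
      rcases List.mem_cons.1 hq' with rfl | hq'
      · rw [Function.update_self]; exact ⟨w1, w2, w3⟩
      · rw [Function.update_of_ne (hne q' hq')]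
        obtain ⟨a, b, c⟩ := hW1 q' hq'
        refine ⟨a, b, fun v hv => ?_⟩
        rcases c v hv with h | h
        · exact Or.inl ⟨h.1, fun h' => h.2 (mem_union_left _ h')⟩
        · exact Or.inr h
    · intro a ha b hb hab
      rcases List.mem_cons.1 ha with rfl | ha'
      · rcases List.mem_cons.1 hb with rfl | hb'
        · exact absurd rfl hab
        · rw [Function.update_self, Function.update_of_ne (hne b hb')]; exact hd0 b hb'
      · rcases List.mem_cons.1 hb with rfl | hb'
        · rw [Function.update_self, Function.update_of_ne (hne a ha')]; exact (hd0 a ha').symm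
        · rw [Function.update_of_ne (hne a ha'), Function.update_of_ne (hne b hb')]
          exact hW2 a ha' b hb' hab

theorem pick (c' : ℝ) (L B : ℕ) (hB : ((L : ℝ) * L + B * L) < c' * Fintype.card V) (hV : 0 < Fintype.card V)
    (j : ℕ) (hj : j ≤ L) (G : Finset (Fin j → V)) (hG : c' * (Fintype.card V : ℝ) ^ j ≤ G.card)
    (S : Finset V) (hS : S.card ≤ B) : ∃ z ∈ G, Function.Injective z ∧ ∀ i, z i ∉ S := by
  by_contra! hcon
  have hsub : G ⊆ ((univ : Finset (Fin j × Fin j)).filter fun p => p.1 ≠ p.2).biUnion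
      (fun p => univ.filter fun z : Fin j → V => z p.1 = z p.2) ∪
      S.biUnion (fun v => univ.filter fun z : Fin j → V => ∃ i, z i = v) := by
    intro z hz
    by_cases hi : Function.Injective z
    · obtain ⟨i, h⟩ := hcon z hz hi
      exact mem_union_right _ (mem_biUnion.2 ⟨z i, h, mem_filter.2 ⟨mem_univ _, i, rfl⟩⟩)
    · simp only [Function.Injective] at hi
      push Not at hi
      obtain ⟨a, b, h1, h2⟩ := hi
      exact mem_union_left _ (mem_biUnion.2 ⟨(a, b), by simpa using h2, by simpa using h1⟩)
  set n := Fintype.card V with hn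
  have hcard : G.card * n ≤ (L * L + B * L) * n ^ j := by
    have h1 := (card_le_card hsub).trans (card_union_le _ _)
    have h2 : (((univ : Finset (Fin j × Fin j)).filter fun p => p.1 ≠ p.2).biUnion
      (fun p => univ.filter fun z : Fin j → V => z p.1 = z p.2)).card * n ≤ L * L * n ^ j := by
      refine (Nat.mul_le_mul_right _ card_biUnion_le).trans ?_
      rw [sum_mul]
      refine (sum_le_card_nsmul _ _ (n ^ j) fun p hp => hit_dup j p.1 p.2 (mem_filter.1 hp).2).trans ?_
      rw [smul_eq_mul]
      refine Nat.mul_le_mul_right _ ((card_le_univ _).trans ?_)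
      rw [Fintype.card_prod, Fintype.card_fin]
      exact Nat.mul_le_mul hj hj
    have h3 : (S.biUnion (fun v => univ.filter fun z : Fin j → V => ∃ i, z i = v)).card * n ≤ B * L * n ^ j := by
      refine (Nat.mul_le_mul_right _ card_biUnion_le).trans ?_
      rw [sum_mul]
      refine (sum_le_card_nsmul _ _ (j * n ^ j) fun v _ => hit_v j v).trans ?_
      rw [smul_eq_mul, mul_assoc]
      exact Nat.mul_le_mul hS (Nat.mul_le_mul_right _ hj)
    calc G.card * n ≤ _ := Nat.mul_le_mul_right _ h1
      _ ≤ _ := by rw [add_mul, add_mul]; exact Nat.add_le_add h2 h3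
  have hcard' : (G.card : ℝ) * n ≤ (L * L + B * L) * (n:ℝ) ^ j := by exact_mod_cast hcard
  have hnp : (0:ℝ) < n := by exact_mod_cast hV
  have h1 : c' * (n:ℝ) ^ j * n ≤ G.card * n := mul_le_mul_of_nonneg_right hG hnp.le
  have h2 : ((L : ℝ) * L + B * L) * (n:ℝ) ^ j < c' * n * (n:ℝ) ^ j := mul_lt_mul_of_pos_right hB (by positivity)
  nlinarith
end A2
end TC

namespace TC
section A3

theorem resv (δ ρ : ℝ) (hδ : 0 < δ) (hδ1 : δ ≤ 1) (hρ : 0 < ρ) :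
    ∃ (K L : ℕ) (c' : ℝ) (n0 : ℕ), 0 < c' ∧ (K : ℝ) ≤ 40000 / δ ^ 4 ∧
      ∀ (V : Type) [Fintype V] [DecidableEq V], n0 ≤ Fintype.card V → 0 < Fintype.card V →
      ∀ H : Bool → Finset (Fin 5 → V), (∀ b, ∀ y ∈ H b, rt y ∈ H b) →
      ∃ (ℓ : Bool → (Fin 4 → V) → Fin K) (H' : Bool → Finset (Fin 5 → V)) (X : Finset V),
        (∀ b, H' b ⊆ H b) ∧ (∀ b, ∀ y ∈ H' b, rt y ∈ H' b) ∧
        (∀ b, ((H b).card : ℝ) ≤ (H' b).card + δ * (Fintype.card V : ℝ) ^ 5) ∧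
        (∀ b, ∀ y ∈ H' b, ℓ b (ini y) = ℓ b (tl y)) ∧ (X.card : ℝ) ≤ ρ * Fintype.card V ∧
        ∀ b, ∀ y ∈ H' b, ∀ y' ∈ H' b, ℓ b (ini y) = ℓ b (ini y') →
          ∃ j ≤ L, c' * (Fintype.card V : ℝ) ^ j ≤
            ((univ.filter fun z : Fin j → V => TWl (H b) (ini y) (List.ofFn z ++ List.ofFn (ini y'))).filter
              fun z => ∀ i, z i ∈ X).card := by
  obtain ⟨K, L, c, hc, hK, hconn⟩ := conn δ hδ hδ1
  obtain ⟨c', hc', n0, hres⟩ := reservoir L (min c 1) ρ (lt_min hc one_pos) hρ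
  refine ⟨K, L, c', n0, hc', hK, fun V _ _ hn hV H hrot => ?_⟩
  choose ℓ H' h1 h2 h3 h4 h5 h6 using fun b => hconn V hV (H b) (hrot b)
  have hch : ∀ t : Bool × (Fin 4 → V) × (Fin 4 → V), ∃ p : Σ j : ℕ, Finset (Fin j → V), p.1 ≤ L ∧
      min c 1 * (Fintype.card V : ℝ) ^ p.1 ≤ p.2.card ∧
      ((∃ j ≤ L, c * (Fintype.card V : ℝ) ^ j ≤ cnt (H t.1) j t.2.1 t.2.2) →
        p.2 = univ.filter fun z : Fin p.1 → V => TWl (H t.1) t.2.1 (List.ofFn z ++ List.ofFn t.2.2)) := by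
    intro t
    by_cases h : ∃ j ≤ L, c * (Fintype.card V : ℝ) ^ j ≤ cnt (H t.1) j t.2.1 t.2.2
    · obtain ⟨j, hj, hjc⟩ := h
      refine ⟨⟨j, univ.filter fun z : Fin j → V => TWl (H t.1) t.2.1 (List.ofFn z ++ List.ofFn t.2.2)⟩, hj, ?_, fun _ => rfl⟩
      exact (mul_le_mul_of_nonneg_right (min_le_left _ _) (by positivity)).trans hjc
    · refine ⟨⟨0, univ⟩, Nat.zero_le _, ?_, fun h' => absurd h' h⟩
      simp
  choose p hp1 hp2 hp3 using hch
  obtain ⟨X, hX1, hX2⟩ := hres V (Bool × (Fin 4 → V) × (Fin 4 → V)) hn hV (by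
    simp only [Fintype.card_prod, Fintype.card_bool, Fintype.card_fun, Fintype.card_fin]
    push_cast
    apply le_of_eq; ring) (fun t => (p t).1) (fun t => (p t).2) hp1 hp2
  refine ⟨fun b f => ⟨ℓ b f, h1 b f⟩, H', X, h2, h3, h4, fun b y hy => Fin.ext (h5 b y hy), hX1, ?_⟩
  intro b y hy y' hy' he
  have hex := h6 b y hy y' hy' (congrArg Fin.val he)
  have e := hp3 (b, ini y, ini y') hex
  refine ⟨(p (b, ini y, ini y')).1, hp1 _, ?_⟩
  have := hX2 (b, ini y, ini y')
  simp only at this e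
  rw [e] at this
  exact this

theorem TWl_map {U V : Type} [Fintype U] [DecidableEq U] [Fintype V] [DecidableEq V] (x : U → V)
    (F : Finset (Fin 5 → U)) (G : Finset (Fin 5 → V)) (h : ∀ y ∈ F, x ∘ y ∈ G) (l : List U) :
    ∀ f, TWl F f l → TWl G (x ∘ f) (l.map x) := by
  induction l with
  | nil => intro _ _; trivial
  | cons a l ih =>
    intro f hf
    refine ⟨?_, ?_⟩
    · have := h _ hf.1
      convert this using 1
      funext i; fin_cases i <;> rfl
    · have := ih _ hf.2
      convert this using 1
      funext i; fin_cases i <;> rfl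

theorem RP_map {U V : Type} [Fintype U] [DecidableEq U] [Fintype V] [DecidableEq V] (x : U → V)
    (F : Finset (Fin 5 → U)) (G : Finset (Fin 5 → V)) (h : ∀ y ∈ F, x ∘ y ∈ G) (Y : List (Fin 5 → U))
    (hY : RP F Y) : RP G (Y.map fun y => x ∘ y) := by
  refine ⟨?_, ?_⟩
  · intro y hy
    obtain ⟨z, hz, rfl⟩ := List.mem_map.1 hy
    exact h z (hY.1 z hz)
  · rw [List.isChain_map]
    refine hY.2.imp ?_
    intro a b hab
    have := TWl_map x F G h _ _ hab
    rw [List.map_ofFn] at this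
    convert this using 1
    funext i; fin_cases i <;> rfl

theorem vts_map {U V : Type} (x : U → V) (Y : List (Fin 5 → U)) :
    vts (Y.map fun y => x ∘ y) = (vts Y).map x := by
  simp only [vts, List.flatMap_map, List.map_flatMap, List.map_ofFn]

theorem noninj {U : Type} [Fintype U] [DecidableEq U] :
    (univ.filter fun y : Fin 5 → U => ¬ Function.Injective y).card * Fintype.card U ≤ 25 * Fintype.card U ^ 5 := by
  have hsub : (univ.filter fun y : Fin 5 → U => ¬ Function.Injective y) ⊆
      ((univ : Finset (Fin 5 × Fin 5)).filter fun p => p.1 ≠ p.2).biUnion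
      (fun p => univ.filter fun z : Fin 5 → U => z p.1 = z p.2) := by
    intro z hz
    have hi := (mem_filter.1 hz).2
    simp only [Function.Injective] at hi
    push Not at hi
    obtain ⟨a, b, h1, h2⟩ := hi
    exact (mem_biUnion.2 ⟨(a, b), by simpa using h2, by simpa using h1⟩)
  refine (Nat.mul_le_mul_right _ ((card_le_card hsub).trans card_biUnion_le)).trans ?_
  rw [sum_mul]
  refine (sum_le_card_nsmul _ _ (Fintype.card U ^ 5) fun p hp => hit_dup 5 p.1 p.2 (mem_filter.1 hp).2).trans ?_
  rw [smul_eq_mul]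
  refine Nat.mul_le_mul_right _ ((card_le_univ _).trans ?_)
  simp

theorem missing {V : Type} [Fintype V] [DecidableEq V] (X : Finset V) (c : Finset V → Bool) (δ : ℝ) (hδ : 0 < δ)
    (H' : Bool → Finset (Fin 5 → V))
    (h1 : ∀ b, H' b ⊆ univ.filter fun y => Function.Injective y ∧ c (univ.image y) = b)
    (h2 : ∀ b, ((univ.filter fun y : Fin 5 → V => Function.Injective y ∧ c (univ.image y) = b).card : ℝ) ≤
      (H' b).card + δ * (Fintype.card V : ℝ) ^ 5)
    (hX : (X.card : ℝ) ≤ 1 / 20 * Fintype.card V) (hn : 25 / δ < Fintype.card V) (hV : 0 < Fintype.card V) :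
    ((univ.filter fun y : Fin 5 → {v // v ∉ X} => Function.Injective y →
      (Subtype.val ∘ y) ∉ H' (c ((univ.image y).image Subtype.val))).card : ℝ) ≤
      4 * δ * (Fintype.card {v // v ∉ X} : ℝ) ^ 5 := by
  set n : ℝ := (Fintype.card V : ℝ) with hnd
  have hnp : 0 < n := by rw [hnd]; exact_mod_cast hV
  set u : ℝ := (Fintype.card {v // v ∉ X} : ℝ) with hud
  have hu : u = n - X.card := by
    have h : Fintype.card {v // v ∉ X} + X.card = Fintype.card V := by
      have := Fintype.card_subtype_compl (fun v => v ∈ X)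
      have h2 : Fintype.card {v // v ∈ X} = X.card := by simp
      have h3 : X.card ≤ Fintype.card V := card_le_univ X
      omega
    rw [hud, hnd, ← h]; push_cast; ring
  have hu1 : 19 / 20 * n ≤ u := by rw [hu]; linarith
  have hu2 : u ≤ n := by rw [hu]; linarith [(Nat.cast_nonneg X.card : (0:ℝ) ≤ X.card)]
  have hup : 0 < u := by linarith
  set A := (univ.filter fun y : Fin 5 → {v // v ∉ X} => Function.Injective y →
      (Subtype.val ∘ y) ∉ H' (c ((univ.image y).image Subtype.val))) with hA
  set N0 := (univ.filter fun y : Fin 5 → {v // v ∉ X} => ¬ Function.Injective y) with hN0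
  set D : Finset (Fin 5 → V) := univ.biUnion fun b : Bool =>
    (univ.filter fun y : Fin 5 → V => Function.Injective y ∧ c (univ.image y) = b) \ H' b with hD
  have hAsub : A.card ≤ N0.card + D.card := by
    have hs : A ⊆ N0 ∪ univ.filter fun y : Fin 5 → {v // v ∉ X} => Subtype.val ∘ y ∈ D := by
      intro y hy
      have hy := (mem_filter.1 hy).2
      by_cases hi : Function.Injective y
      · refine mem_union_right _ (mem_filter.2 ⟨mem_univ _, mem_biUnion.2 ⟨_, mem_univ _, mem_sdiff.2 ⟨?_, hy hi⟩⟩⟩)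
        refine mem_filter.2 ⟨mem_univ _, Subtype.val_injective.comp hi, ?_⟩
        rw [image_image]
      · exact mem_union_left _ (mem_filter.2 ⟨mem_univ _, hi⟩)
    refine (card_le_card hs).trans ((card_union_le _ _).trans (Nat.add_le_add_left ?_ _))
    refine card_le_card_of_injOn (fun y => Subtype.val ∘ y) ?_ ?_
    · intro y hy
      simpa using hy
    · intro y _ z _ h
      funext i
      exact Subtype.ext (congrFun h i)
  have hDc : (D.card : ℝ) ≤ 2 * δ * n ^ 5 := by
    have h3 : ∀ b, ((((univ.filter fun y : Fin 5 → V => Function.Injective y ∧ c (univ.image y) = b) \ H' b).card : ℕ) : ℝ) ≤ δ * n ^ 5 := by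
      intro b
      rw [card_sdiff_of_subset (h1 b), Nat.cast_sub (card_le_card (h1 b))]
      linarith [h2 b]
    have h4 : (D.card : ℝ) ≤ ∑ b : Bool, ((((univ.filter fun y : Fin 5 → V => Function.Injective y ∧ c (univ.image y) = b) \ H' b).card : ℕ) : ℝ) := by
      rw [← Nat.cast_sum]
      exact_mod_cast card_biUnion_le
    refine h4.trans ((sum_le_sum fun b _ => h3 b).trans ?_)
    simp only [sum_const, card_univ, Fintype.card_bool, nsmul_eq_mul]
    push_cast
    linarith
  have hNc : (N0.card : ℝ) ≤ 25 * u ^ 4 := by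
    have h := noninj (U := {v // v ∉ X})
    have h' : (N0.card : ℝ) * u ≤ 25 * u ^ 5 := by rw [hud]; exact_mod_cast h
    refine le_of_mul_le_mul_right ?_ hup
    calc (N0.card : ℝ) * u ≤ 25 * u ^ 5 := h'
      _ = 25 * u ^ 4 * u := by ring
  have hAc : (A.card : ℝ) ≤ 25 * u ^ 4 + 2 * δ * n ^ 5 := by
    have : (A.card : ℝ) ≤ N0.card + D.card := by exact_mod_cast hAsub
    linarith
  have h5 : 25 * u ^ 4 ≤ δ * n ^ 5 := by
    rw [div_lt_iff₀ hδ] at hn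
    calc 25 * u ^ 4 ≤ 25 * n ^ 4 := by gcongr
      _ ≤ (n * δ) * n ^ 4 := by gcongr
      _ = δ * n ^ 5 := by ring
  have h6 : (19 / 20 * n) ^ 5 ≤ u ^ 5 := by gcongr
  have h7 : 3 * n ^ 5 ≤ 4 * u ^ 5 := by
    have : 3 * n ^ 5 ≤ 4 * (19 / 20 * n) ^ 5 := by
      rw [mul_pow]
      have : 0 ≤ n ^ 5 := by positivity
      norm_num
      linarith
    linarith
  have h8 := mul_le_mul_of_nonneg_left h7 hδ.le
  linarith
end A3
end TC

namespace TC
section A4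

theorem Q_vts {U V ι : Type} (x : U → V) (P : List (ι × List (Fin 5 → U))) :
    (P.map fun a => a.2.map fun y => x ∘ y).flatMap vts = (avts P).map x := by
  simp only [avts, List.flatMap_map, List.map_flatMap, vts_map]

theorem avts_length {U ι : Type} [Fintype U] [DecidableEq U] (t : ℕ) (P : List (ι × List (Fin 5 → U))) (h : ∀ x ∈ P, x.2.length = t) :
    (avts P).length = 5 * t * P.length := by
  induction P with
  | nil => rfl
  | cons a P ih =>
    have := ih fun x hx => h x (List.mem_cons_of_mem _ hx)
    rw [avts_cons, List.length_append, vts_length, h a (by simp), this, List.length_cons]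
    ring

theorem main (ε : ℝ) (hε : 0 < ε) :
    ∃ n₁ : ℕ, ∀ (V : Type) [Fintype V] [DecidableEq V], n₁ ≤ Fintype.card V → ∀ c : Finset V → Bool,
      ∃ W : Bool × Bool → Finset V,
        (∀ i j, i ≠ j → Disjoint (W i) (W j)) ∧
        (∀ i, IsTightCycleSetOn 5 (fun e => c e = i.1) (W i)) ∧
        (Fintype.card V : ℝ) - ε * Fintype.card V ≤ (((univ : Finset (Bool × Bool)).biUnion W).card : ℝ) := by
  set e' : ℝ := min ε 1 with he'
  have he0 : 0 < e' := lt_min hε one_pos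
  have he1 : e' ≤ 1 := min_le_right _ _
  have heε : e' ≤ ε := min_le_left _ _
  obtain ⟨N, δ, hN, hδ, hδ1, hfrac⟩ := fracW (e' / 40) (by positivity)
  obtain ⟨K, L, c', n1, hc', hK, hres⟩ := resv δ (e' / 20) hδ hδ1 (by positivity)
  obtain ⟨t, ht⟩ := exists_nat_gt (2 * (L:ℝ) ^ 2 / c' + 1)
  have htpos : (1:ℝ) < t := by
    have : 0 ≤ 2 * (L:ℝ) ^ 2 / c' := by positivity
    linarith
  have ht1 : 1 ≤ t := by exact_mod_cast htpos.le
  have htL : 2 * (L:ℝ) ^ 2 ≤ c' * t := by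
    have h : 2 * (L:ℝ) ^ 2 / c' ≤ t := by linarith
    rw [div_le_iff₀ hc'] at h; linarith
  obtain ⟨n2, hpack⟩ := pack (Bool × Bool) (e' / 40) ((N:ℝ) ^ 4) (by positivity) (by linarith)
    (by have : (0:ℝ) < N := by exact_mod_cast hN
        positivity) t ht1
  obtain ⟨n3, hn3⟩ := exists_nat_gt (25 / δ)
  obtain ⟨n4, hn4⟩ := exists_nat_gt (10 * (L:ℝ) ^ 2 / c')
  refine ⟨n1 + 2 * n2 + n3 + n4 + 1, fun V _ _ hn c => ?_⟩
  have hV : 0 < Fintype.card V := by omega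
  set n : ℝ := (Fintype.card V : ℝ) with hnd
  have hnp : 0 < n := by rw [hnd]; exact_mod_cast hV
  have hn3' : 25 / δ < n := hn3.trans_le (by rw [hnd]; exact_mod_cast (by omega : n3 ≤ Fintype.card V))
  have hn4' : 10 * (L:ℝ) ^ 2 < c' * n := by
    have h : 10 * (L:ℝ) ^ 2 / c' < n := hn4.trans_le (by rw [hnd]; exact_mod_cast (by omega : n4 ≤ Fintype.card V))
    rw [div_lt_iff₀ hc'] at h; linarith
  set H : Bool → Finset (Fin 5 → V) := fun b => univ.filter fun y => Function.Injective y ∧ c (univ.image y) = b with hH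
  have hrt : ∀ y : Fin 5 → V, univ.image (rt y) = univ.image y := by
    intro y
    ext v
    simp only [mem_image, mem_univ, true_and, rt]
    constructor
    · rintro ⟨i, h⟩; exact ⟨i + 1, h⟩
    · rintro ⟨i, h⟩; exact ⟨i - 1, by simpa using h⟩
  have hrti : ∀ y : Fin 5 → V, Function.Injective y → Function.Injective (rt y) := by
    intro y hy i j h
    have := hy h
    simpa using this
  obtain ⟨ℓ, H', X, hH1, hH2, hH3, hH4, hX, hH5⟩ := hres V (by omega) hV H (by
    intro b y hy
    obtain ⟨a1, a2⟩ := (mem_filter.1 hy).2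
    exact mem_filter.2 ⟨mem_univ _, hrti y a1, by rw [hrt]; exact a2⟩)
  have hX' : (X.card : ℝ) ≤ 1 / 20 * n := by
    refine hX.trans (mul_le_mul_of_nonneg_right (by linarith) hnp.le)
  have hu : (Fintype.card {v // v ∉ X} : ℝ) = n - X.card := by
    have h : Fintype.card {v // v ∉ X} + X.card = Fintype.card V := by
      have := Fintype.card_subtype_compl (fun v => v ∈ X)
      have h2 : Fintype.card {v // v ∈ X} = X.card := by simp
      have h3 : X.card ≤ Fintype.card V := card_le_univ X
      omega
    rw [hnd, ← h]; push_cast; ring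
  set u : ℝ := (Fintype.card {v // v ∉ X} : ℝ) with hud
  have hu1 : 19 / 20 * n ≤ u := by rw [hu]; linarith
  have hup : 0 < u := by linarith
  have hUpos : 0 < Fintype.card {v // v ∉ X} := by rw [hud] at hup; exact_mod_cast hup
  have hUn2 : n2 ≤ Fintype.card {v // v ∉ X} := by
    have h : (2:ℝ) * n2 ≤ n := by rw [hnd]; exact_mod_cast (by omega : 2 * n2 ≤ Fintype.card V)
    have : (n2:ℝ) ≤ u := by linarith
    rw [hud] at this; exact_mod_cast this
  have hKpos : 0 < K := by
    obtain ⟨v⟩ := Fintype.card_pos_iff.1 hV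
    exact (Nat.zero_le _).trans_lt (ℓ true fun _ => v).2
  set HU : Bool → Finset (Fin 5 → {v // v ∉ X}) := fun b => univ.filter fun y => Subtype.val ∘ y ∈ H' b with hHU
  set ℓU : Bool → (Fin 4 → {v // v ∉ X}) → Fin K := fun b f => ℓ b (Subtype.val ∘ f) with hℓU
  have hini : ∀ y : Fin 5 → {v // v ∉ X}, ini (Subtype.val ∘ y) = Subtype.val ∘ ini y := fun y => ini_comp _ _
  have htl : ∀ y : Fin 5 → {v // v ∉ X}, tl (Subtype.val ∘ y) = Subtype.val ∘ tl y := by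
    intro y; funext i; fin_cases i <;> rfl
  have hHUl : ∀ b, ∀ y ∈ HU b, ℓU b (ini y) = ℓU b (tl y) := by
    intro b y hy
    have := hH4 b _ (mem_filter.1 hy).2
    rw [hini, htl] at this
    exact this
  obtain ⟨Λ, M, W, w1, w2, w3, w4, w5⟩ := hfrac K hKpos hK {v // v ∉ X} hUpos HU ℓU (fun e => c (e.image Subtype.val)) hHUl (by
    have := missing X c δ hδ H' hH1 hH3 hX' hn3' hV
    simpa [hHU] using this)
  have hFU : ∀ q, ∀ y ∈ FQ HU ℓU Λ M q, Subtype.val ∘ y ∈ FQ H' ℓ Λ M q := by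
    intro q y hy
    obtain ⟨a1, a2⟩ := mem_filter.1 hy
    refine mem_filter.2 ⟨(mem_filter.1 a1).2, ?_⟩
    rw [hini]; exact a2
  obtain ⟨P, hP1, hP2, hP3⟩ := hpack {v // v ∉ X} hUn2 hUpos (FQ HU ℓU Λ M) W (by
      intro q y hy
      obtain ⟨a1, a2⟩ := mem_filter.1 hy
      refine mem_filter.2 ⟨mem_filter.2 ⟨mem_univ _, hH2 _ _ (mem_filter.1 a1).2⟩, ?_⟩
      rw [ini_rt, ← hHUl _ _ a1]; exact a2) (by
      intro q y hy
      obtain ⟨a1, a2⟩ := mem_filter.1 hy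
      have := (mem_filter.1 (hH1 _ (mem_filter.1 a1).2)).2.1
      exact Function.Injective.of_comp this) w1 w2 (by
      intro v; convert w3 v) w4 w5
  have hlenP : (avts P).length = 5 * t * P.length := avts_length t P fun x hx => (hP1 x hx).1
  have hPle : 5 * t * P.length ≤ Fintype.card V := by
    rw [← hlenP]
    refine (List.Nodup.length_le_card hP2).trans ?_
    exact Fintype.card_le_of_injective _ Subtype.val_injective
  have hPle' : 5 * (t:ℝ) * P.length ≤ n := by rw [hnd]; exact_mod_cast hPle
  set k := P.length with hk
  set B : ℕ := 4 * ((k + 1) * L) with hB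
  have hBL : (L:ℝ) * L + B * L < c' * n := by
    rw [hB]; push_cast
    have h1 : 2 * (L:ℝ) ^ 2 * k ≤ c' * t * k := mul_le_mul_of_nonneg_right htL (Nat.cast_nonneg _)
    have h2 : c' * (5 * (t:ℝ) * k) ≤ c' * n := mul_le_mul_of_nonneg_left hPle' hc'.le
    nlinarith
  have hCP : ∀ q, CP (H q.1) (FQ H' ℓ Λ M q) X L B := by
    intro q y hy y' hy' S hS
    obtain ⟨a1, a2⟩ := mem_filter.1 hy
    obtain ⟨b1, b2⟩ := mem_filter.1 hy'
    obtain ⟨j, hj, hjc⟩ := hH5 q.1 y a1 y' b1 (a2.trans b2.symm)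
    obtain ⟨z, hz1, hz2, hz3⟩ := pick c' L B hBL hV j hj _ hjc S hS
    obtain ⟨z4, z5⟩ := mem_filter.1 hz1
    refine ⟨List.ofFn z, by simpa using hj, List.nodup_ofFn.2 hz2, ?_, (mem_filter.1 z4).2⟩
    intro v hv
    rw [List.mem_ofFn] at hv
    obtain ⟨i, rfl⟩ := hv
    exact ⟨z5 i, hz3 i⟩
  set Q : Bool × Bool → List (List (Fin 5 → V)) := fun q =>
    (P.filter fun x => x.1 = q).map fun a => a.2.map fun y => Subtype.val ∘ y with hQ
  have hQv : ∀ q, (Q q).flatMap vts = (avts (P.filter fun x => x.1 = q)).map Subtype.val := fun q => Q_vts _ _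
  obtain ⟨nd1, nd2⟩ := List.nodup_flatMap.1 hP2
  obtain ⟨W', hW1, hW2⟩ := cycs (fun q => H q.1) (FQ H' ℓ Λ M) (by
      intro q; exact (filter_subset _ _).trans (hH1 q.1)) (by
      intro q y hy
      obtain ⟨a1, a2⟩ := mem_filter.1 hy
      refine mem_filter.2 ⟨hH2 _ _ a1, ?_⟩
      rw [ini_rt, ← hH4 _ _ a1]; exact a2) X L B k hCP (fun q e => c e = q.1) (by
      intro q y hy; exact (mem_filter.1 hy).2.2) Q (by
      intro q Y hY
      obtain ⟨a, ha, rfl⟩ := List.mem_map.1 hY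
      obtain ⟨ha1, ha2⟩ := List.mem_filter.1 ha
      have ha3 : a.1 = q := by simpa using ha2
      obtain ⟨h1, h2⟩ := hP1 a ha1
      refine ⟨?_, ?_⟩
      · intro h
        have : a.2.length = 0 := by rw [List.map_eq_nil_iff.1 h]; rfl
        omega
      · rw [ha3] at h2
        exact RP_map _ _ _ (hFU q) _ h2) (by
      intro q
      rw [hQv]
      exact List.Nodup.map Subtype.val_injective (hP2.sublist (List.filter_sublist.flatMap _))) (by
      intro q v hv
      rw [hQv] at hv
      obtain ⟨w, _, rfl⟩ := List.mem_map.1 hv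
      exact w.2) (by
      intro q
      simp only [hQ, List.length_map]
      exact List.length_filter_le _ _) (by
      intro q q' hqq v hv hv'
      rw [hQv] at hv hv'
      obtain ⟨w, hw, rfl⟩ := List.mem_map.1 hv
      obtain ⟨w', hw', he⟩ := List.mem_map.1 hv'
      have := Subtype.val_injective he
      subst this
      obtain ⟨a, ha, haw⟩ := List.mem_flatMap.1 hw
      obtain ⟨b, hb, hbw⟩ := List.mem_flatMap.1 hw'
      obtain ⟨a1, a2⟩ := List.mem_filter.1 ha
      obtain ⟨b1, b2⟩ := List.mem_filter.1 hb
      have a3 : a.1 = q := by simpa using a2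
      have b3 : b.1 = q' := by simpa using b2
      have hab : a ≠ b := by
        rintro rfl; exact hqq (a3.symm.trans b3)
      have : Std.Symm (Function.onFun List.Disjoint fun x : (Bool × Bool) × List (Fin 5 → {v // v ∉ X}) => vts x.2) :=
        ⟨fun _ _ h => List.Disjoint.symm h⟩
      exact (nd2.forall a1 b1 hab) haw hbw)
      [(false, false), (false, true), (true, false), (true, true)] (by decide) ∅ (by simp [hB])
  have hall : ∀ q : Bool × Bool, q ∈ [(false, false), (false, true), (true, false), (true, true)] := by decide
  refine ⟨W', fun i j hij => hW2 i (hall i) j (hall j) hij, fun i => (hW1 i (hall i)).1, ?_⟩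
  have hcov : ((avts P).map Subtype.val).toFinset ⊆ (univ : Finset (Bool × Bool)).biUnion W' := by
    intro v hv
    rw [List.mem_toFinset] at hv
    obtain ⟨w, hw, rfl⟩ := List.mem_map.1 hv
    obtain ⟨a, ha, haw⟩ := List.mem_flatMap.1 hw
    refine mem_biUnion.2 ⟨a.1, mem_univ _, (hW1 a.1 (hall _)).2.1 _ ?_⟩
    rw [hQv]
    exact List.mem_map.2 ⟨w, List.mem_flatMap.2 ⟨a, List.mem_filter.2 ⟨ha, by simp⟩, haw⟩, rfl⟩
  have hcard := card_le_card hcov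
  rw [List.toFinset_card_of_nodup (List.Nodup.map Subtype.val_injective hP2), List.length_map, hlenP] at hcard
  have hcard' : 5 * (t:ℝ) * k ≤ (((univ : Finset (Bool × Bool)).biUnion W').card : ℝ) := by exact_mod_cast hcard
  refine le_trans ?_ hcard'
  refine le_trans ?_ hP3
  have h1 : n - e' / 20 * n ≤ u := by rw [hu]; linarith
  have h2 := mul_le_mul_of_nonneg_left h1 (show 0 ≤ 1 - 5 * (e' / 40) by linarith)
  have h3 : e' * n ≤ ε * n := mul_le_mul_of_nonneg_right heε hnp.le
  have h4 : 0 ≤ e' * (e' * n) := by positivity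
  nlinarith
end A4
end TC

theorem stmt2 (ε : ℝ) (hε : 0 < ε) :
    ∃ n₁ : ℕ, ∀ n : ℕ, n₁ ≤ n → ∀ c : Finset (Fin n) → Bool,
      ∃ (W : Fin 4 → Finset (Fin n)) (b : Fin 4 → Bool),
        (∀ i j, i ≠ j → Disjoint (W i) (W j)) ∧
        (∀ i, IsTightCycleSetOn 5 (fun e => c e = b i) (W i)) ∧
        (n : ℝ) - ε * n ≤ (((Finset.univ : Finset (Fin 4)).biUnion W).card : ℝ) := by
  obtain ⟨n₁, h⟩ := TC.main ε hε
  refine ⟨n₁, fun n hn c => ?_⟩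
  obtain ⟨W, h1, h2, h3⟩ := h (Fin n) (by simpa using hn) c
  have e : Fin 4 ≃ Bool × Bool := Fintype.equivOfCardEq (by simp)
  refine ⟨fun i => W (e i), fun i => (e i).1, fun i j hij => h1 _ _ (fun h => hij (e.injective h)), fun i => h2 _, ?_⟩
  rw [Fintype.card_fin] at h3
  refine h3.trans ?_
  have : (univ : Finset (Bool × Bool)).biUnion W ⊆ (univ : Finset (Fin 4)).biUnion fun i => W (e i) := by
    intro v hv
    obtain ⟨q, _, hq⟩ := mem_biUnion.1 hv
    exact mem_biUnion.2 ⟨e.symm q, mem_univ _, by simpa using hq⟩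
  exact_mod_cast card_le_card this
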